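/- For every integer k ≥ 1, the limit as X → ∞ of [ Σ_{d positive odd fundamental discriminant, 1 < d < X} ( f̃(d) / 3^{ω(d)} )^k ] divided by the number of positive odd fundamental discriminants d with 1 < d < X exists and equals (1/192)^k. -/

import Mathlib

open Finset Filter Asymptotics

open scoped Classical

noncomputable section

/-- `D` is a fundamental discriminant: either `D ≡ 1 (mod 4)` and `D` is squarefree,
or `D = 4m` with `m` squarefree and `m ≡ 2, 3 (mod 4)`. -/
def IsFundDisc (D : ℤ) : Prop :=
  (D % 4 = 1 ∧ Squarefree D) ∨
    ∃ m : ℤ, D = 4 * m ∧ Squarefree m ∧ (m % 4 = 2 ∨ m % 4 = 3)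

/-- `ω(d)`, the number of distinct primes dividing `|d|`. -/
def omegaZ (d : ℤ) : ℕ := d.natAbs.primeFactors.card

/-- The Legendre symbol `(m/p)` for odd primes `p`, and the Kronecker symbol at `p = 2`
(`0` if `m` is even, `1` if `m ≡ ±1 (mod 8)`, `-1` if `m ≡ ±3 (mod 8)`). -/
def kron (m : ℤ) (p : ℕ) : ℤ :=
  if p = 2 then
    if m % 2 = 0 then 0 else if m % 8 = 1 ∨ m % 8 = 7 then 1 else -1
  else jacobiSym m p

/-- `α(d) = 1` if `d > 0` and `α(d) = 0` if `d < 0`. -/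
def alphaFD (d : ℤ) : ℕ := if 0 < d then 1 else 0

/-- Ordered triples `(d₁, d₂, d₃)` of pairwise coprime fundamental discriminants,
each `≠ 1`, with `d₁ * d₂ * d₃ = d`. -/
def fdTriples (d : ℤ) : Finset (ℤ × ℤ × ℤ) :=
  (Finset.Icc (-(d.natAbs : ℤ)) (d.natAbs : ℤ) ×ˢ
      Finset.Icc (-(d.natAbs : ℤ)) (d.natAbs : ℤ) ×ˢ
      Finset.Icc (-(d.natAbs : ℤ)) (d.natAbs : ℤ)).filter
    fun t =>
      IsFundDisc t.1 ∧ IsFundDisc t.2.1 ∧ IsFundDisc t.2.2 ∧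
      t.1 ≠ 1 ∧ t.2.1 ≠ 1 ∧ t.2.2 ≠ 1 ∧
      IsCoprime t.1 t.2.1 ∧ IsCoprime t.1 t.2.2 ∧ IsCoprime t.2.1 t.2.2 ∧
      t.1 * t.2.1 * t.2.2 = d

/-- The summand attached to a factorization `d = d₁ d₂ d₃`:
`∏_{p ∣ d₃} (1 + (d₁d₂/p)) · ∏_{p ∣ d₂} (1 + (d₁d₃/p)) · ∏_{p ∣ d₁} (1 + (d₂d₃/p))`. -/
def tripleTerm (t : ℤ × ℤ × ℤ) : ℤ :=
  (∏ p ∈ t.2.2.natAbs.primeFactors, (1 + kron (t.1 * t.2.1) p)) *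
    (∏ p ∈ t.2.1.natAbs.primeFactors, (1 + kron (t.1 * t.2.2) p)) *
    (∏ p ∈ t.1.natAbs.primeFactors, (1 + kron (t.2.1 * t.2.2) p))

/-- `f̃(d) = 2^{-3-α(d)} Σ_{{d₁,d₂,d₃}} (…)`, the sum over *unordered* triples of
pairwise coprime fundamental discriminants `≠ 1` with product `d`.  Since the summand is
symmetric and the entries of any such triple are pairwise distinct, the unordered sum is
one sixth of the ordered sum. -/
def ftilde (d : ℤ) : ℝ :=
  (1 / 2 ^ (3 + alphaFD d) : ℝ) * ((1 : ℝ) / 6) * ∑ t ∈ fdTriples d, (tripleTerm t : ℝ)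

/-- `D⁻(X, n, m)`: fundamental discriminants `d` with `0 < -d < X` and `d ≡ n (mod m)`. -/
def Dminus (X : ℝ) (n m : ℤ) : Finset ℤ :=
  (Finset.Icc (-⌈X⌉) ⌈X⌉).filter fun d =>
    IsFundDisc d ∧ d < 0 ∧ -X < (d : ℝ) ∧ d % m = n % m

/-- `D⁺(X, n, m)`: fundamental discriminants `d` with `0 < d < X` and `d ≡ n (mod m)`. -/
def Dplus (X : ℝ) (n m : ℤ) : Finset ℤ :=
  (Finset.Icc (-⌈X⌉) ⌈X⌉).filter fun d =>
    IsFundDisc d ∧ 0 < d ∧ (d : ℝ) < X ∧ d % m = n % m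

/-- Positive odd fundamental discriminants `d` with `1 < d < X`:
squarefree integers `d > 1` with `d ≡ 1 (mod 4)`. -/
def DposOdd (X : ℝ) : Finset ℤ :=
  (Finset.Icc 0 ⌈X⌉).filter fun d =>
    1 < d ∧ Squarefree d ∧ d % 4 = 1 ∧ (d : ℝ) < X

/-- Exponent of the symbol `(q* / p)` for primes `q`, `p` of colours `a`, `b`. -/
def colorExp (a b : Fin 3 × Bool) : ℕ := if a.1 ≠ b.1 ∧ b.2 = true then 1 else 0

/-- Exponent of the symbol for colours occurring in a `k`-th moment. -/
def colorExpPow (k : ℕ) (u v : Fin k → Fin 3 × Bool) : ℕ := ∑ j, colorExp (u j) (v j)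

/-- All colours with prescribed second components. -/
def colorSlice (k : ℕ) (s : Fin k → Bool) : Finset (Fin k → Fin 3 × Bool) :=
  univ.filter fun u => ∀ j, (u j).2 = s j

theorem card_colorSlice (k : ℕ) (s : Fin k → Bool) : (colorSlice k s).card = 3 ^ k := by
  have : (colorSlice k s) = (univ : Finset (Fin k → Fin 3)).image (fun c j => (c j, s j)) := by
    ext u
    simp only [colorSlice, mem_filter, mem_univ, true_and, mem_image]
    constructor
    · intro h
      exact ⟨fun j => (u j).1, by ext j <;> simp [h]⟩
    · rintro ⟨c, rfl⟩ j
      rfl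
  rw [this, card_image_of_injective]
  · simp
  · intro c c' h
    ext j
    have := congrFun h j
    simp at this
    rw [this]

theorem colorExp_add_eq (a b : Fin 3 × Bool) :
    colorExp a b + colorExp b a = (if a.1 ≠ b.1 then
      (if a.2 = b.2 then (if a.2 = true then 2 else 0) else 1) else 0) := by
  revert a b; decide

theorem colorExpPow_cons (k : ℕ) (a b : Fin 3 × Bool) (u v : Fin k → Fin 3 × Bool) :
    colorExpPow (k + 1) (Fin.cons a u) (Fin.cons b v) = colorExp a b + colorExpPow k u v := by
  simp [colorExpPow, Fin.sum_univ_succ]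

theorem even_link_of_fst_eq (k : ℕ) (u v : Fin k → Fin 3 × Bool) (h : ∀ j, (u j).1 = (v j).1) :
    colorExpPow k u v + colorExpPow k v u = 0 := by
  simp only [colorExpPow, ← Finset.sum_add_distrib]
  refine Finset.sum_eq_zero fun j _ => ?_
  rw [colorExp_add_eq]; simp [h]

theorem even_link_of_snd_eq (k : ℕ) (u v : Fin k → Fin 3 × Bool) (h : ∀ j, (u j).2 = (v j).2) :
    Even (colorExpPow k u v + colorExpPow k v u) := by
  simp only [colorExpPow, ← Finset.sum_add_distrib]
  refine Finset.even_sum _ fun j _ => ?_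
  rw [colorExp_add_eq]; simp [h]
  split_ifs <;> simp

theorem card_eq_sum_fibers (k : ℕ) (U : Finset (Fin (k + 1) → Fin 3 × Bool)) :
    U.card = ∑ s : Bool, ∑ u : Fin k → Fin 3 × Bool,
      (univ.filter fun c : Fin 3 => (Fin.cons (c, s) u : Fin (k + 1) → Fin 3 × Bool) ∈ U).card := by
  have h1 : U.card = ∑ x : Fin (k + 1) → Fin 3 × Bool, if x ∈ U then 1 else 0 := by
    simp
  rw [h1, ← (Fin.consEquiv (fun _ => Fin 3 × Bool)).sum_comp, Fintype.sum_prod_type,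
    Fintype.sum_prod_type, Finset.sum_comm]
  refine Finset.sum_congr rfl fun s _ => ?_
  rw [Finset.sum_comm]
  refine Finset.sum_congr rfl fun u _ => ?_
  rw [Finset.card_filter]
  rfl

theorem unlinked_card_le (k : ℕ) : ∀ U : Finset (Fin k → Fin 3 × Bool),
    (∀ u ∈ U, ∀ v ∈ U, Even (colorExpPow k u v + colorExpPow k v u)) →
    U.card ≤ 3 ^ k ∧ (U.card = 3 ^ k → ∃ s, U = colorSlice k s) := by
  induction k with
  | zero =>
    intro U _
    have h1 : U.card ≤ 1 := by
      have := Finset.card_le_univ U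
      simpa using this
    refine ⟨by simpa using h1, fun h => ⟨fun _ => true, ?_⟩⟩
    refine Finset.eq_of_subset_of_card_le ?_ ?_
    · intro u _
      simp only [colorSlice, mem_filter, mem_univ, true_and]
      exact fun j => j.elim0
    · rw [card_colorSlice, h]
  | succ k ih =>
    intro U hU
    let M : Bool → (Fin k → Fin 3 × Bool) → Finset (Fin 3) := fun s u =>
      univ.filter fun c : Fin 3 => (Fin.cons (c, s) u : Fin (k + 1) → Fin 3 × Bool) ∈ U
    let A : Bool → Finset (Fin k → Fin 3 × Bool) := fun s => univ.filter fun u => (M s u).Nonempty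
    have hM : ∀ s u c, c ∈ M s u ↔ (Fin.cons (c, s) u : Fin (k + 1) → Fin 3 × Bool) ∈ U := by
      intro s u c; simp [M]
    have hA : ∀ s u, u ∈ A s ↔ ∃ c, c ∈ M s u := by
      intro s u
      simp only [A, mem_filter, mem_univ, true_and]
      exact Iff.rfl
    have hcard : U.card = ∑ s : Bool, ∑ u ∈ A s, (M s u).card := by
      rw [card_eq_sum_fibers]
      refine Finset.sum_congr rfl fun s _ => ?_
      refine (Finset.sum_subset (Finset.subset_univ _) ?_).symm
      intro u _ hu
      rw [Finset.card_eq_zero]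
      by_contra hne
      exact hu (by simp only [A, mem_filter, mem_univ, true_and]; exact Finset.nonempty_iff_ne_empty.2 hne)
    have hsplit : ∀ s, U.card = ∑ u ∈ A s, (M s u).card + ∑ u ∈ A (!s), (M (!s) u).card := by
      intro s
      rw [hcard]
      cases s <;> simp [add_comm]
    have hsame : ∀ s, ∀ u ∈ A s, ∀ v ∈ A s, Even (colorExpPow k u v + colorExpPow k v u) := by
      intro s u hu v hv
      obtain ⟨c, hc⟩ := (hA s u).1 hu
      obtain ⟨c', hc'⟩ := (hA s v).1 hv
      have h := hU _ ((hM _ _ _).1 hc) _ ((hM _ _ _).1 hc')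
      rw [colorExpPow_cons, colorExpPow_cons] at h
      have h2 := colorExp_add_eq (c, s) (c', s)
      simp only [if_true] at h2
      split_ifs at h2 <;> grind
    have hdiff : ∀ s u v c c', c ∈ M s u → c' ∈ M (!s) v →
        (c = c' ↔ Even (colorExpPow k u v + colorExpPow k v u)) := by
      intro s u v c c' hc hc'
      have h := hU _ ((hM _ _ _).1 hc) _ ((hM _ _ _).1 hc')
      rw [colorExpPow_cons, colorExpPow_cons] at h
      have h2 := colorExp_add_eq (c, s) (c', !s)
      have h3 : s ≠ !s := by cases s <;> simp
      simp only [h3, if_false] at h2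
      split_ifs at h2 <;> grind
    have hAle : ∀ s, (A s).card ≤ 3 ^ k := fun s => (ih (A s) (hsame s)).1
    have hpos : 0 < 3 ^ k := by positivity
    have hM3 : ∀ s u, (M s u).card ≤ 3 := fun s u => by
      simpa using Finset.card_le_univ (M s u)
    have hone : ∀ s u, 2 ≤ (M s u).card → ∀ v, (M (!s) v).card ≤ 1 := by
      intro s u h v
      by_contra hlt
      push Not at hlt
      obtain ⟨c1, h1, c2, h2, hne⟩ := Finset.one_lt_card.1 (show 1 < (M s u).card by omega)
      obtain ⟨d1, g1, d2, g2, hne'⟩ := Finset.one_lt_card.1 hlt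
      have e1 := hdiff s u v c1 d1 h1 g1
      have e2 := hdiff s u v c2 d1 h2 g1
      have e3 := hdiff s u v c1 d2 h1 g2
      have e4 := hdiff s u v c2 d2 h2 g2
      have : ∀ x y z w : Fin 3, x ≠ y → z ≠ w → (x = z ↔ y = z) → (x = z ↔ x = w) →
          (x = z ↔ y = w) → False := by
        decide
      exact this c1 c2 d1 d2 hne hne' (e1.trans e2.symm) (e1.trans e3.symm) (e1.trans e4.symm)
    rw [pow_succ]
    by_cases h3 : ∃ s u, (M s u).card = 3
    · obtain ⟨s, u, hsu⟩ := h3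
      have hall : ∀ c, c ∈ M s u := by
        intro c
        have : M s u = univ := by
          rw [← Finset.card_eq_iff_eq_univ]; simpa using hsu
        rw [this]; simp
      have hempty : A (!s) = ∅ := by
        rw [Finset.eq_empty_iff_forall_notMem]
        intro v hv
        obtain ⟨c', hc'⟩ := (hA _ _).1 hv
        have e1 := hdiff s u v c' c' (hall _) hc'
        have e2 := hdiff s u v (c' + 1) c' (hall _) hc'
        have : ∀ x : Fin 3, ¬ (x + 1 = x) := by decide
        exact this c' (e2.2 (e1.1 rfl))
      have hle : U.card ≤ (A s).card * 3 := by
        rw [hsplit s, hempty, Finset.sum_empty, add_zero]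
        calc _ ≤ ∑ u ∈ A s, 3 := Finset.sum_le_sum fun u _ => hM3 s u
          _ = _ := by simp
      refine ⟨hle.trans (Nat.mul_le_mul_right _ (hAle s)), fun heq => ?_⟩
      have hAs : (A s).card = 3 ^ k := le_antisymm (hAle s) (by omega)
      obtain ⟨s', hs'⟩ := (ih (A s) (hsame s)).2 hAs
      refine ⟨Fin.cons s s', Finset.eq_of_subset_of_card_le ?_ ?_⟩
      · intro x hx
        have hx' : x = Fin.cons ((x 0).1, (x 0).2) (Fin.tail x) := by simp
        have hmem : (x 0).1 ∈ M (x 0).2 (Fin.tail x) := by rw [hM, ← hx']; exact hx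
        have hxs : (x 0).2 = s := by
          by_contra hne
          have : (x 0).2 = !s := by revert hne; cases (x 0).2 <;> cases s <;> simp
          rw [this] at hmem
          have := (hA _ _).2 ⟨_, hmem⟩
          rw [hempty] at this
          simp at this
        rw [hxs] at hmem
        have := (hA _ _).2 ⟨_, hmem⟩
        rw [hs'] at this
        simp only [colorSlice, mem_filter, mem_univ, true_and] at this ⊢
        intro j
        refine Fin.cases ?_ (fun j => ?_) j
        · simpa using hxs
        · simpa [Fin.tail] using this j
      · rw [card_colorSlice, heq, pow_succ]
    · have hM2 : ∀ s u, (M s u).card ≤ 2 := by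
        intro s u
        have := hM3 s u
        by_contra hlt
        exact h3 ⟨s, u, by omega⟩
      by_cases h2 : ∃ s u, (M s u).card = 2
      · obtain ⟨s, u, hsu⟩ := h2
        have hM1 := hone s u hsu.ge
        have hb1 : ∑ u ∈ A s, (M s u).card ≤ (A s).card * 2 := by
          calc _ ≤ ∑ u ∈ A s, 2 := Finset.sum_le_sum fun u _ => hM2 s u
            _ = _ := by simp
        have hb2 : ∑ u ∈ A (!s), (M (!s) u).card ≤ (A (!s)).card := by
          calc _ ≤ ∑ u ∈ A (!s), 1 := Finset.sum_le_sum fun u _ => hM1 u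
            _ = _ := by simp
        have hsp := hsplit s
        have l1 := hAle s
        have l2 := hAle (!s)
        refine ⟨by omega, fun heq => ?_⟩
        exfalso
        obtain ⟨s1, hs1⟩ := (ih (A s) (hsame s)).2 (by omega)
        obtain ⟨s2, hs2⟩ := (ih (A (!s)) (hsame (!s))).2 (by omega)
        have hallM : ∀ u ∈ A s, (M s u).card = 2 := by
          by_contra hcon
          push Not at hcon
          obtain ⟨w, hw, hwne⟩ := hcon
          have : ∑ u ∈ A s, (M s u).card < ∑ u ∈ A s, 2 :=
            Finset.sum_lt_sum (fun u _ => hM2 s u) ⟨w, hw, lt_of_le_of_ne (hM2 s w) hwne⟩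
          simp at this
          omega
        have hu1 : (fun j => ((0 : Fin 3), s1 j)) ∈ A s := by
          rw [hs1]; simp [colorSlice]
        have hv1 : (fun j => ((0 : Fin 3), s2 j)) ∈ A (!s) := by
          rw [hs2]; simp [colorSlice]
        obtain ⟨c', hc'⟩ := (hA _ _).1 hv1
        have hev := even_link_of_fst_eq k (fun j => ((0 : Fin 3), s1 j))
          (fun j => ((0 : Fin 3), s2 j)) (fun _ => rfl)
        obtain ⟨c1, g1, c2, g2, hne⟩ := Finset.one_lt_card.1
          (show 1 < (M s (fun j => ((0 : Fin 3), s1 j))).card by rw [hallM _ hu1]; norm_num)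
        have e1 := (hdiff s _ _ c1 c' g1 hc').2 (by rw [hev]; simp)
        have e2 := (hdiff s _ _ c2 c' g2 hc').2 (by rw [hev]; simp)
        exact hne (e1.trans e2.symm)
      · have hM1 : ∀ s u, (M s u).card ≤ 1 := by
          intro s u
          have := hM2 s u
          by_contra hlt
          exact h2 ⟨s, u, by omega⟩
        have hb : ∀ s, ∑ u ∈ A s, (M s u).card ≤ (A s).card := fun s => by
          calc _ ≤ ∑ u ∈ A s, 1 := Finset.sum_le_sum fun u _ => hM1 s u
            _ = _ := by simp
        have hsp := hsplit true
        have l1 := hAle true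
        have l2 := hAle (!true)
        have b1 := hb true
        have b2 := hb (!true)
        exact ⟨by omega, fun heq => by omega⟩

theorem exists_linked_unlinked (k : ℕ) (s : Fin k → Bool) (v : Fin k → Fin 3 × Bool)
    (hv : v ∉ colorSlice k s) :
    ∃ u ∈ colorSlice k s, ∃ u' ∈ colorSlice k s,
      Odd (colorExpPow k u v + colorExpPow k v u) ∧
      Even (colorExpPow k u' v + colorExpPow k v u') := by
  simp only [colorSlice, mem_filter, mem_univ, true_and, not_forall] at hv
  obtain ⟨j, hj⟩ := hv
  refine ⟨fun i => (if i = j then (v i).1 + 1 else (v i).1, s i), by simp [colorSlice],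
    fun i => ((v i).1, s i), by simp [colorSlice], ?_, ?_⟩
  · simp only [colorExpPow, ← Finset.sum_add_distrib]
    rw [Finset.sum_eq_single j]
    · rw [colorExp_add_eq]
      have : ∀ x : Fin 3, ¬ (x + 1 = x) := by decide
      simp [this, Ne.symm hj]
    · intro b _ hb
      rw [colorExp_add_eq]
      simp [hb]
    · simp
  · rw [even_link_of_fst_eq]
    · simp
    · simp

theorem sum_le_sum_of_injOn' {ι κ : Type*} {s : Finset ι} {t : Finset κ} {f : ι → ℝ} {g : κ → ℝ}
    (i : ι → κ) (hi : ∀ a ∈ s, i a ∈ t) (inj : Set.InjOn i s) (h : ∀ a ∈ s, f a ≤ g (i a))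
    (hg : ∀ b ∈ t, 0 ≤ g b) : ∑ a ∈ s, f a ≤ ∑ b ∈ t, g b := by
  calc ∑ a ∈ s, f a ≤ ∑ a ∈ s, g (i a) := Finset.sum_le_sum h
    _ = ∑ b ∈ s.image i, g b := (Finset.sum_image inj).symm
    _ ≤ _ := Finset.sum_le_sum_of_subset_of_nonneg (Finset.image_subset_iff.2 hi)
        fun b hb _ => hg b hb

theorem le_sum_mul_of_antitone {a w : ℕ → ℝ} (hw : Antitone w)
    (ha : ∀ n, 0 ≤ ∑ i ∈ range n, a i) (n : ℕ) :
    (∑ i ∈ range (n + 1), a i) * w n ≤ ∑ i ∈ range (n + 1), a i * w i := by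
  induction n with
  | zero => simp
  | succ n ih =>
    rw [Finset.sum_range_succ _ (n + 1), Finset.sum_range_succ _ (n + 1), add_mul]
    gcongr
    exact (mul_le_mul_of_nonneg_left (hw (Nat.le_succ n)) (ha _)).trans ih

theorem sum_mul_nonneg_of_antitone {a w : ℕ → ℝ} (hw : Antitone w) (hw0 : ∀ n, 0 ≤ w n)
    (ha : ∀ n, 0 ≤ ∑ i ∈ range n, a i) (n : ℕ) : 0 ≤ ∑ i ∈ range n, a i * w i := by
  cases n with
  | zero => simp
  | succ n => exact (mul_nonneg (ha _) (hw0 _)).trans (le_sum_mul_of_antitone hw ha n)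

theorem sum_primes_log_le (n : ℕ) :
    ∑ p ∈ (range (n + 1)).filter Nat.Prime, Real.log p ≤ 2 * n := by
  have h := Chebyshev.theta_le_log4_mul_x (x := n) (by positivity)
  have h4 : Real.log 4 ≤ 2 := by
    have : Real.log 4 = 2 * Real.log 2 := by
      rw [← Real.log_rpow (by norm_num)]; norm_num
    have := Real.log_two_lt_d9
    linarith
  have h5 : ∑ p ∈ (range (n + 1)).filter Nat.Prime, Real.log p = Chebyshev.theta n := by
    rw [Chebyshev.theta, Nat.floor_natCast]
    refine Finset.sum_congr ?_ fun _ _ => rfl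
    ext p
    simp only [mem_filter, mem_range, mem_Ioc]
    constructor
    · rintro ⟨h1, h2⟩
      exact ⟨⟨h2.pos, by omega⟩, h2⟩
    · rintro ⟨h1, h2⟩
      exact ⟨by omega, h2⟩
  rw [h5]
  refine h.trans ?_
  gcongr

/-- Sums of nonnegative multiplicative functions bounded by one on squarefree numbers, compared
with the corresponding logarithmic sums. -/
theorem sum_squarefree_le_log_sum (g : ℕ → ℝ) (h0 : ∀ p, 0 ≤ g p) (h1 : ∀ p, g p ≤ 1) (y : ℕ)
    (hy : 1 ≤ y) :
    (1 + Real.log y) * ∑ n ∈ (Icc 1 y).filter Squarefree, ∏ p ∈ n.primeFactors, g p ≤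
      4 * y * ∑ n ∈ (Icc 1 y).filter Squarefree, (∏ p ∈ n.primeFactors, g p) / n := by
  set S := (Icc 1 y).filter Squarefree with hS
  have hG0 : ∀ n : ℕ, 0 ≤ ∏ p ∈ n.primeFactors, g p := fun n => Finset.prod_nonneg fun p _ => h0 p
  have hmem : ∀ n, n ∈ S ↔ (1 ≤ n ∧ n ≤ y) ∧ Squarefree n := by intro n; simp [hS]
  have key : ∑ n ∈ S, (∏ p ∈ n.primeFactors, g p) * ∑ p ∈ n.primeFactors, Real.log p ≤
      ∑ m ∈ S, (∏ p ∈ m.primeFactors, g p) *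
        ∑ p ∈ (range (y / m + 1)).filter Nat.Prime, Real.log p := by
    simp only [Finset.mul_sum]
    rw [Finset.sum_sigma', Finset.sum_sigma']
    refine sum_le_sum_of_injOn' (fun x : (_ : ℕ) × ℕ => (⟨x.1 / x.2, x.2⟩ : (_ : ℕ) × ℕ)) ?_ ?_ ?_ ?_
    · rintro ⟨n, p⟩ hx
      simp only [mem_sigma, hmem, Nat.mem_primeFactors, mem_filter, mem_range] at hx ⊢
      obtain ⟨⟨⟨hn1, hny⟩, hsq⟩, hp, ⟨m, rfl⟩, -⟩ := hx
      have hm : p * m / p = m := Nat.mul_div_cancel_left _ hp.pos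
      have hm1 : 1 ≤ m := by
        rcases Nat.eq_zero_or_pos m with h | h
        · simp [h] at hn1
        · exact h
      rw [hm]
      refine ⟨⟨⟨hm1, ?_⟩, (Nat.squarefree_mul_iff.1 hsq).2.2⟩, ?_, hp⟩
      · exact le_trans (Nat.le_mul_of_pos_left _ hp.pos) hny
      · exact Nat.lt_succ_of_le ((Nat.le_div_iff_mul_le hm1).2 hny)
    · rintro ⟨n, p⟩ hx ⟨n', p'⟩ hx' heq
      simp only [coe_sigma, Set.mem_sigma_iff, mem_coe, hmem, Nat.mem_primeFactors] at hx hx'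
      simp only [Sigma.mk.injEq, heq_eq_eq] at heq
      obtain ⟨e1, rfl⟩ := heq
      have : n = n' := by
        rw [← Nat.div_mul_cancel hx.2.2.1, ← Nat.div_mul_cancel hx'.2.2.1, e1]
      subst this; rfl
    · rintro ⟨n, p⟩ hx
      simp only [mem_sigma, hmem, Nat.mem_primeFactors] at hx ⊢
      obtain ⟨⟨⟨hn1, hny⟩, hsq⟩, hp, ⟨m, rfl⟩, -⟩ := hx
      rw [Nat.mul_div_cancel_left _ hp.pos]
      have hc := (Nat.squarefree_mul_iff.1 hsq).1
      refine mul_le_mul_of_nonneg_right ?_ (Real.log_natCast_nonneg _)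
      rw [hc.primeFactors_mul, Finset.prod_union hc.disjoint_primeFactors]
      exact mul_le_of_le_one_left (hG0 _) (Finset.prod_le_one (fun p _ => h0 p) fun p _ => h1 p)
    · rintro ⟨n, p⟩ _
      exact mul_nonneg (hG0 _) (Real.log_natCast_nonneg _)
  have hle : ∀ n ∈ S, (1 + Real.log y) * ∏ p ∈ n.primeFactors, g p ≤
      2 * y * ((∏ p ∈ n.primeFactors, g p) / n) +
        (∏ p ∈ n.primeFactors, g p) * ∑ p ∈ n.primeFactors, Real.log p := by
    intro n hn
    obtain ⟨⟨hn1, hny⟩, hsq⟩ := (hmem n).1 hn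
    have hn0 : (0 : ℝ) < n := by exact_mod_cast hn1
    have hy0 : (0 : ℝ) < y := by exact_mod_cast hy
    have hlog : ∑ p ∈ n.primeFactors, Real.log p = Real.log n := by
      conv_rhs => rw [← Nat.prod_primeFactors_of_squarefree hsq]
      push_cast
      rw [Real.log_prod]
      intro p hp
      exact_mod_cast (Nat.prime_of_mem_primeFactors hp).ne_zero
    rw [hlog]
    have h2 : Real.log y - Real.log n ≤ y / n := by
      rw [← Real.log_div hy0.ne' hn0.ne']
      have := Real.log_le_sub_one_of_pos (div_pos hy0 hn0)
      linarith
    have h3 : (1 : ℝ) ≤ y / n := by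
      rw [le_div_iff₀ hn0]; simpa using (by exact_mod_cast hny : (n : ℝ) ≤ y)
    have h4 : 1 + Real.log y ≤ 2 * (y / n) + Real.log n := by linarith
    calc _ ≤ (2 * (y / n) + Real.log n) * ∏ p ∈ n.primeFactors, g p :=
          mul_le_mul_of_nonneg_right h4 (hG0 n)
      _ = _ := by ring
  rw [Finset.mul_sum]
  refine (Finset.sum_le_sum hle).trans ?_
  rw [Finset.sum_add_distrib, ← Finset.mul_sum]
  refine (add_le_add le_rfl (key.trans (Finset.sum_le_sum fun m hm =>
    mul_le_mul_of_nonneg_left (sum_primes_log_le (y / m)) (hG0 m)))).trans ?_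
  have : ∀ m ∈ S, (∏ p ∈ m.primeFactors, g p) * (2 * ((y / m : ℕ) : ℝ)) ≤
      2 * y * ((∏ p ∈ m.primeFactors, g p) / m) := by
    intro m _
    have : ((y / m : ℕ) : ℝ) ≤ (y : ℝ) / m := Nat.cast_div_le
    calc _ ≤ (∏ p ∈ m.primeFactors, g p) * (2 * ((y : ℝ) / m)) := by
          exact mul_le_mul_of_nonneg_left (by linarith) (hG0 m)
      _ = _ := by ring
  refine (add_le_add le_rfl (Finset.sum_le_sum this)).trans ?_
  rw [← Finset.mul_sum]
  apply le_of_eq; ring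

theorem sum_squarefree_le_prod (f : ℕ → ℝ) (hf : ∀ p, 0 ≤ f p) (y : ℕ) :
    ∑ n ∈ (Icc 1 y).filter Squarefree, ∏ p ∈ n.primeFactors, f p ≤
      ∏ p ∈ (y + 1).primesBelow, (1 + f p) := by
  rw [Finset.prod_one_add]
  refine sum_le_sum_of_injOn' (fun n : ℕ => n.primeFactors) ?_ ?_ (fun _ _ => le_rfl)
    fun _ _ => Finset.prod_nonneg fun p _ => hf p
  · intro n hn
    simp only [mem_filter, mem_Icc] at hn
    rw [Finset.mem_powerset]
    intro p hp
    rw [Nat.mem_primesBelow]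
    exact ⟨by have := Nat.le_of_mem_primeFactors hp; omega, Nat.prime_of_mem_primeFactors hp⟩
  · intro n hn m hm h
    simp only [coe_filter, mem_Icc, Set.mem_ofPred_eq] at hn hm
    simp only at h
    rw [← Nat.prod_primeFactors_of_squarefree hn.2, ← Nat.prod_primeFactors_of_squarefree hm.2, h]

/-- The completely multiplicative function `χ n * n ^ (-σ)`. -/
def twist (χ : ℕ →*₀ ℝ) (σ : ℝ) (hσ : σ ≠ 0) : ℕ →*₀ ℝ where
  toFun n := χ n * (n : ℝ) ^ (-σ)
  map_zero' := by simp
  map_one' := by simp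
  map_mul' a b := by
    rw [map_mul, Nat.cast_mul, Real.mul_rpow (by positivity) (by positivity)]; ring

theorem twist_norm_le (χ : ℕ →*₀ ℝ) (hχ : ∀ n, |χ n| ≤ 1) (σ : ℝ) (hσ : σ ≠ 0) (n : ℕ) :
    ‖twist χ σ hσ n‖ ≤ (n : ℝ) ^ (-σ) := by
  change ‖χ n * (n : ℝ) ^ (-σ)‖ ≤ _
  rw [norm_mul, Real.norm_of_nonneg (show 0 ≤ (n : ℝ) ^ (-σ) by positivity)]
  exact mul_le_of_le_one_left (by positivity) (hχ n)

theorem twist_summable (χ : ℕ →*₀ ℝ) (hχ : ∀ n, |χ n| ≤ 1) (σ : ℝ) (hσ : σ ≠ 0) (h1 : 1 < σ) :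
    Summable fun n => ‖twist χ σ hσ n‖ :=
  Summable.of_nonneg_of_le (fun _ => norm_nonneg _) (twist_norm_le χ hχ σ hσ)
    (Real.summable_nat_rpow.2 (by linarith))

theorem exp_sum_primes_le (f : ℕ →*₀ ℝ) (hf : Summable fun n => ‖f n‖) (M : ℕ) :
    Real.exp (∑ p ∈ M.primesBelow, f p) ≤ ∏ p ∈ M.primesBelow, (1 - f p)⁻¹ := by
  rw [Real.exp_sum]
  refine Finset.prod_le_prod (fun _ _ => (Real.exp_pos _).le) fun p hp => ?_
  have hp1 : 1 < p := (Nat.prime_of_mem_primesBelow hp).one_lt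
  have h1 : ‖f p‖ < 1 := Summable.norm_lt_one (f := f.toMonoidHom) hf.of_norm hp1
  have h2 : 0 < 1 - f p := by
    have := (abs_lt.1 h1).2; linarith
  rw [← neg_neg (f p), Real.exp_neg]
  have h3 := Real.add_one_le_exp (-f p)
  simp only [neg_neg]
  exact inv_anti₀ h2 (by linarith)

theorem prod_primes_inv_pos (f : ℕ →*₀ ℝ) (hf : Summable fun n => ‖f n‖) (M : ℕ) :
    0 ≤ ∏ p ∈ M.primesBelow, (1 - f p)⁻¹ :=
  (Real.exp_pos _).le.trans (exp_sum_primes_le f hf M)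

theorem sum_rpow_neg_le (σ : ℝ) (hσ : 1 < σ) (M : ℕ) :
    ∑ n ∈ range M, (n : ℝ) ^ (-σ) ≤ 1 + 1 / (σ - 1) := by
  have hδ : 0 < σ - 1 := by linarith
  have key : ∀ M : ℕ, ∑ n ∈ range (M + 2), (n : ℝ) ^ (-σ) ≤
      1 + 1 / (σ - 1) * (1 - ((M + 1 : ℕ) : ℝ) ^ (-(σ - 1))) := by
    intro M
    induction M with
    | zero =>
      have : -σ ≠ 0 := by linarith
      simp [Finset.sum_range_succ, Real.zero_rpow this]
    | succ M ih =>
      rw [Finset.sum_range_succ]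
      refine (add_le_add ih le_rfl).trans ?_
      have hx : (0 : ℝ) < ((M + 1 : ℕ) : ℝ) := by positivity
      have hx2 : (0 : ℝ) < ((M + 2 : ℕ) : ℝ) := by positivity
      have hlog : Real.log ((M + 1 : ℕ) : ℝ) - Real.log ((M + 2 : ℕ) : ℝ) ≤
          -(1 / ((M + 2 : ℕ) : ℝ)) := by
        rw [← Real.log_div hx.ne' hx2.ne']
        refine (Real.log_le_sub_one_of_pos (by positivity)).trans (le_of_eq ?_)
        push_cast
        have : (M : ℝ) + 2 ≠ 0 := by positivity
        field_simp
        ring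
      have h1 : ((M + 2 : ℕ) : ℝ) ^ (-(σ - 1)) * (1 + (σ - 1) * (1 / ((M + 2 : ℕ) : ℝ))) ≤
          ((M + 1 : ℕ) : ℝ) ^ (-(σ - 1)) := by
        rw [Real.rpow_def_of_pos hx, Real.rpow_def_of_pos hx2]
        have h2 : Real.log ((M + 1 : ℕ) : ℝ) * -(σ - 1) =
          Real.log ((M + 2 : ℕ) : ℝ) * -(σ - 1) +
            (σ - 1) * (Real.log ((M + 2 : ℕ) : ℝ) - Real.log ((M + 1 : ℕ) : ℝ)) := by ring
        rw [h2, Real.exp_add]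
        refine mul_le_mul_of_nonneg_left ?_ (Real.exp_pos _).le
        have h3 := Real.add_one_le_exp
          ((σ - 1) * (Real.log ((M + 2 : ℕ) : ℝ) - Real.log ((M + 1 : ℕ) : ℝ)))
        have h4 : (σ - 1) * (1 / ((M + 2 : ℕ) : ℝ)) ≤
            (σ - 1) * (Real.log ((M + 2 : ℕ) : ℝ) - Real.log ((M + 1 : ℕ) : ℝ)) :=
          mul_le_mul_of_nonneg_left (by linarith) hδ.le
        linarith
      have h5 : ((M + 2 : ℕ) : ℝ) ^ (-σ) = ((M + 2 : ℕ) : ℝ) ^ (-(σ - 1)) *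
          (1 / ((M + 2 : ℕ) : ℝ)) := by
        rw [one_div, ← Real.rpow_neg_one, ← Real.rpow_add hx2]; congr 1; ring
      rw [h5]
      have h6 : ((M + 2 : ℕ) : ℝ) ^ (-(σ - 1)) * (1 / ((M + 2 : ℕ) : ℝ)) ≤
          1 / (σ - 1) * (((M + 1 : ℕ) : ℝ) ^ (-(σ - 1)) - ((M + 2 : ℕ) : ℝ) ^ (-(σ - 1))) := by
        rw [one_div_mul_eq_div, le_div_iff₀ hδ]
        linarith
      have e : M + 1 + 1 = M + 2 := rfl
      rw [e]
      linarith
  refine (Finset.sum_le_sum_of_subset_of_nonneg (Finset.range_subset_range.2 (by omega : M ≤ M + 2))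
    fun i _ _ => by positivity).trans ((key M).trans ?_)
  have : 0 ≤ ((M + 1 : ℕ) : ℝ) ^ (-(σ - 1)) := by positivity
  have h7 : 0 < 1 / (σ - 1) := by positivity
  nlinarith

theorem twist_tsum_le (χ : ℕ →*₀ ℝ) (hχ : ∀ n, |χ n| ≤ 1) (σ : ℝ) (hσ : σ ≠ 0) (h1 : 1 < σ) :
    ∑' n, twist χ σ hσ n ≤ 1 + 1 / (σ - 1) := by
  refine Summable.tsum_le_of_sum_range_le (twist_summable χ hχ σ hσ h1).of_norm fun M => ?_
  exact (Finset.sum_le_sum fun n _ => (le_abs_self _).trans (twist_norm_le χ hχ σ hσ n)).trans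
    (sum_rpow_neg_le σ h1 M)

theorem twist_tsum_le_log (χ : ℕ →*₀ ℝ) (hχ : ∀ n, |χ n| ≤ 1) (Q : ℝ) (hQ : 1 ≤ Q)
    (hsum : ∀ t : ℕ, |∑ n ∈ range t, χ n| ≤ Q) (σ : ℝ) (hσ : σ ≠ 0) (h1 : 1 < σ) :
    ∑' n, twist χ σ hσ n ≤ 2 + Real.log Q := by
  refine Summable.tsum_le_of_sum_range_le (twist_summable χ hχ σ hσ h1).of_norm fun M => ?_
  set K := ⌈Q⌉₊ with hK
  have hle : ∀ M : ℕ, ∑ n ∈ range (M + 1), twist χ σ hσ n ≤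
      ∑ n ∈ range M, (if n < K then (1 : ℝ) else 0) * ((n + 1 : ℕ) : ℝ) ^ (-σ) := by
    intro M
    rw [Finset.sum_range_succ', map_zero, add_zero, ← sub_nonneg, ← Finset.sum_sub_distrib]
    have := sum_mul_nonneg_of_antitone (w := fun n : ℕ => ((n + 1 : ℕ) : ℝ) ^ (-σ))
      (a := fun n => (if n < K then (1 : ℝ) else 0) - χ (n + 1)) ?_ (fun n => by positivity) ?_ M
    · refine this.trans (le_of_eq (Finset.sum_congr rfl fun n _ => ?_))
      change _ = _ - χ (n + 1) * ((n + 1 : ℕ) : ℝ) ^ (-σ)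
      ring
    · intro a b hab
      exact Real.rpow_le_rpow_of_nonpos (by positivity) (by exact_mod_cast Nat.succ_le_succ hab)
        (by linarith)
    · intro n
      rw [Finset.sum_sub_distrib, sub_nonneg]
      rcases le_total n K with h | h
      · have : ∑ i ∈ range n, (if i < K then (1 : ℝ) else 0) = ∑ i ∈ range n, (1 : ℝ) := by
          refine Finset.sum_congr rfl fun i hi => ?_
          rw [if_pos]; have := mem_range.1 hi; omega
        rw [this]
        exact Finset.sum_le_sum fun i _ => (le_abs_self _).trans (hχ _)
      · have h2 : ∑ i ∈ range n, (if i < K then (1 : ℝ) else 0) = K := by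
          rw [Finset.sum_ite, Finset.sum_const_zero, add_zero]
          simp only [sum_const, nsmul_eq_mul, mul_one]
          congr 1
          have : (range n).filter (fun i => i < K) = range K := by
            ext i; simp only [mem_filter, mem_range]; omega
          rw [this, card_range]
        rw [h2]
        have h3 := (le_abs_self _).trans (hsum (n + 1))
        rw [Finset.sum_range_succ', map_zero, add_zero] at h3
        exact h3.trans (Nat.le_ceil Q)
  have hM : ∑ n ∈ range M, twist χ σ hσ n ≤
      ∑ n ∈ range M, (if n < K then (1 : ℝ) else 0) * ((n + 1 : ℕ) : ℝ) ^ (-σ) := by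
    cases M with
    | zero => simp
    | succ M =>
      refine (hle M).trans (Finset.sum_le_sum_of_subset_of_nonneg (range_subset_range.2 (by omega)) ?_)
      intro i _ _
      positivity
  refine hM.trans ?_
  have hb : ∑ n ∈ range M, (if n < K then (1 : ℝ) else 0) * ((n + 1 : ℕ) : ℝ) ^ (-σ) ≤
      ∑ n ∈ range K, ((n : ℝ) + 1)⁻¹ := by
    simp only [ite_mul, one_mul, zero_mul]
    rw [← Finset.sum_filter]
    refine (Finset.sum_le_sum (g := fun n : ℕ => ((n : ℝ) + 1)⁻¹) fun n _ => ?_).trans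
      (Finset.sum_le_sum_of_subset_of_nonneg ?_ fun i _ _ => by positivity)
    · rw [← Real.rpow_neg_one, Nat.cast_succ]
      refine Real.rpow_le_rpow_of_exponent_le ?_ (by linarith)
      linarith [Nat.cast_nonneg (α := ℝ) n]
    · intro i hi
      exact mem_range.2 (mem_filter.1 hi).2
  refine hb.trans ?_
  have hh := harmonic_le_one_add_log K
  have he : ((harmonic K : ℚ) : ℝ) = ∑ n ∈ range K, ((n : ℝ) + 1)⁻¹ := by
    simp [harmonic]
  rw [← he]
  refine hh.trans ?_
  have hK2 : (K : ℝ) ≤ 2 * Q := by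
    have := Nat.ceil_lt_add_one (show (0 : ℝ) ≤ Q by linarith)
    rw [← hK] at this
    linarith
  have hK0 : (0 : ℝ) < K := by
    have := Nat.le_ceil Q
    rw [← hK] at this
    linarith
  have h3 := Real.log_le_log hK0 hK2
  rw [Real.log_mul (by norm_num) (by linarith)] at h3
  have := Real.log_two_lt_d9
  linarith

/-- The constant-one completely multiplicative function (vanishing at zero). -/
def oneChar : ℕ →*₀ ℝ where
  toFun n := if n = 0 then 0 else 1
  map_zero' := by simp
  map_one' := by simp
  map_mul' a b := by
    by_cases ha : a = 0 <;> by_cases hb : b = 0 <;> simp [ha, hb]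

theorem sum_squarefree_char_le (χ : ℕ →*₀ ℝ) (hχ : ∀ n, |χ n| ≤ 1) (Q : ℝ) (hQ : 1 ≤ Q)
    (hsum : ∀ t : ℕ, |∑ n ∈ range t, χ n| ≤ Q) (N : ℕ) (hN : 2 ≤ N) (y : ℕ) (hy : 1 ≤ y) :
    ∑ n ∈ (Icc 1 y).filter Squarefree, ∏ p ∈ n.primeFactors, (1 - (1 - χ p) / N) ≤
      24 * y * ((1 + Real.log Q) / (1 + Real.log y)) ^ (1 / N : ℝ) := by
  set g : ℕ → ℝ := fun p => 1 - (1 - χ p) / N with hg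
  have hN0 : (2 : ℝ) ≤ N := by exact_mod_cast hN
  have hNpos : (0 : ℝ) < N := by linarith
  have hg0 : ∀ p, 0 ≤ g p := by
    intro p
    have := (abs_le.1 (hχ p)).1
    rw [hg]; simp only [sub_nonneg]
    rw [div_le_one hNpos]; linarith
  have hg1 : ∀ p, g p ≤ 1 := by
    intro p
    have := (abs_le.1 (hχ p)).2
    rw [hg]; simp only [sub_le_self_iff]
    exact div_nonneg (by linarith) hNpos.le
  have hlogy : 0 ≤ Real.log y := Real.log_natCast_nonneg y
  have hlogQ : 0 ≤ Real.log Q := Real.log_nonneg hQ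
  set ℓ := 1 + Real.log y with hℓ
  have hℓ1 : 1 ≤ ℓ := by linarith
  have hℓ0 : 0 < ℓ := by linarith
  set σ := 1 + 1 / ℓ with hσdef
  have hσ1 : 1 < σ := by
    have : 0 < 1 / ℓ := by positivity
    linarith
  have hσ : σ ≠ 0 := by linarith
  have hone : ∀ n, |oneChar n| ≤ 1 := by
    intro n
    change |if n = 0 then (0 : ℝ) else 1| ≤ 1
    split_ifs <;> simp
  set f₁ := twist oneChar σ hσ with hf₁
  set f₂ := twist χ σ hσ with hf₂
  have hs₁ := twist_summable oneChar hone σ hσ hσ1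
  have hs₂ := twist_summable χ hχ σ hσ hσ1
  -- the logarithmic sum
  have hA : ∑ n ∈ (Icc 1 y).filter Squarefree, (∏ p ∈ n.primeFactors, g p) / n ≤
      Real.exp 1 * Real.exp (∑ p ∈ (y + 1).primesBelow, g p * (p : ℝ) ^ (-σ)) := by
    have h1 : ∀ n ∈ (Icc 1 y).filter Squarefree, (∏ p ∈ n.primeFactors, g p) / n ≤
        Real.exp 1 * ∏ p ∈ n.primeFactors, (g p * (p : ℝ) ^ (-σ)) := by
      intro n hn
      simp only [mem_filter, mem_Icc] at hn
      obtain ⟨⟨hn1, hny⟩, hsq⟩ := hn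
      have hn0 : (0 : ℝ) < n := by exact_mod_cast hn1
      rw [Finset.prod_mul_distrib, Real.finsetProd_rpow _ _ fun p _ => Nat.cast_nonneg p]
      rw [← Nat.cast_prod, Nat.prod_primeFactors_of_squarefree hsq, div_eq_mul_inv, mul_left_comm]
      refine mul_le_mul_of_nonneg_left ?_ (Finset.prod_nonneg fun p _ => hg0 p)
      rw [Real.rpow_def_of_pos hn0, ← Real.exp_add, ← Real.exp_log (inv_pos.2 hn0), Real.log_inv]
      refine Real.exp_le_exp.2 ?_
      have h2 : Real.log n ≤ ℓ := by
        have := Real.log_le_log hn0 (show (n : ℝ) ≤ y by exact_mod_cast hny)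
        linarith
      have h3 : Real.log n * (1 / ℓ) ≤ 1 := by
        rw [mul_one_div, div_le_one hℓ0]; exact h2
      rw [hσdef]; linarith
    refine (Finset.sum_le_sum h1).trans ?_
    rw [← Finset.mul_sum]
    refine mul_le_mul_of_nonneg_left ?_ (Real.exp_pos _).le
    refine (sum_squarefree_le_prod _ (fun p => mul_nonneg (hg0 p) (by positivity)) y).trans ?_
    rw [Real.exp_sum]
    refine Finset.prod_le_prod (fun p _ => ?_) fun p _ => ?_
    · have := mul_nonneg (hg0 p) (show 0 ≤ (p : ℝ) ^ (-σ) by positivity)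
      linarith
    · rw [add_comm]; exact Real.add_one_le_exp _
  have hB : Real.exp (∑ p ∈ (y + 1).primesBelow, g p * (p : ℝ) ^ (-σ)) ≤
      (∑' n, f₁ n) ^ (1 - 1 / N : ℝ) * (∑' n, f₂ n) ^ (1 / N : ℝ) := by
    have ht₁ := EulerProduct.eulerProduct_completely_multiplicative hs₁
    have ht₂ := EulerProduct.eulerProduct_completely_multiplicative hs₂
    have hinv : 1 / (N : ℝ) ≤ 1 := by rw [div_le_one hNpos]; linarith
    have hinv0 : 0 ≤ 1 / (N : ℝ) := by positivity
    refine ge_of_tendsto ((ht₁.rpow_const (Or.inr (sub_nonneg.2 hinv))).mul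
      (ht₂.rpow_const (Or.inr hinv0))) ?_
    filter_upwards [eventually_ge_atTop (y + 1)] with M hM
    have h1 : ∑ p ∈ (y + 1).primesBelow, g p * (p : ℝ) ^ (-σ) ≤
        (∑ p ∈ M.primesBelow, f₁ p) * (1 - 1 / N) + (∑ p ∈ M.primesBelow, f₂ p) * (1 / N) := by
      refine (Finset.sum_le_sum_of_subset_of_nonneg (t := M.primesBelow) ?_ ?_).trans (le_of_eq ?_)
      · intro p hp
        rw [Nat.mem_primesBelow] at hp ⊢
        exact ⟨by omega, hp.2⟩
      · intro p _ _
        exact mul_nonneg (hg0 p) (by positivity)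
      · rw [Finset.sum_mul, Finset.sum_mul, ← Finset.sum_add_distrib]
        refine Finset.sum_congr rfl fun p hp => ?_
        have hp0 := (Nat.prime_of_mem_primesBelow hp).ne_zero
        change (1 - (1 - χ p) / N) * (p : ℝ) ^ (-σ) = (if p = 0 then 0 else 1) * (p : ℝ) ^ (-σ) *
          (1 - 1 / N) + χ p * (p : ℝ) ^ (-σ) * (1 / N)
        rw [if_neg hp0]; ring
    refine (Real.exp_le_exp.2 h1).trans ?_
    rw [Real.exp_add, Real.exp_mul, Real.exp_mul]
    refine mul_le_mul ?_ ?_ (by positivity) ?_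
    · exact Real.rpow_le_rpow (Real.exp_pos _).le (exp_sum_primes_le f₁ hs₁ M) (sub_nonneg.2 hinv)
    · exact Real.rpow_le_rpow (Real.exp_pos _).le (exp_sum_primes_le f₂ hs₂ M) hinv0
    · exact Real.rpow_nonneg (prod_primes_inv_pos f₁ hs₁ M) _
  have hL₁ : ∑' n, f₁ n ≤ 2 * ℓ := by
    refine (twist_tsum_le oneChar hone σ hσ hσ1).trans ?_
    rw [hσdef, add_sub_cancel_left, one_div_one_div]; linarith
  have hL₂ : ∑' n, f₂ n ≤ 2 * (1 + Real.log Q) := by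
    refine (twist_tsum_le_log χ hχ Q hQ hsum σ hσ hσ1).trans ?_
    linarith
  have hp₁ : 0 ≤ ∑' n, f₁ n :=
    ge_of_tendsto' (EulerProduct.eulerProduct_completely_multiplicative hs₁)
      (prod_primes_inv_pos f₁ hs₁)
  have hp₂ : 0 ≤ ∑' n, f₂ n :=
    ge_of_tendsto' (EulerProduct.eulerProduct_completely_multiplicative hs₂)
      (prod_primes_inv_pos f₂ hs₂)
  have hinv : 1 / (N : ℝ) ≤ 1 := by rw [div_le_one hNpos]; linarith
  have hC : (∑' n, f₁ n) ^ (1 - 1 / N : ℝ) * (∑' n, f₂ n) ^ (1 / N : ℝ) ≤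
      2 * ℓ * ((1 + Real.log Q) / ℓ) ^ (1 / N : ℝ) := by
    calc _ ≤ (2 * ℓ) ^ (1 - 1 / N : ℝ) * (2 * (1 + Real.log Q)) ^ (1 / N : ℝ) := by
          refine mul_le_mul (Real.rpow_le_rpow hp₁ hL₁ (sub_nonneg.2 hinv))
            (Real.rpow_le_rpow hp₂ hL₂ (by positivity)) (Real.rpow_nonneg hp₂ _) (by positivity)
      _ = _ := by
          rw [Real.rpow_sub (by positivity), Real.rpow_one, div_mul_eq_mul_div, mul_div_assoc,
            ← Real.div_rpow (by positivity) (by positivity), mul_div_mul_left _ _ two_ne_zero]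
  have hmain := sum_squarefree_le_log_sum g hg0 hg1 y hy
  have hfin : ℓ * ∑ n ∈ (Icc 1 y).filter Squarefree, ∏ p ∈ n.primeFactors, g p ≤
      ℓ * (24 * y * ((1 + Real.log Q) / ℓ) ^ (1 / N : ℝ)) := by
    refine hmain.trans ?_
    have h1 := hA.trans (mul_le_mul_of_nonneg_left (hB.trans hC) (Real.exp_pos 1).le)
    refine (mul_le_mul_of_nonneg_left h1 (by positivity)).trans ?_
    have he : Real.exp 1 ≤ 3 := by
      have := Real.exp_one_lt_d9; linarith
    have hT : 0 ≤ (y : ℝ) * ℓ * ((1 + Real.log Q) / ℓ) ^ (1 / N : ℝ) := by positivity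
    nlinarith
  exact le_of_mul_le_mul_left hfin hℓ0

/-- The (possibly twisted by the character mod 4) Jacobi symbol, as an integer valued function. -/
def qsym (ε : Bool) (Q n : ℕ) : ℤ := (if ε then ZMod.χ₄ n else 1) * jacobiSym n Q

theorem qsym_mul (ε : Bool) (Q m n : ℕ) : qsym ε Q (m * n) = qsym ε Q m * qsym ε Q n := by
  unfold qsym
  push_cast
  rw [jacobiSym.mul_left, map_mul]
  cases ε
  · simp
  · simp; ring

theorem qsym_one (ε : Bool) (Q : ℕ) : qsym ε Q 1 = 1 := by
  cases ε <;> simp [qsym, jacobiSym.one_left]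

theorem abs_jacobiSym_le (a : ℤ) (b : ℕ) : |jacobiSym a b| ≤ 1 := by
  rcases jacobiSym.trichotomy a b with h | h | h <;> simp [h]

theorem abs_chi4_le (a : ZMod 4) : |ZMod.χ₄ a| ≤ 1 := by
  revert a; decide

theorem abs_qsym_le (ε : Bool) (Q n : ℕ) : |qsym ε Q n| ≤ 1 := by
  unfold qsym
  rw [abs_mul]
  refine mul_le_one₀ ?_ (abs_nonneg _) (abs_jacobiSym_le _ _)
  split_ifs
  · exact abs_chi4_le _
  · simp

theorem qsym_add_period (ε : Bool) (Q n : ℕ) : qsym ε Q (n + 4 * Q) = qsym ε Q n := by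
  unfold qsym
  have h1 : ((n + 4 * Q : ℕ) : ZMod 4) = (n : ZMod 4) := by
    push_cast
    have : (4 : ZMod 4) = 0 := by decide
    rw [this]; simp
  rw [h1]
  congr 1
  rw [jacobiSym.mod_left, jacobiSym.mod_left (n : ℤ)]
  congr 1
  push_cast
  exact Int.add_mul_emod_self_right _ _ _

theorem qsym_congr (ε : Bool) (Q : ℕ) {m n : ℕ} (h : m ≡ n [MOD 4 * Q]) :
    qsym ε Q m = qsym ε Q n := by
  have key : ∀ m : ℕ, qsym ε Q m = qsym ε Q (m % (4 * Q)) := by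
    intro m
    conv_lhs => rw [← Nat.mod_add_div m (4 * Q)]
    generalize m / (4 * Q) = t
    induction t with
    | zero => simp
    | succ t ih => rw [Nat.mul_succ, ← add_assoc, qsym_add_period, ih]
  rw [key m, key n, h]

/-- Nondegeneracy: the symbol is a nontrivial character. -/
def QNontrivial (ε : Bool) (Q : ℕ) : Prop :=
  Odd Q ∧ ((ε = true ∧ Q = 1) ∨ ∃ p r : ℕ, p.Prime ∧ Q = p * r ∧ p.Coprime r)

theorem exists_jacobiSym_eq_neg_one (p : ℕ) (hp : p.Prime) (h2 : p ≠ 2) :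
    ∃ a : ℕ, jacobiSym a p = -1 := by
  have := Fact.mk hp
  obtain ⟨a, ha⟩ := FiniteField.exists_nonsquare (F := ZMod p) (by rwa [ZMod.ringChar_zmod_n])
  refine ⟨a.val, ?_⟩
  rw [← jacobiSym.legendreSym.to_jacobiSym, legendreSym.eq_neg_one_iff]
  simpa using ha

theorem exists_qsym_eq_neg_one {ε : Bool} {Q : ℕ} (h : QNontrivial ε Q) :
    ∃ u : ℕ, u.Coprime (4 * Q) ∧ qsym ε Q u = -1 := by
  obtain ⟨hodd, ⟨rfl, rfl⟩ | ⟨p, r, hp, rfl, hc⟩⟩ := h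
  · refine ⟨3, by norm_num, ?_⟩
    simp [qsym]
  · have hp2 : p ≠ 2 := by
      rintro rfl
      rw [Nat.odd_mul] at hodd
      exact absurd hodd.1 (by decide)
    obtain ⟨a, ha⟩ := exists_jacobiSym_eq_neg_one p hp hp2
    have hro : Odd r := (Nat.odd_mul.1 hodd).2
    have hpo : Odd p := (Nat.odd_mul.1 hodd).1
    have hcop : p.Coprime (4 * r) := by
      refine Nat.Coprime.mul_right ?_ hc
      have : Nat.Coprime p 2 := Nat.coprime_two_right.2 hpo
      exact Nat.Coprime.pow_right 2 this
    obtain ⟨u, hu1, hu2⟩ := Nat.chineseRemainder hcop a 1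
    have h1 : jacobiSym u p = -1 := by
      rw [← ha, jacobiSym.mod_left, jacobiSym.mod_left (a : ℤ)]
      congr 1
      exact_mod_cast hu1
    have h2 : jacobiSym u r = 1 := by
      rw [jacobiSym.mod_left]
      have : (u : ℤ) % r = 1 % r := by
        have := Nat.ModEq.of_mul_left 4 hu2
        exact_mod_cast this
      rw [this, ← jacobiSym.mod_left, jacobiSym.one_left]
    have h4 : u % 4 = 1 := Nat.ModEq.of_mul_right r hu2
    have h5 : ZMod.χ₄ u = 1 := ZMod.χ₄_nat_one_mod_four h4
    have : NeZero p := ⟨hp.ne_zero⟩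
    have hr0 : r ≠ 0 := by rintro rfl; simp at hro
    have : NeZero r := ⟨hr0⟩
    have hJ : jacobiSym u (p * r) = -1 := by
      rw [jacobiSym.mul_right, h1, h2]; simp
    refine ⟨u, ?_, ?_⟩
    · refine Nat.Coprime.mul_right ?_ ?_
      · have : u.Coprime 2 := by
          rw [Nat.coprime_two_right]; rw [Nat.odd_iff]; omega
        exact Nat.Coprime.pow_right 2 this
      · by_contra hne
        have : jacobiSym u (p * r) = 0 := by
          have : NeZero (p * r) := ⟨mul_ne_zero hp.ne_zero hr0⟩
          rw [jacobiSym.eq_zero_iff_not_coprime]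
          rwa [Int.gcd_natCast_natCast]
        rw [hJ] at this
        norm_num at this
    · simp [qsym, h5, hJ]

theorem sum_period_eq_zero {ε : Bool} {Q : ℕ} (h : QNontrivial ε Q) :
    ∑ n ∈ range (4 * Q), qsym ε Q n = 0 := by
  have hQ : 0 < Q := h.1.pos
  have : NeZero (4 * Q) := ⟨by omega⟩
  obtain ⟨u, huc, hu⟩ := exists_qsym_eq_neg_one h
  have h1 : ∑ n ∈ range (4 * Q), qsym ε Q n = ∑ x : ZMod (4 * Q), qsym ε Q x.val := by
    refine Finset.sum_nbij' (fun n => (n : ZMod (4 * Q))) (fun x => x.val) ?_ ?_ ?_ ?_ ?_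
    · simp
    · intro x _; exact mem_range.2 (ZMod.val_lt x)
    · intro n hn; exact ZMod.val_cast_of_lt (mem_range.1 hn)
    · intro x _; simp
    · intro n hn
      rw [ZMod.val_cast_of_lt (mem_range.1 hn)]
  rw [h1]
  let w := ZMod.unitOfCoprime u huc
  have h2 : ∑ x : ZMod (4 * Q), qsym ε Q x.val = ∑ x : ZMod (4 * Q), qsym ε Q ((w : ZMod (4 * Q)) * x).val :=
    (Equiv.sum_comp (Units.mulLeft w) (fun x : ZMod (4 * Q) => qsym ε Q x.val)).symm
  have h3 : ∀ x : ZMod (4 * Q), qsym ε Q ((w : ZMod (4 * Q)) * x).val = - qsym ε Q x.val := by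
    intro x
    have : ((w : ZMod (4 * Q)) * x).val ≡ u * x.val [MOD 4 * Q] := by
      rw [← ZMod.natCast_eq_natCast_iff]
      simp [w]
    rw [qsym_congr ε Q this, qsym_mul, hu]; ring
  simp only [h3, Finset.sum_neg_distrib] at h2
  omega

theorem abs_sum_qsym_le {ε : Bool} {Q : ℕ} (h : QNontrivial ε Q) (t : ℕ) :
    |∑ n ∈ range t, qsym ε Q n| ≤ 4 * Q := by
  have hQ : 0 < Q := h.1.pos
  induction t using Nat.strong_induction_on with
  | _ t ih =>
    by_cases ht : t < 4 * Q
    · refine (Finset.abs_sum_le_sum_abs _ _).trans ?_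
      refine (Finset.sum_le_sum fun n _ => abs_qsym_le ε Q n).trans ?_
      simp; omega
    · push Not at ht
      obtain ⟨s, rfl⟩ := Nat.exists_eq_add_of_le ht
      rw [Finset.sum_range_add, sum_period_eq_zero h, zero_add]
      have : ∀ x, qsym ε Q (4 * Q + x) = qsym ε Q x := fun x => by
        rw [add_comm, qsym_add_period]
      simp only [this]
      exact ih s (by omega)

theorem qsym_zero {ε : Bool} {Q : ℕ} (h : QNontrivial ε Q) : qsym ε Q 0 = 0 := by
  obtain ⟨hodd, ⟨rfl, rfl⟩ | ⟨p, r, hp, rfl, hc⟩⟩ := h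
  · simp [qsym]
  · have : 1 < p * r := by
      have h1 := hp.one_lt
      have h2 : 0 < r := by
        rcases Nat.eq_zero_or_pos r with h | h
        · simp [h] at hodd
        · exact h
      nlinarith
    simp [qsym, jacobiSym.zero_left this]

/-- The symbol as a completely multiplicative real function. -/
def qchar (ε : Bool) (Q : ℕ) : ℕ →*₀ ℝ where
  toFun n := if n = 0 then 0 else (qsym ε Q n : ℝ)
  map_zero' := by simp
  map_one' := by simp [qsym_one]
  map_mul' a b := by
    by_cases ha : a = 0 <;> by_cases hb : b = 0 <;> simp [ha, hb, qsym_mul]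

theorem qchar_apply {ε : Bool} {Q n : ℕ} (hn : n ≠ 0) : qchar ε Q n = qsym ε Q n := by
  change (if n = 0 then (0 : ℝ) else (qsym ε Q n : ℝ)) = _
  rw [if_neg hn]

theorem abs_qchar_le (ε : Bool) (Q n : ℕ) : |qchar ε Q n| ≤ 1 := by
  by_cases hn : n = 0
  · simp [hn]
  · rw [qchar_apply hn]; exact_mod_cast abs_qsym_le ε Q n

theorem abs_sum_qchar_le {ε : Bool} {Q : ℕ} (h : QNontrivial ε Q) (t : ℕ) :
    |∑ n ∈ range t, qchar ε Q n| ≤ 4 * Q := by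
  have : ∀ n, qchar ε Q n = (qsym ε Q n : ℝ) := by
    intro n
    by_cases hn : n = 0
    · rw [hn, map_zero, qsym_zero h]; simp
    · exact qchar_apply hn
  simp only [this]
  exact_mod_cast abs_sum_qsym_le h t

theorem QNontrivial.of_squarefree {ε : Bool} {Q : ℕ} (hodd : Odd Q) (hsq : Squarefree Q)
    (h1 : Q ≠ 1) : QNontrivial ε Q := by
  refine ⟨hodd, Or.inr ?_⟩
  obtain ⟨p, hp, r, rfl⟩ := Nat.exists_prime_and_dvd h1
  exact ⟨p, r, hp, rfl, (Nat.squarefree_mul_iff.1 hsq).1⟩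

/-- The indicator of `1`, completely multiplicative. -/
def deltaChar : ℕ →*₀ ℝ where
  toFun n := if n = 1 then 1 else 0
  map_zero' := by simp
  map_one' := by simp
  map_mul' a b := by
    by_cases ha : a = 1 <;> by_cases hb : b = 1 <;> simp [ha, hb]

/-- The bound for sums over squarefree numbers, with a nontrivial real character. -/
theorem sum_squarefree_qchar_le {ε : Bool} {Q : ℕ} (h : QNontrivial ε Q) (N : ℕ) (hN : 2 ≤ N)
    (y : ℕ) (hy : 1 ≤ y) :
    ∑ n ∈ (Icc 1 y).filter Squarefree, ∏ p ∈ n.primeFactors, (1 - (1 - qchar ε Q p) / N) ≤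
      24 * y * ((1 + Real.log (4 * Q)) / (1 + Real.log y)) ^ (1 / N : ℝ) := by
  refine sum_squarefree_char_le _ (abs_qchar_le ε Q) _ ?_ (abs_sum_qchar_le h) N hN y hy
  have : (1 : ℝ) ≤ Q := by exact_mod_cast h.1.pos
  linarith

theorem sum_squarefree_const_le (N : ℕ) (hN : 2 ≤ N) (y : ℕ) (hy : 1 ≤ y) :
    ∑ n ∈ (Icc 1 y).filter Squarefree, ∏ _p ∈ n.primeFactors, (1 - 1 / (N : ℝ)) ≤
      24 * y * (1 / (1 + Real.log y)) ^ (1 / N : ℝ) := by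
  have h := sum_squarefree_char_le deltaChar ?_ 1 le_rfl ?_ N hN y hy
  · rw [Real.log_one, add_zero] at h
    refine le_trans (le_of_eq ?_) h
    refine Finset.sum_congr rfl fun n _ => Finset.prod_congr rfl fun p hp => ?_
    have : deltaChar p = 0 := by
      change (if p = 1 then (1 : ℝ) else 0) = 0
      rw [if_neg (Nat.prime_of_mem_primeFactors hp).ne_one]
    rw [this, sub_zero]
  · intro n
    change |if n = 1 then (1 : ℝ) else 0| ≤ 1
    split_ifs <;> simp
  · intro t
    change |∑ n ∈ range t, if n = 1 then (1 : ℝ) else 0| ≤ 1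
    rw [Finset.sum_ite_eq']
    split_ifs <;> simp

theorem card_divisors_mul_le (m n : ℕ) :
    (m * n).divisors.card ≤ m.divisors.card * n.divisors.card := by
  rw [Nat.divisors_mul]
  exact Finset.card_mul_le

theorem sum_divisors_pow_div_le (A j : ℕ) :
    ∑ a ∈ Icc 1 A, (a.divisors.card : ℝ) ^ j / a ≤ (∑ a ∈ Icc 1 A, (1 : ℝ) / a) ^ (2 ^ j) := by
  induction j with
  | zero => simp
  | succ j ih =>
    have h1 : ∑ a ∈ Icc 1 A, (a.divisors.card : ℝ) ^ (j + 1) / a ≤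
        (∑ a ∈ Icc 1 A, (a.divisors.card : ℝ) ^ j / a) ^ 2 := by
      have h2 : ∀ a ∈ Icc 1 A, (a.divisors.card : ℝ) ^ (j + 1) / a =
          ∑ u ∈ a.divisors, (a.divisors.card : ℝ) ^ j / a := by
        intro a _
        rw [Finset.sum_const, nsmul_eq_mul]; ring
      rw [Finset.sum_congr rfl h2, Finset.sum_sigma', sq, Finset.sum_mul_sum,
        ← Finset.sum_product']
      refine sum_le_sum_of_injOn' (fun x : (_ : ℕ) × ℕ => (x.2, x.1 / x.2)) ?_ ?_ ?_ ?_
      · rintro ⟨a, u⟩ h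
        simp only [mem_sigma, mem_Icc, Nat.mem_divisors, mem_product] at h ⊢
        obtain ⟨⟨h1, h2⟩, ⟨v, rfl⟩, h3⟩ := h
        have hu : 0 < u := Nat.pos_of_ne_zero (by rintro rfl; simp at h3)
        have hv : 0 < v := Nat.pos_of_ne_zero (by rintro rfl; simp at h3)
        rw [Nat.mul_div_cancel_left _ hu]
        exact ⟨⟨hu, by nlinarith⟩, hv, by nlinarith⟩
      · rintro ⟨a, u⟩ h ⟨a', u'⟩ h' e
        simp only [coe_sigma, Set.mem_sigma_iff, mem_coe, mem_Icc, Nat.mem_divisors] at h h'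
        simp only [Prod.mk.injEq] at e
        obtain ⟨rfl, e2⟩ := e
        have : a = a' := by
          rw [← Nat.div_mul_cancel h.2.1, ← Nat.div_mul_cancel h'.2.1, e2]
        subst this; rfl
      · rintro ⟨a, u⟩ h
        simp only [mem_sigma, mem_Icc, Nat.mem_divisors] at h ⊢
        obtain ⟨⟨h1, h2⟩, ⟨v, rfl⟩, h3⟩ := h
        have hu : 0 < u := Nat.pos_of_ne_zero (by rintro rfl; simp at h3)
        have hv : 0 < v := Nat.pos_of_ne_zero (by rintro rfl; simp at h3)
        rw [Nat.mul_div_cancel_left _ hu, div_mul_div_comm, ← mul_pow]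
        push_cast
        gcongr
        exact_mod_cast card_divisors_mul_le u v
      · intro b _
        positivity
    refine h1.trans ?_
    rw [pow_succ 2 j, pow_mul]
    exact pow_le_pow_left₀ (Finset.sum_nonneg fun a _ => by positivity) ih 2

theorem sum_one_div_le (A : ℕ) : ∑ a ∈ Icc 1 A, (1 : ℝ) / a ≤ 1 + Real.log A := by
  have h := harmonic_le_one_add_log A
  rw [harmonic_eq_sum_Icc] at h
  push_cast at h
  simpa [one_div] using h

theorem sum_divisors_pow_le (A j : ℕ) :
    ∑ a ∈ Icc 1 A, (a.divisors.card : ℝ) ^ j ≤ A * (1 + Real.log A) ^ (2 ^ j) := by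
  have h1 : ∀ a ∈ Icc 1 A, (a.divisors.card : ℝ) ^ j ≤ A * ((a.divisors.card : ℝ) ^ j / a) := by
    intro a ha
    obtain ⟨h1, h2⟩ := mem_Icc.1 ha
    have ha0 : (0 : ℝ) < a := by exact_mod_cast h1
    rw [mul_div_assoc', le_div_iff₀ ha0, mul_comm]
    gcongr
  refine (Finset.sum_le_sum h1).trans ?_
  rw [← Finset.mul_sum]
  refine mul_le_mul_of_nonneg_left ((sum_divisors_pow_div_le A j).trans ?_) (by positivity)
  exact pow_le_pow_left₀ (Finset.sum_nonneg fun a _ => by positivity) (sum_one_div_le A) _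

theorem card_fiber_prod_le (A n : ℕ) (hn : n ≠ 0) :
    ((Fintype.piFinset fun _ : Fin 4 => Icc 1 A).filter fun t => ∏ i, t i = n).card ≤
      n.divisors.card ^ 3 := by
  have : n.divisors.card ^ 3 = (n.divisors ×ˢ n.divisors ×ˢ n.divisors).card := by
    rw [card_product, card_product]; ring
  rw [this]
  refine Finset.card_le_card_of_injOn (fun t => (t 0, t 1, t 2)) ?_ ?_
  · intro t ht
    simp only [coe_filter, Set.mem_ofPred_eq] at ht
    have hd : ∀ i, t i ∈ n.divisors := fun i => by
      rw [Nat.mem_divisors]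
      exact ⟨ht.2 ▸ Finset.dvd_prod_of_mem t (mem_univ i), hn⟩
    simp [hd]
  · intro t ht t' ht' e
    simp only [coe_filter, Set.mem_ofPred_eq] at ht ht'
    simp only [Prod.mk.injEq] at e
    have h1 := ht.2
    have h2 := ht'.2
    rw [Fin.prod_univ_four] at h1 h2
    obtain ⟨e0, e1, e2⟩ := e
    rw [← e0, ← e1, ← e2] at h2
    have h3 : t 0 * t 1 * t 2 ≠ 0 := by
      intro h; rw [h, zero_mul] at h1; exact hn h1.symm
    have e3 : t 3 = t' 3 := Nat.eq_of_mul_eq_mul_left (Nat.pos_of_ne_zero h3) (h1.trans h2.symm)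
    ext i
    fin_cases i <;> assumption

/-- The second moment over `n` of sums of Jacobi symbols. -/
theorem sum_sq_jacobi_le (S : Finset ℕ) (B M : ℕ) (hS : ∀ b ∈ S, Odd b ∧ Squarefree b ∧ b ≤ B) :
    ∑ n ∈ range M, (∑ b ∈ S, (jacobiSym n b : ℝ)) ^ 2 ≤ B * M + 4 * (B : ℝ) ^ 4 := by
  have hcard : S.card ≤ B := by
    have : S ⊆ Icc 1 B := fun b hb => mem_Icc.2 ⟨(hS b hb).1.pos, (hS b hb).2.2⟩
    simpa using card_le_card this
  have h1 : ∑ n ∈ range M, (∑ b ∈ S, (jacobiSym n b : ℝ)) ^ 2 =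
      ∑ b ∈ S, ∑ c ∈ S, ∑ n ∈ range M, (jacobiSym n b : ℝ) * jacobiSym n c := by
    simp only [sq, Finset.sum_mul_sum]
    rw [Finset.sum_comm]
    refine Finset.sum_congr rfl fun b _ => ?_
    rw [Finset.sum_comm]
  rw [h1]
  have h2 : ∀ b ∈ S, ∀ c ∈ S, ∑ n ∈ range M, (jacobiSym n b : ℝ) * jacobiSym n c ≤
      (if b = c then (M : ℝ) else 0) + 4 * (B : ℝ) ^ 2 := by
    intro b hb c hc
    by_cases hbc : b = c
    · rw [if_pos hbc]
      have : ∑ n ∈ range M, (jacobiSym n b : ℝ) * jacobiSym n c ≤ ∑ n ∈ range M, 1 := by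
        refine Finset.sum_le_sum fun n _ => ?_
        have hh := abs_jacobiSym_le n b
        have hh' := abs_jacobiSym_le n c
        have : |(jacobiSym n b : ℝ) * jacobiSym n c| ≤ 1 := by
          rw [abs_mul]
          exact mul_le_one₀ (by exact_mod_cast hh) (abs_nonneg _) (by exact_mod_cast hh')
        exact (le_abs_self _).trans this
      simp only [sum_const, card_range, nsmul_eq_mul, mul_one] at this
      have h4 : (0 : ℝ) ≤ 4 * (B : ℝ) ^ 2 := by positivity
      linarith
    · rw [if_neg hbc, zero_add]
      obtain ⟨ob, sb, lb⟩ := hS b hb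
      obtain ⟨oc, sc, lc⟩ := hS c hc
      have hb0 : NeZero b := ⟨ob.pos.ne'⟩
      have hc0 : NeZero c := ⟨oc.pos.ne'⟩
      have hnt : QNontrivial false (b * c) := by
        refine ⟨ob.mul oc, Or.inr ?_⟩
        have key : ∀ x y : ℕ, Squarefree x → Squarefree y → ∀ p, p ∈ x.primeFactors →
            p ∉ y.primeFactors → ∃ p r : ℕ, p.Prime ∧ x * y = p * r ∧ p.Coprime r := by
          intro x y hx hy p hpx hpy
          have hp := Nat.prime_of_mem_primeFactors hpx
          obtain ⟨r, rfl⟩ := Nat.dvd_of_mem_primeFactors hpx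
          refine ⟨p, r * y, hp, by ring, Nat.Coprime.mul_right (Nat.squarefree_mul_iff.1 hx).1 ?_⟩
          rw [Nat.Prime.coprime_iff_not_dvd hp]
          intro hd
          exact hpy (Nat.mem_primeFactors.2 ⟨hp, hd, hy.ne_zero⟩)
        by_cases hsub : b.primeFactors ⊆ c.primeFactors
        · by_cases hsub' : c.primeFactors ⊆ b.primeFactors
          · exfalso
            apply hbc
            rw [← Nat.prod_primeFactors_of_squarefree sb, ← Nat.prod_primeFactors_of_squarefree sc,
              hsub.antisymm hsub']
          · obtain ⟨p, h1, h2⟩ := Finset.not_subset.1 hsub'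
            rw [mul_comm]
            exact key c b sc sb p h1 h2
        · obtain ⟨p, h1, h2⟩ := Finset.not_subset.1 hsub
          exact key b c sb sc p h1 h2
      have h3 := abs_sum_qsym_le hnt M
      have h4 : ∑ n ∈ range M, (jacobiSym n b : ℝ) * jacobiSym n c =
          ((∑ n ∈ range M, qsym false (b * c) n : ℤ) : ℝ) := by
        push_cast
        refine Finset.sum_congr rfl fun n _ => ?_
        simp [qsym, jacobiSym.mul_right]
      rw [h4]
      have h5 : ((∑ n ∈ range M, qsym false (b * c) n : ℤ) : ℝ) ≤ 4 * ((b * c : ℕ) : ℝ) := by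
        have := (le_abs_self _).trans h3
        exact_mod_cast this
      refine h5.trans ?_
      have : ((b * c : ℕ) : ℝ) ≤ (B : ℝ) ^ 2 := by
        rw [sq]; exact_mod_cast Nat.mul_le_mul lb lc
      linarith
  refine (Finset.sum_le_sum fun b hb => Finset.sum_le_sum fun c hc => h2 b hb c hc).trans ?_
  have h3 : ∀ b ∈ S, ∑ c ∈ S, ((if b = c then (M : ℝ) else 0) + 4 * (B : ℝ) ^ 2) =
      M + S.card * (4 * (B : ℝ) ^ 2) := by
    intro b hb
    rw [Finset.sum_add_distrib, Finset.sum_ite_eq, if_pos hb, sum_const, nsmul_eq_mul]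
  rw [Finset.sum_congr rfl h3, sum_const, nsmul_eq_mul]
  have hc : (S.card : ℝ) ≤ B := by exact_mod_cast hcard
  have hc0 : (0 : ℝ) ≤ S.card := by positivity
  calc (S.card : ℝ) * (M + S.card * (4 * (B : ℝ) ^ 2)) ≤ B * (M + B * (4 * (B : ℝ) ^ 2)) := by gcongr
    _ = _ := by ring

/-- The bilinear estimate in a box whose first side is the longer one. -/
theorem bilinear_box (α β : ℕ → ℝ) (hα : ∀ n, |α n| ≤ 1) (hβ : ∀ n, |β n| ≤ 1)
    (hβs : ∀ n, β n ≠ 0 → Odd n ∧ Squarefree n) (A B : ℕ) (hB : 1 ≤ B) (hAB : B ≤ A) :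
    (∑ a ∈ Icc 1 A, ∑ b ∈ Icc 1 B, α a * β b * jacobiSym a b) ^ 8 ≤
      6 * (A : ℝ) ^ 8 * (B : ℝ) ^ 7 * (1 + Real.log A) ^ 32 := by
  set S := (Icc 1 B).filter fun b => Odd b ∧ Squarefree b with hS
  have hSm : ∀ b ∈ S, Odd b ∧ Squarefree b ∧ b ≤ B := by
    intro b hb
    simp only [hS, mem_filter, mem_Icc] at hb
    exact ⟨hb.2.1, hb.2.2, hb.1.2⟩
  have hcard : (S.card : ℝ) ≤ B := by
    have := card_filter_le (Icc 1 B) (fun b => Odd b ∧ Squarefree b)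
    rw [← hS] at this
    simp at this
    exact_mod_cast this
  set F : ℕ → ℝ := fun b => ∑ a ∈ Icc 1 A, α a * jacobiSym a b with hF
  have hR : ∑ a ∈ Icc 1 A, ∑ b ∈ Icc 1 B, α a * β b * jacobiSym a b = ∑ b ∈ S, β b * F b := by
    rw [Finset.sum_comm]
    rw [← Finset.sum_filter_add_sum_filter_not (Icc 1 B) (fun b => Odd b ∧ Squarefree b)]
    rw [← hS]
    have h0 : ∑ b ∈ (Icc 1 B).filter (fun b => ¬ (Odd b ∧ Squarefree b)),
        ∑ a ∈ Icc 1 A, α a * β b * (jacobiSym a b : ℝ) = 0 := by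
      refine Finset.sum_eq_zero fun b hb => Finset.sum_eq_zero fun a _ => ?_
      have : β b = 0 := by
        by_contra h
        exact (mem_filter.1 hb).2 (hβs b h)
      rw [this]; ring
    rw [h0, add_zero]
    refine Finset.sum_congr rfl fun b _ => ?_
    rw [hF, Finset.mul_sum]
    exact Finset.sum_congr rfl fun a _ => by ring
  rw [hR]
  set R := ∑ b ∈ S, β b * F b with hRdef
  have c1 : R ^ 2 ≤ B * ∑ b ∈ S, F b ^ 2 := by
    refine (sq_sum_le_card_mul_sum_sq).trans ?_
    refine mul_le_mul hcard (Finset.sum_le_sum fun b _ => ?_)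
      (Finset.sum_nonneg fun _ _ => sq_nonneg _) (by positivity)
    rw [mul_pow]
    refine mul_le_of_le_one_left (sq_nonneg _) ?_
    rw [sq_le_one_iff_abs_le_one]; exact hβ b
  have c2 : (∑ b ∈ S, F b ^ 2) ^ 2 ≤ B * ∑ b ∈ S, F b ^ 4 := by
    refine (sq_sum_le_card_mul_sum_sq).trans ?_
    refine mul_le_mul hcard (le_of_eq (Finset.sum_congr rfl fun b _ => by ring))
      (Finset.sum_nonneg fun _ _ => sq_nonneg _) (by positivity)
  set T := Fintype.piFinset fun _ : Fin 4 => Icc 1 A with hT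
  set H : ℕ → ℝ := fun n => ∑ b ∈ S, (jacobiSym n b : ℝ) with hH
  have c3 : ∑ b ∈ S, F b ^ 4 = ∑ t ∈ T, (∏ i, α (t i)) * H (∏ i, t i) := by
    have : ∀ b ∈ S, F b ^ 4 = ∑ t ∈ T, (∏ i, α (t i)) * jacobiSym ((∏ i, t i : ℕ) : ℤ) b := by
      intro b _
      have h1 : F b ^ 4 = ∏ _i : Fin 4, F b := by simp
      rw [h1, hF, Finset.prod_univ_sum]
      refine Finset.sum_congr rfl fun t _ => ?_
      rw [Finset.prod_mul_distrib]
      congr 1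
      simp only [Fin.prod_univ_four]
      push_cast
      simp only [jacobiSym.mul_left]
      push_cast
      ring
    rw [Finset.sum_congr rfl this, Finset.sum_comm]
    refine Finset.sum_congr rfl fun t _ => ?_
    rw [hH, Finset.mul_sum]
  set M := A ^ 4 + 1 with hM
  have hmaps : ∀ t ∈ T, ∏ i, t i ∈ range M := by
    intro t ht
    rw [mem_range, hM, Nat.lt_succ_iff]
    have h1 : ∀ i, t i ≤ A := fun i => (mem_Icc.1 (Fintype.mem_piFinset.1 ht i)).2
    calc ∏ i, t i ≤ ∏ _i : Fin 4, A := Finset.prod_le_prod' fun i _ => h1 i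
      _ = A ^ 4 := by simp
  have hT0 : ∀ t ∈ T, ∏ i, t i ≠ 0 := by
    intro t ht
    refine Finset.prod_ne_zero_iff.2 fun i _ => ?_
    have := (mem_Icc.1 (Fintype.mem_piFinset.1 ht i)).1
    omega
  set r : ℕ → ℝ := fun n => ((T.filter fun t => ∏ i, t i = n).card : ℝ) with hr
  have c4 : (∑ t ∈ T, (∏ i, α (t i)) * H (∏ i, t i)) ^ 2 ≤
      (∑ n ∈ range M, r n ^ 2) * ∑ n ∈ range M, H n ^ 2 := by
    rw [← Finset.sum_fiberwise_of_maps_to hmaps]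
    have h1 : ∀ n ∈ range M, ∑ t ∈ T with ∏ i, t i = n, (∏ i, α (t i)) * H (∏ i, t i) =
        (∑ t ∈ T with ∏ i, t i = n, (∏ i, α (t i))) * H n := by
      intro n _
      rw [Finset.sum_mul]
      refine Finset.sum_congr rfl fun t ht => ?_
      rw [(mem_filter.1 ht).2]
    rw [Finset.sum_congr rfl h1]
    refine (Finset.sum_mul_sq_le_sq_mul_sq _ _ _).trans ?_
    refine mul_le_mul_of_nonneg_right (Finset.sum_le_sum fun n _ => ?_)
      (Finset.sum_nonneg fun _ _ => sq_nonneg _)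
    rw [← sq_abs]
    refine pow_le_pow_left₀ (abs_nonneg _) ?_ 2
    refine (Finset.abs_sum_le_sum_abs _ _).trans ?_
    rw [hr]
    simp only
    rw [Finset.card_eq_sum_ones]
    push_cast
    refine Finset.sum_le_sum fun t _ => ?_
    rw [Finset.abs_prod]
    exact Finset.prod_le_one (fun _ _ => abs_nonneg _) fun i _ => hα _
  have c5 : ∑ n ∈ range M, r n ^ 2 ≤ (A : ℝ) ^ 4 * (1 + Real.log A) ^ 32 := by
    have h1 : ∑ n ∈ range M, r n ^ 2 = ∑ t ∈ T, r (∏ i, t i) := by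
      rw [← Finset.sum_fiberwise_of_maps_to hmaps]
      refine Finset.sum_congr rfl fun n _ => ?_
      rw [Finset.sum_congr rfl (g := fun _ => r n) (fun t ht => by rw [(mem_filter.1 ht).2]),
        Finset.sum_const, nsmul_eq_mul, sq]
    rw [h1]
    have h2 : ∀ t ∈ T, r (∏ i, t i) ≤ ∏ i, ((t i).divisors.card : ℝ) ^ 3 := by
      intro t ht
      have h3 : r (∏ i, t i) ≤ ((∏ i, t i).divisors.card : ℝ) ^ 3 := by
        simp only [hr]
        exact_mod_cast card_fiber_prod_le A _ (hT0 t ht)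
      refine h3.trans ?_
      rw [Finset.prod_pow]
      refine pow_le_pow_left₀ (by positivity) ?_ 3
      rw [Fin.prod_univ_four, Fin.prod_univ_four]
      have e1 := card_divisors_mul_le (t 0 * t 1 * t 2) (t 3)
      have e2 := card_divisors_mul_le (t 0 * t 1) (t 2)
      have e3 := card_divisors_mul_le (t 0) (t 1)
      have : (t 0 * t 1 * t 2 * t 3).divisors.card ≤
          (t 0).divisors.card * (t 1).divisors.card * (t 2).divisors.card *
            (t 3).divisors.card :=
        e1.trans (Nat.mul_le_mul_right _ (e2.trans (Nat.mul_le_mul_right _ e3)))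
      exact_mod_cast this
    refine (Finset.sum_le_sum h2).trans ?_
    rw [hT, ← Finset.prod_univ_sum (fun _ : Fin 4 => Icc 1 A)
      (fun _ a => ((a : ℕ).divisors.card : ℝ) ^ 3)]
    rw [Finset.prod_const, card_univ, Fintype.card_fin]
    refine (pow_le_pow_left₀ (Finset.sum_nonneg fun _ _ => by positivity)
      (sum_divisors_pow_le A 3) 4).trans (le_of_eq ?_)
    rw [mul_pow, ← pow_mul]
    norm_num
  have hA1 : (1 : ℝ) ≤ A := by exact_mod_cast hB.trans hAB
  have hB1 : (1 : ℝ) ≤ B := by exact_mod_cast hB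
  have hBA : (B : ℝ) ≤ A := by exact_mod_cast hAB
  have c6 : ∑ n ∈ range M, H n ^ 2 ≤ 6 * B * (A : ℝ) ^ 4 := by
    refine (sum_sq_jacobi_le S B M hSm).trans ?_
    rw [hM]; push_cast
    have h1 : (1 : ℝ) ≤ (A : ℝ) ^ 4 := one_le_pow₀ hA1
    have h2 : (B : ℝ) ^ 3 ≤ (A : ℝ) ^ 4 :=
      (pow_le_pow_left₀ (by positivity) hBA 3).trans (pow_le_pow_right₀ hA1 (by norm_num))
    have h3 : (B : ℝ) ^ 4 ≤ B * (A : ℝ) ^ 4 := by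
      calc (B : ℝ) ^ 4 = B * (B : ℝ) ^ 3 := by ring
        _ ≤ _ := by gcongr
    nlinarith
  have hlog : 0 ≤ Real.log A := Real.log_nonneg hA1
  have hF4 : 0 ≤ ∑ b ∈ S, F b ^ 4 := Finset.sum_nonneg fun _ _ => by positivity
  calc R ^ 8 = (R ^ 2) ^ 4 := by ring
    _ ≤ (B * ∑ b ∈ S, F b ^ 2) ^ 4 := pow_le_pow_left₀ (sq_nonneg _) c1 4
    _ = (B : ℝ) ^ 4 * ((∑ b ∈ S, F b ^ 2) ^ 2) ^ 2 := by ring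
    _ ≤ (B : ℝ) ^ 4 * (B * ∑ b ∈ S, F b ^ 4) ^ 2 := by
        gcongr
    _ = (B : ℝ) ^ 6 * (∑ b ∈ S, F b ^ 4) ^ 2 := by ring
    _ ≤ (B : ℝ) ^ 6 * (((A : ℝ) ^ 4 * (1 + Real.log A) ^ 32) * (6 * B * (A : ℝ) ^ 4)) := by
        rw [c3]
        refine mul_le_mul_of_nonneg_left (c4.trans ?_) (by positivity)
        exact mul_le_mul c5 c6 (Finset.sum_nonneg fun _ _ => sq_nonneg _) (by positivity)
    _ = _ := by ring

theorem bilinear_rect_aux (α β : ℕ → ℝ) (hα : ∀ n, |α n| ≤ 1) (hβ : ∀ n, |β n| ≤ 1)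
    (hβs : ∀ n, β n ≠ 0 → Odd n ∧ Squarefree n) (w Y A B : ℕ) (hw : 1 ≤ w)
    (hBw : w ^ 16 ≤ B) (hAB : B ≤ A) (hY : A * B ≤ Y) :
    |∑ a ∈ Icc 1 A, ∑ b ∈ Icc 1 B, α a * β b * jacobiSym a b| ≤
      2 * Y * (1 + Real.log Y) ^ 4 / w ^ 2 := by
  have hB : 1 ≤ B := le_trans (Nat.one_le_pow _ _ hw) hBw
  have h := bilinear_box α β hα hβ hβs A B hB hAB
  set R := ∑ a ∈ Icc 1 A, ∑ b ∈ Icc 1 B, α a * β b * jacobiSym a b with hR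
  have hA1 : 1 ≤ A := hB.trans hAB
  have hAY : A ≤ Y := le_trans (Nat.le_mul_of_pos_right _ hB) hY
  have hA0 : (0 : ℝ) < A := by exact_mod_cast hA1
  have hlogA : 0 ≤ Real.log A := Real.log_natCast_nonneg A
  have hlog : Real.log A ≤ Real.log Y := Real.log_le_log hA0 (by exact_mod_cast hAY)
  have hw0 : (0 : ℝ) < w := by exact_mod_cast hw
  rw [le_div_iff₀ (by positivity)]
  have hYr : (A : ℝ) * B ≤ Y := by exact_mod_cast hY
  refine le_of_pow_le_pow_left₀ (n := 8) (by norm_num) (by positivity) ?_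
  rw [mul_pow, (show Even 8 by decide).pow_abs]
  calc R ^ 8 * ((w : ℝ) ^ 2) ^ 8 = R ^ 8 * (w : ℝ) ^ 16 := by ring
    _ ≤ R ^ 8 * B := by
        have : ((w : ℝ)) ^ 16 ≤ B := by exact_mod_cast hBw
        exact mul_le_mul_of_nonneg_left this ((show Even 8 by decide).pow_nonneg R)
    _ ≤ (6 * (A : ℝ) ^ 8 * (B : ℝ) ^ 7 * (1 + Real.log A) ^ 32) * B := by gcongr
    _ = 6 * ((A : ℝ) * B) ^ 8 * (1 + Real.log A) ^ 32 := by ring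
    _ ≤ 256 * (Y : ℝ) ^ 8 * (1 + Real.log Y) ^ 32 := by
        gcongr
        norm_num
    _ = _ := by ring

/-- The character mod 4 on odd numbers, as a sign. -/
def sgnFour (n : ℕ) : ℝ := if n % 4 = 1 then 1 else -1

theorem abs_sgnFour (n : ℕ) : |sgnFour n| = 1 := by
  unfold sgnFour; split_ifs <;> simp

theorem jacobiSym_swap {a b : ℕ} (ha : Odd a) (hb : Odd b) :
    (jacobiSym a b : ℝ) =
      (1 + sgnFour a + sgnFour b - sgnFour a * sgnFour b) / 2 * jacobiSym b a := by
  rw [jacobiSym.quadratic_reciprocity ha hb]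
  push_cast
  congr 1
  rw [Nat.odd_iff] at ha hb
  have ha' : a % 4 = 1 ∨ a % 4 = 3 := by omega
  have hb' : b % 4 = 1 ∨ b % 4 = 3 := by omega
  have key1 : ∀ c : ℕ, c % 4 = 1 → Even (c / 2) := fun c hc => by
    rw [Nat.even_iff]; omega
  have key3 : ∀ c : ℕ, c % 4 = 3 → Odd (c / 2) := fun c hc => by
    rw [Nat.odd_iff]; omega
  rcases ha' with h1 | h1
  · rw [((key1 a h1).mul_right _).neg_one_pow]; simp [sgnFour, h1]
  · rcases hb' with h2 | h2
    · rw [((key1 b h2).mul_left _).neg_one_pow]; simp [sgnFour, h1, h2]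
    · rw [((key3 a h1).mul (key3 b h2)).neg_one_pow]; simp [sgnFour, h1, h2]; norm_num

theorem bilinear_rect (α β : ℕ → ℝ) (hα : ∀ n, |α n| ≤ 1) (hβ : ∀ n, |β n| ≤ 1) (w : ℕ)
    (hw : 1 ≤ w) (hαs : ∀ n, α n ≠ 0 → Odd n ∧ Squarefree n ∧ w ^ 16 < n)
    (hβs : ∀ n, β n ≠ 0 → Odd n ∧ Squarefree n ∧ w ^ 16 < n) (Y A B : ℕ) (hY : A * B ≤ Y) :
    |∑ a ∈ Icc 1 A, ∑ b ∈ Icc 1 B, α a * β b * jacobiSym a b| ≤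
      4 * Y * (1 + Real.log Y) ^ 4 / w ^ 2 := by
  have hlogY : 0 ≤ Real.log Y := Real.log_natCast_nonneg Y
  by_cases hA : A ≤ w ^ 16
  · rw [Finset.sum_eq_zero, abs_zero]
    · positivity
    · intro a ha
      refine Finset.sum_eq_zero fun b _ => ?_
      have : α a = 0 := by
        by_contra h
        have := (hαs a h).2.2
        have := (mem_Icc.1 ha).2
        omega
      rw [this]; ring
  by_cases hB : B ≤ w ^ 16
  · rw [Finset.sum_eq_zero, abs_zero]
    · positivity
    · intro a ha
      refine Finset.sum_eq_zero fun b hb => ?_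
      have : β b = 0 := by
        by_contra h
        have := (hβs b h).2.2
        have := (mem_Icc.1 hb).2
        omega
      rw [this]; ring
  push Not at hA hB
  rcases le_total B A with h | h
  · refine (bilinear_rect_aux α β hα hβ (fun n hn => ⟨(hβs n hn).1, (hβs n hn).2.1⟩) w Y A B hw
      hB.le h hY).trans ?_
    gcongr
    norm_num
  · have hs : ∀ f : ℕ → ℝ, (∀ n, |f n| ≤ 1) → ∀ n, |sgnFour n * f n| ≤ 1 := by
      intro f hf n
      rw [abs_mul, abs_sgnFour, one_mul]; exact hf n
    have hsa : ∀ n, α n ≠ 0 → Odd n ∧ Squarefree n := fun n hn => ⟨(hαs n hn).1, (hαs n hn).2.1⟩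
    have hsa' : ∀ n, sgnFour n * α n ≠ 0 → Odd n ∧ Squarefree n :=
      fun n hn => hsa n (right_ne_zero_of_mul hn)
    have hY' : B * A ≤ Y := by rwa [mul_comm]
    have r1 := bilinear_rect_aux β α hβ hα hsa w Y B A hw hA.le h hY'
    have r2 := bilinear_rect_aux β (fun n => sgnFour n * α n) hβ (hs α hα) hsa' w Y B A hw
      hA.le h hY'
    have r3 := bilinear_rect_aux (fun n => sgnFour n * β n) α (hs β hβ) hα hsa w Y B A hw
      hA.le h hY'
    have r4 := bilinear_rect_aux (fun n => sgnFour n * β n) (fun n => sgnFour n * α n) (hs β hβ)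
      (hs α hα) hsa' w Y B A hw hA.le h hY'
    have e : ∑ a ∈ Icc 1 A, ∑ b ∈ Icc 1 B, α a * β b * jacobiSym a b =
        (1 / 2) * ∑ b ∈ Icc 1 B, ∑ a ∈ Icc 1 A, β b * α a * jacobiSym b a +
        (1 / 2) * ∑ b ∈ Icc 1 B, ∑ a ∈ Icc 1 A, β b * (sgnFour a * α a) * jacobiSym b a +
        (1 / 2) * ∑ b ∈ Icc 1 B, ∑ a ∈ Icc 1 A, (sgnFour b * β b) * α a * jacobiSym b a -
        (1 / 2) * ∑ b ∈ Icc 1 B, ∑ a ∈ Icc 1 A,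
          (sgnFour b * β b) * (sgnFour a * α a) * jacobiSym b a := by
      rw [Finset.sum_comm]
      simp only [Finset.mul_sum, ← Finset.sum_add_distrib, ← Finset.sum_sub_distrib]
      refine Finset.sum_congr rfl fun b _ => Finset.sum_congr rfl fun a _ => ?_
      by_cases h0 : α a * β b = 0
      · have : α a = 0 ∨ β b = 0 := mul_eq_zero.1 h0
        rcases this with h | h <;> simp [h]
      · rw [jacobiSym_swap (hαs a (left_ne_zero_of_mul h0)).1 (hβs b (right_ne_zero_of_mul h0)).1]
        ring
    rw [e]
    set K := 2 * (Y : ℝ) * (1 + Real.log Y) ^ 4 / w ^ 2 with hK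
    have hK2 : 4 * (Y : ℝ) * (1 + Real.log Y) ^ 4 / w ^ 2 = 2 * K := by rw [hK]; ring
    rw [hK2]
    rw [abs_le] at *
    constructor <;> linarith [r1.1, r1.2, r2.1, r2.2, r3.1, r3.2, r4.1, r4.2]

theorem card_between_le (Y : ℕ) (u v : ℝ) (hu : 0 ≤ u) (huv : u ≤ v) :
    (((Icc 1 Y).filter fun b : ℕ => u < b ∧ (b : ℝ) ≤ v).card : ℝ) ≤ v - u + 1 := by
  have hsub : ((Icc 1 Y).filter fun b : ℕ => u < b ∧ (b : ℝ) ≤ v) ⊆ Ioc ⌊u⌋₊ ⌊v⌋₊ := by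
    intro b hb
    simp only [mem_filter, mem_Icc, mem_Ioc] at hb ⊢
    exact ⟨(Nat.floor_lt hu).2 hb.2.1, Nat.le_floor hb.2.2⟩
  have h1 := card_le_card hsub
  rw [Nat.card_Ioc] at h1
  have h2 : ⌊u⌋₊ ≤ ⌊v⌋₊ := Nat.floor_mono huv
  have h3 : (((Icc 1 Y).filter fun b : ℕ => u < b ∧ (b : ℝ) ≤ v).card : ℝ) ≤
      (⌊v⌋₊ : ℝ) - ⌊u⌋₊ := by
    rw [← Nat.cast_sub h2]; exact_mod_cast h1
  have h4 := Nat.floor_le (hu.trans huv)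
  have h5 := Nat.lt_floor_add_one u
  linarith

/-- The bilinear estimate over a hyperbolic region. -/
theorem bilinear_hyperbola (α β : ℕ → ℝ) (hα : ∀ n, |α n| ≤ 1) (hβ : ∀ n, |β n| ≤ 1) (w : ℕ)
    (hw : 1 ≤ w) (hαs : ∀ n, α n ≠ 0 → Odd n ∧ Squarefree n ∧ w ^ 16 < n)
    (hβs : ∀ n, β n ≠ 0 → Odd n ∧ Squarefree n ∧ w ^ 16 < n) (Y : ℕ) :
    |∑ a ∈ Icc 1 Y, ∑ b ∈ (Icc 1 Y).filter (fun b => a * b ≤ Y), α a * β b * jacobiSym a b| ≤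
      6 * Y * (1 + Real.log Y) ^ 5 / w := by
  rcases Nat.eq_zero_or_pos Y with rfl | hYpos
  · simp
  have hw0 : (0 : ℝ) < w := by exact_mod_cast hw
  have hw1 : (1 : ℝ) ≤ w := by exact_mod_cast hw
  have hY0 : (0 : ℝ) < Y := by exact_mod_cast hYpos
  have hlogY : 0 ≤ Real.log Y := Real.log_natCast_nonneg Y
  set L := 1 + Real.log Y with hL
  have hL1 : 1 ≤ L := by linarith
  set cl : ℕ → ℕ := fun a => ⌊(w : ℝ) * Real.log a⌋₊ with hcl
  set m := ⌊(w : ℝ) * Real.log Y⌋₊ with hm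
  set E : ℕ → ℝ := fun i => Real.exp (((i : ℝ) + 1) / w) with hE
  have hE0 : ∀ i, 0 < E i := fun i => Real.exp_pos _
  set A : ℕ → ℕ := fun i => ⌊E i⌋₊ with hA
  set B : ℕ → ℕ := fun i => ⌊(Y : ℝ) / E i⌋₊ with hB
  set K : ℕ → ℕ → ℝ := fun a b => α a * β b * jacobiSym a b with hK
  have hKle : ∀ a b, |K a b| ≤ 1 := by
    intro a b
    simp only [hK, abs_mul]
    have h3 : |(jacobiSym a b : ℝ)| ≤ 1 := by exact_mod_cast abs_jacobiSym_le a b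
    exact mul_le_one₀ (mul_le_one₀ (hα a) (abs_nonneg _) (hβ b)) (abs_nonneg _) h3
  have hAB : ∀ i, A i * B i ≤ Y := by
    intro i
    have h1 : (A i : ℝ) ≤ E i := Nat.floor_le (hE0 i).le
    have h2 : (B i : ℝ) ≤ Y / E i := Nat.floor_le (by have := hE0 i; positivity)
    have h3 : (A i : ℝ) * B i ≤ E i * (Y / E i) := by
      have := hE0 i
      gcongr
    rw [mul_div_cancel₀ _ (hE0 i).ne'] at h3
    exact_mod_cast h3
  have haE : ∀ a : ℕ, 1 ≤ a → (a : ℝ) < E (cl a) := by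
    intro a ha
    have ha0 : (0 : ℝ) < a := by exact_mod_cast ha
    have h1 : (w : ℝ) * Real.log a < cl a + 1 := Nat.lt_floor_add_one _
    rw [← Real.exp_log ha0]
    simp only [hE]
    refine Real.exp_lt_exp.2 ?_
    rw [lt_div_iff₀ hw0]; linarith
  have hEa : ∀ a : ℕ, 1 ≤ a → E (cl a) ≤ a * Real.exp (1 / w) := by
    intro a ha
    have ha0 : (0 : ℝ) < a := by exact_mod_cast ha
    have h1 : (cl a : ℝ) ≤ w * Real.log a :=
      Nat.floor_le (mul_nonneg hw0.le (Real.log_natCast_nonneg a))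
    conv_rhs => rw [← Real.exp_log ha0]
    rw [← Real.exp_add]
    simp only [hE]
    refine Real.exp_le_exp.2 ?_
    rw [add_div]
    gcongr
    rw [div_le_iff₀ hw0]; linarith
  -- decomposition
  have hinner : ∀ a ∈ Icc 1 Y, ∑ b ∈ (Icc 1 Y).filter (fun b => a * b ≤ Y), K a b =
      ∑ b ∈ Icc 1 (B (cl a)), K a b +
        ∑ b ∈ (Icc 1 Y).filter (fun b => a * b ≤ Y ∧ B (cl a) < b), K a b := by
    intro a ha
    obtain ⟨ha1, haY⟩ := mem_Icc.1 ha
    rw [← Finset.sum_filter_add_sum_filter_not _ (fun b => b ≤ B (cl a)), Finset.filter_filter,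
      Finset.filter_filter]
    congr 1
    · refine Finset.sum_congr ?_ fun _ _ => rfl
      ext b
      simp only [mem_filter, mem_Icc]
      constructor
      · rintro ⟨⟨h1, h2⟩, h3, h4⟩; exact ⟨h1, h4⟩
      · rintro ⟨h1, h2⟩
        have h3 : a * b ≤ Y := by
          have h4 : (b : ℝ) ≤ Y / E (cl a) :=
            le_trans (by exact_mod_cast h2) (Nat.floor_le (by have := hE0 (cl a); positivity))
          have h5 : (a : ℝ) * b ≤ E (cl a) * (Y / E (cl a)) :=
            mul_le_mul (haE a ha1).le h4 (by positivity) (hE0 _).le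
          rw [mul_div_cancel₀ _ (hE0 _).ne'] at h5
          exact_mod_cast h5
        exact ⟨⟨h1, le_trans (Nat.le_mul_of_pos_left _ ha1) h3⟩, h3, h2⟩
    · refine Finset.sum_congr ?_ fun _ _ => rfl
      ext b
      simp only [mem_filter, mem_Icc, not_le]
  rw [Finset.sum_congr rfl hinner, Finset.sum_add_distrib]
  have hmaps : ∀ a ∈ Icc 1 Y, cl a ∈ range (m + 1) := by
    intro a ha
    obtain ⟨ha1, haY⟩ := mem_Icc.1 ha
    rw [mem_range, Nat.lt_succ_iff]
    refine Nat.floor_mono (mul_le_mul_of_nonneg_left ?_ hw0.le)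
    exact Real.log_le_log (by exact_mod_cast ha1) (by exact_mod_cast haY)
  have hfirst : |∑ a ∈ Icc 1 Y, ∑ b ∈ Icc 1 (B (cl a)), K a b| ≤ 4 * Y * L ^ 5 / w := by
    rw [← Finset.sum_fiberwise_of_maps_to hmaps]
    refine (Finset.abs_sum_le_sum_abs _ _).trans ?_
    have hi : ∀ i ∈ range (m + 1), |∑ a ∈ Icc 1 Y with cl a = i, ∑ b ∈ Icc 1 (B (cl a)), K a b| ≤
        4 * Y * L ^ 4 / w ^ 2 := by
      intro i _
      have heq : ∑ a ∈ Icc 1 Y with cl a = i, ∑ b ∈ Icc 1 (B (cl a)), K a b =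
          ∑ a ∈ Icc 1 (A i), ∑ b ∈ Icc 1 (B i),
            (if cl a = i ∧ a ≤ Y then α a else 0) * β b * jacobiSym a b := by
        have h1 : ∑ a ∈ Icc 1 (A i), ∑ b ∈ Icc 1 (B i),
            (if cl a = i ∧ a ≤ Y then α a else 0) * β b * jacobiSym a b =
            ∑ a ∈ (Icc 1 (A i)).filter (fun a => cl a = i ∧ a ≤ Y), ∑ b ∈ Icc 1 (B i), K a b := by
          rw [Finset.sum_filter]
          refine Finset.sum_congr rfl fun a _ => ?_
          split_ifs
          · rfl
          · simp
        rw [h1]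
        refine Finset.sum_congr ?_ ?_
        · ext a
          simp only [mem_filter, mem_Icc]
          constructor
          · rintro ⟨⟨g1, g2⟩, rfl⟩
            exact ⟨⟨g1, Nat.le_floor (haE a g1).le⟩, rfl, g2⟩
          · rintro ⟨⟨g1, g2⟩, rfl, g3⟩
            exact ⟨⟨g1, g3⟩, rfl⟩
        · intro a ha
          rw [(mem_filter.1 ha).2.1]
      rw [heq]
      refine bilinear_rect (fun a => if cl a = i ∧ a ≤ Y then α a else 0) β ?_ hβ w hw ?_ hβs Y
        (A i) (B i) (hAB i)
      · intro n; split_ifs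
        · exact hα n
        · simp
      · intro n hn
        split_ifs at hn with hc
        · exact hαs n hn
        · exact absurd rfl hn
    refine (Finset.sum_le_sum hi).trans ?_
    rw [Finset.sum_const, card_range, nsmul_eq_mul]
    have hm1 : ((m + 1 : ℕ) : ℝ) ≤ w * L := by
      push_cast
      have : (m : ℝ) ≤ w * Real.log Y := Nat.floor_le (by positivity)
      rw [hL]; nlinarith
    calc ((m + 1 : ℕ) : ℝ) * (4 * Y * L ^ 4 / w ^ 2) ≤ (w * L) * (4 * Y * L ^ 4 / w ^ 2) := by
          gcongr
      _ = _ := by field_simp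
  have hsecond : |∑ a ∈ Icc 1 Y, ∑ b ∈ (Icc 1 Y).filter (fun b => a * b ≤ Y ∧ B (cl a) < b), K a b|
      ≤ 2 * Y * L / w := by
    refine (Finset.abs_sum_le_sum_abs _ _).trans ?_
    have hz : (1 : ℝ) ≤ (w : ℝ) ^ 16 := one_le_pow₀ hw1
    have ha : ∀ a ∈ Icc 1 Y,
        |∑ b ∈ (Icc 1 Y).filter (fun b => a * b ≤ Y ∧ B (cl a) < b), K a b| ≤
        Y / w * (1 / a) + if (a : ℝ) ≤ Y / w ^ 16 then 1 else 0 := by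
      intro a ha
      obtain ⟨ha1, haY⟩ := mem_Icc.1 ha
      have ha0 : (0 : ℝ) < a := by exact_mod_cast ha1
      split_ifs with hc
      · refine (Finset.abs_sum_le_sum_abs _ _).trans ?_
        refine (Finset.sum_le_sum fun b _ => hKle a b).trans ?_
        rw [Finset.sum_const, nsmul_eq_mul, mul_one]
        set u := (Y : ℝ) / a * Real.exp (-(1 / w)) with hu
        have huv : u ≤ (Y : ℝ) / a := by
          refine mul_le_of_le_one_right (by positivity) (Real.exp_le_one_iff.2 ?_)
          have : 0 < 1 / (w : ℝ) := by positivity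
          linarith
        have hsub : (Icc 1 Y).filter (fun b => a * b ≤ Y ∧ B (cl a) < b) ⊆
            (Icc 1 Y).filter fun b : ℕ => u < b ∧ (b : ℝ) ≤ (Y : ℝ) / a := by
          intro b hb
          simp only [mem_filter] at hb ⊢
          refine ⟨hb.1, ?_, ?_⟩
          · refine lt_of_le_of_lt ?_ (Nat.lt_of_floor_lt hb.2.2)
            rw [le_div_iff₀ (hE0 _)]
            calc u * E (cl a) ≤ u * (a * Real.exp (1 / w)) := by
                  have : 0 ≤ u := by positivity
                  have := hEa a ha1
                  gcongr
              _ = Y * (Real.exp (-(1 / w)) * Real.exp (1 / w)) := by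
                  rw [hu]; field_simp
              _ = Y := by rw [← Real.exp_add]; simp
          · rw [le_div_iff₀ ha0, mul_comm]; exact_mod_cast hb.2.1
        refine (Nat.cast_le.2 (card_le_card hsub)).trans ?_
        refine (card_between_le Y u _ (by positivity) huv).trans ?_
        have hexp : 1 - 1 / (w : ℝ) ≤ Real.exp (-(1 / w)) := by
          have := Real.add_one_le_exp (-(1 / (w : ℝ))); linarith
        have : (Y : ℝ) / a - u ≤ Y / w * (1 / a) := by
          calc (Y : ℝ) / a - u = Y / a * (1 - Real.exp (-(1 / w))) := by rw [hu]; ring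
            _ ≤ Y / a * (1 / w) := by
                refine mul_le_mul_of_nonneg_left (by linarith) (by positivity)
            _ = _ := by ring
        linarith
      · rw [Finset.sum_eq_zero, abs_zero]
        · positivity
        · intro b hb
          simp only [mem_filter] at hb
          have : β b = 0 := by
            by_contra h0
            have h1 := (hβs b h0).2.2
            apply hc
            rw [le_div_iff₀ (by positivity)]
            have h2 : a * w ^ 16 ≤ Y := le_trans (Nat.mul_le_mul_left _ h1.le) hb.2.1
            exact_mod_cast h2
          simp [hK, this]
    refine (Finset.sum_le_sum ha).trans ?_
    rw [Finset.sum_add_distrib, ← Finset.mul_sum]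
    have h1 : (Y : ℝ) / w * ∑ a ∈ Icc 1 Y, (1 : ℝ) / a ≤ Y / w * L :=
      mul_le_mul_of_nonneg_left (sum_one_div_le Y) (by positivity)
    have h2 : ∑ a ∈ Icc 1 Y, (if (a : ℝ) ≤ Y / w ^ 16 then (1 : ℝ) else 0) ≤ Y / w * L := by
      rw [← Finset.sum_filter, Finset.sum_const, nsmul_eq_mul, mul_one]
      have hsub : (Icc 1 Y).filter (fun a : ℕ => (a : ℝ) ≤ Y / w ^ 16) ⊆
          Icc 1 ⌊(Y : ℝ) / w ^ 16⌋₊ := by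
        intro a ha
        simp only [mem_filter, mem_Icc] at ha ⊢
        exact ⟨ha.1.1, Nat.le_floor ha.2⟩
      have h3 := card_le_card hsub
      rw [Nat.card_Icc, Nat.add_sub_cancel] at h3
      have h4 : (((Icc 1 Y).filter (fun a : ℕ => (a : ℝ) ≤ Y / w ^ 16)).card : ℝ) ≤ Y / w ^ 16 :=
        le_trans (by exact_mod_cast h3) (Nat.floor_le (by positivity))
      refine h4.trans ?_
      calc (Y : ℝ) / w ^ 16 ≤ Y / w := by
            gcongr
            exact le_self_pow₀ hw1 (by norm_num)
        _ ≤ Y / w * L := le_mul_of_one_le_right (by positivity) hL1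
    calc _ ≤ (Y : ℝ) / w * L + Y / w * L := add_le_add h1 h2
      _ = _ := by ring
  refine (abs_add_le _ _).trans ((add_le_add hfirst hsecond).trans ?_)
  have h5 : L ≤ L ^ 5 := le_self_pow₀ hL1 (by norm_num)
  have h6 : 2 * (Y : ℝ) * L / w ≤ 2 * Y * L ^ 5 / w := by gcongr
  calc _ ≤ 4 * (Y : ℝ) * L ^ 5 / w + 2 * Y * L ^ 5 / w := add_le_add le_rfl h6
    _ = _ := by ring

section Tuples

variable {J : Type*} [Fintype J] [DecidableEq J]

/-- The factorization of a squarefree number attached to a colouring of its prime factors. -/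
def tupleOf {n : ℕ} (f : n.primeFactors → J) (j : J) : ℕ :=
  ∏ p, if f p = j then (p : ℕ) else 1

variable (J) in
/-- Factorizations of `n` indexed by `J`. -/
def factTuples (n : ℕ) : Finset (J → ℕ) :=
  (Fintype.piFinset fun _ => n.divisors).filter fun D => ∏ j, D j = n

theorem mem_factTuples {n : ℕ} (hn : n ≠ 0) {D : J → ℕ} :
    D ∈ factTuples J n ↔ ∏ j, D j = n := by
  simp only [factTuples, mem_filter, Fintype.mem_piFinset, Nat.mem_divisors, and_iff_right_iff_imp]
  rintro rfl j
  exact ⟨dvd_prod_of_mem D (mem_univ j), hn⟩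

theorem prod_tupleOf {n : ℕ} (hn : Squarefree n) (f : n.primeFactors → J) :
    ∏ j, tupleOf f j = n := by
  unfold tupleOf
  rw [Finset.prod_comm]
  simp only [prod_ite_eq, mem_univ, if_true]
  rw [prod_coe_sort n.primeFactors (fun p => p)]
  exact Nat.prod_primeFactors_of_squarefree hn

theorem coprime_of_prod_squarefree {D : J → ℕ} (h : Squarefree (∏ j, D j)) {i j : J}
    (hij : i ≠ j) : (D i).Coprime (D j) := by
  have h1 : D i * D j ∣ ∏ j, D j := by
    rw [← mul_prod_erase univ D (mem_univ i),
      ← mul_prod_erase (univ.erase i) D (mem_erase.2 ⟨hij.symm, mem_univ j⟩), ← mul_assoc]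
    exact dvd_mul_right _ _
  exact Nat.coprime_of_squarefree_mul (h.squarefree_of_dvd h1)

theorem squarefree_of_prod_squarefree {D : J → ℕ} (h : Squarefree (∏ j, D j)) (i : J) :
    Squarefree (D i) := h.squarefree_of_dvd (dvd_prod_of_mem D (mem_univ i))

theorem dvd_tupleOf_iff {n : ℕ} (f : n.primeFactors → J) (j : J) (p : n.primeFactors) :
    (p : ℕ) ∣ tupleOf f j ↔ f p = j := by
  have hp : (p : ℕ).Prime := Nat.prime_of_mem_primeFactors p.2
  unfold tupleOf
  rw [hp.prime.dvd_finsetProd_iff]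
  constructor
  · rintro ⟨q, -, hq⟩
    split_ifs at hq with h
    · have := (Nat.prime_dvd_prime_iff_eq hp (Nat.prime_of_mem_primeFactors q.2)).1 hq
      rwa [Subtype.ext this]
    · exact absurd (Nat.dvd_one.1 hq) hp.one_lt.ne'
  · intro h
    exact ⟨p, mem_univ _, by simp [h]⟩

theorem tupleOf_surj {n : ℕ} (hn : Squarefree n) {D : J → ℕ} (hD : ∏ j, D j = n) :
    ∃ f : n.primeFactors → J, tupleOf f = D := by
  have h1 : ∀ p : n.primeFactors, ∃ j, (p : ℕ) ∣ D j := by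
    intro p
    have hp : (p : ℕ).Prime := Nat.prime_of_mem_primeFactors p.2
    have : (p : ℕ) ∣ ∏ j, D j := (Nat.dvd_of_mem_primeFactors p.2).trans hD.symm.dvd
    rw [hp.prime.dvd_finsetProd_iff] at this
    obtain ⟨j, -, hj⟩ := this
    exact ⟨j, hj⟩
  choose f hf using h1
  refine ⟨f, ?_⟩
  have hsq : Squarefree (∏ j, D j) := hD ▸ hn
  have hsq' : Squarefree (∏ j, tupleOf f j) := (prod_tupleOf hn f).symm ▸ hn
  ext j
  rw [← Nat.prod_primeFactors_of_squarefree (squarefree_of_prod_squarefree hsq j),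
    ← Nat.prod_primeFactors_of_squarefree (squarefree_of_prod_squarefree hsq' j)]
  congr 1
  ext p
  simp only [Nat.mem_primeFactors]
  have hne : D j ≠ 0 := (squarefree_of_prod_squarefree hsq j).ne_zero
  have hne' : tupleOf f j ≠ 0 := (squarefree_of_prod_squarefree hsq' j).ne_zero
  constructor
  · rintro ⟨hp, hd, -⟩
    have hpn : p ∈ n.primeFactors := by
      rw [Nat.mem_primeFactors]
      refine ⟨hp, hd.trans ?_, hn.ne_zero⟩
      conv_rhs => rw [← prod_tupleOf hn f]
      exact dvd_prod_of_mem _ (mem_univ j)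
    have := (dvd_tupleOf_iff f j ⟨p, hpn⟩).1 hd
    exact ⟨hp, this ▸ hf ⟨p, hpn⟩, hne⟩
  · rintro ⟨hp, hd, -⟩
    have hpn : p ∈ n.primeFactors := by
      rw [Nat.mem_primeFactors]
      refine ⟨hp, hd.trans ?_, hn.ne_zero⟩
      conv_rhs => rw [← hD]
      exact dvd_prod_of_mem _ (mem_univ j)
    refine ⟨hp, (dvd_tupleOf_iff f j ⟨p, hpn⟩).2 ?_, hne'⟩
    by_contra hne2
    have hc := coprime_of_prod_squarefree hsq hne2
    exact Nat.not_coprime_of_dvd_of_dvd hp.one_lt (hf ⟨p, hpn⟩) hd hc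

theorem tupleOf_injective {n : ℕ} :
    Function.Injective (tupleOf : (n.primeFactors → J) → J → ℕ) := by
  intro f g h
  ext p
  have := (dvd_tupleOf_iff f (f p) p).2 rfl
  rw [h, dvd_tupleOf_iff] at this
  exact this.symm

theorem sum_factTuples {n : ℕ} (hn : Squarefree n) (G : (J → ℕ) → ℝ) :
    ∑ D ∈ factTuples J n, G D = ∑ f : n.primeFactors → J, G (tupleOf f) := by
  symm
  refine sum_bij (fun f _ => tupleOf f) ?_ ?_ ?_ ?_
  · intro f _
    exact (mem_factTuples hn.ne_zero).2 (prod_tupleOf hn f)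
  · intro f _ g _ h
    exact tupleOf_injective h
  · intro D hD
    obtain ⟨f, hf⟩ := tupleOf_surj hn ((mem_factTuples hn.ne_zero).1 hD)
    exact ⟨f, mem_univ _, hf⟩
  · intro f _
    rfl

theorem primeFactors_tupleOf {n : ℕ} (hn : Squarefree n) (f : n.primeFactors → J) (j : J) :
    (tupleOf f j).primeFactors = (univ.filter fun p => f p = j).image Subtype.val := by
  have hdvd : tupleOf f j ∣ n := by
    conv_rhs => rw [← prod_tupleOf hn f]
    exact dvd_prod_of_mem _ (mem_univ j)
  ext p
  simp only [mem_image, mem_filter, mem_univ, true_and]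
  constructor
  · intro hp
    have hpn := Nat.primeFactors_mono hdvd hn.ne_zero hp
    exact ⟨⟨p, hpn⟩, (dvd_tupleOf_iff f j ⟨p, hpn⟩).1 (Nat.dvd_of_mem_primeFactors hp), rfl⟩
  · rintro ⟨p, hp, rfl⟩
    exact Nat.mem_primeFactors.2 ⟨Nat.prime_of_mem_primeFactors p.2,
      (dvd_tupleOf_iff f j p).2 hp, ne_zero_of_dvd_ne_zero hn.ne_zero hdvd⟩

theorem prod_primeFactors_tupleOf {n : ℕ} (hn : Squarefree n) (f : n.primeFactors → J)
    (h : J → ℕ → ℝ) :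
    ∏ j, ∏ p ∈ (tupleOf f j).primeFactors, h j p = ∏ p : n.primeFactors, h (f p) p := by
  rw [← prod_fiberwise univ f]
  refine prod_congr rfl fun j _ => ?_
  rw [primeFactors_tupleOf hn, prod_image (fun a _ b _ h => Subtype.ext h)]
  refine prod_congr rfl fun p hp => ?_
  rw [(mem_filter.1 hp).2]

theorem sum_factTuples_prod {n : ℕ} (hn : Squarefree n) (h : J → ℕ → ℝ) :
    ∑ D ∈ factTuples J n, ∏ j, ∏ p ∈ (D j).primeFactors, h j p =
      ∏ p ∈ n.primeFactors, ∑ j, h j p := by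
  rw [sum_factTuples hn, ← prod_coe_sort, Fintype.prod_sum]
  exact sum_congr rfl fun f _ => prod_primeFactors_tupleOf hn f h

/-- Sum over factorizations bounded through the product. -/
theorem sum_prod_le_sum_squarefree (h : J → ℕ → ℝ) (h0 : ∀ j p, 0 ≤ h j p) (y : ℕ)
    (S : Finset (J → ℕ)) (hS : ∀ D ∈ S, Squarefree (∏ j, D j) ∧ ∏ j, D j ≤ y) :
    ∑ D ∈ S, ∏ j, ∏ p ∈ (D j).primeFactors, h j p ≤
      ∑ n ∈ (Icc 1 y).filter Squarefree, ∏ p ∈ n.primeFactors, ∑ j, h j p := by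
  have hmap : ∀ D ∈ S, ∏ j, D j ∈ (Icc 1 y).filter Squarefree := by
    intro D hD
    obtain ⟨h1, h2⟩ := hS D hD
    exact mem_filter.2 ⟨mem_Icc.2 ⟨Nat.pos_of_ne_zero h1.ne_zero, h2⟩, h1⟩
  rw [← sum_fiberwise_of_maps_to hmap]
  refine sum_le_sum fun n hn => ?_
  have hsq := (mem_filter.1 hn).2
  rw [← sum_factTuples_prod hsq]
  refine sum_le_sum_of_subset_of_nonneg ?_ ?_
  · intro D hD
    exact (mem_factTuples hsq.ne_zero).2 (mem_filter.1 hD).2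
  · intro D _ _
    exact prod_nonneg fun j _ => prod_nonneg fun p _ => h0 j p

/-- The product of Jacobi symbols attached to a tuple. -/
def symb (φ : J → J → ℕ) (D : J → ℕ) : ℝ := ∏ u, ∏ v, (jacobiSym (D v) (D u) : ℝ) ^ φ u v

theorem jacobiSym_prod_left {ι : Type*} (s : Finset ι) (a : ι → ℕ) (b : ℕ) :
    jacobiSym ((∏ i ∈ s, a i : ℕ) : ℤ) b = ∏ i ∈ s, jacobiSym (a i) b := by
  classical
  induction s using Finset.induction_on with
  | empty => simp
  | insert i s hi ih => rw [prod_insert hi, prod_insert hi, Nat.cast_mul, jacobiSym.mul_left, ih]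

theorem jacobiSym_prod_right {ι : Type*} (s : Finset ι) (a : ℤ) (b : ι → ℕ)
    (hb : ∀ i ∈ s, b i ≠ 0) :
    jacobiSym a (∏ i ∈ s, b i) = ∏ i ∈ s, jacobiSym a (b i) := by
  classical
  induction s using Finset.induction_on with
  | empty => simp
  | insert i s hi ih =>
    rw [prod_insert hi, prod_insert hi, jacobiSym.mul_right' a (hb i (mem_insert_self _ _)),
      ih fun j hj => hb j (mem_insert_of_mem hj)]
    exact prod_ne_zero_iff.2 fun j hj => hb j (mem_insert_of_mem hj)

theorem symb_tupleOf {n : ℕ} (φ : J → J → ℕ) (f : n.primeFactors → J) :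
    symb φ (tupleOf f) =
      ∏ q : n.primeFactors, ∏ p : n.primeFactors, (jacobiSym p q : ℝ) ^ φ (f q) (f p) := by
  have h1 : ∀ u v : J, (jacobiSym (tupleOf f v) (tupleOf f u) : ℝ) ^ φ u v =
      ∏ q with f q = u, ∏ p with f p = v, (jacobiSym p q : ℝ) ^ φ (f q) (f p) := by
    intro u v
    unfold tupleOf
    rw [← prod_filter, ← prod_filter, jacobiSym_prod_left]
    have h2 : ∀ p : n.primeFactors, jacobiSym (p : ℕ) (∏ q with f q = u, (q : ℕ)) =
        ∏ q with f q = u, jacobiSym (p : ℕ) q := fun p =>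
      jacobiSym_prod_right _ _ _ fun q _ => (Nat.prime_of_mem_primeFactors q.2).ne_zero
    simp only [h2]
    push_cast
    rw [Finset.prod_comm, ← prod_pow]
    refine prod_congr rfl fun q hq => ?_
    rw [← prod_pow]
    refine prod_congr rfl fun p hp => ?_
    rw [(mem_filter.1 hq).2, (mem_filter.1 hp).2]
  unfold symb
  simp only [h1]
  rw [← prod_fiberwise univ f]
  refine prod_congr rfl fun u _ => ?_
  rw [Finset.prod_comm]
  refine prod_congr rfl fun q _ => ?_
  exact prod_fiberwise univ f _

theorem abs_symb_le (φ : J → J → ℕ) (D : J → ℕ) : |symb φ D| ≤ 1 := by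
  unfold symb
  rw [abs_prod]
  refine prod_le_one (fun _ _ => abs_nonneg _) fun u _ => ?_
  rw [abs_prod]
  refine prod_le_one (fun _ _ => abs_nonneg _) fun v _ => ?_
  rw [abs_pow]
  exact pow_le_one₀ (abs_nonneg _) (by exact_mod_cast abs_jacobiSym_le _ _)

/-- Reciprocity sign as a function of residues modulo four. -/
def reciprocitySign (θ : J → J → ℕ) (m : J → ℕ) : ℝ :=
  ∏ u, ∏ v, if Fintype.equivFin J u < Fintype.equivFin J v then
    (if m u = 3 ∧ m v = 3 then (-1 : ℝ) else 1) ^ θ u v else 1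

theorem abs_reciprocitySign (θ : J → J → ℕ) (m : J → ℕ) : |reciprocitySign θ m| = 1 := by
  unfold reciprocitySign
  rw [abs_prod]
  refine prod_eq_one fun u _ => ?_
  rw [abs_prod]
  refine prod_eq_one fun v _ => ?_
  split_ifs <;> simp

theorem jacobiSym_sq_eq_one_real {a b : ℕ} (h : a.Coprime b) : ((jacobiSym a b : ℤ) : ℝ) ^ 2 = 1 := by
  have : (a : ℤ).gcd b = 1 := by simpa using h
  exact_mod_cast jacobiSym.sq_one this

theorem symb_mul_symb_eq (φ ψ : J → J → ℕ) (hd : ∀ u, φ u u = 0 ∧ ψ u u = 0)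
    (hpar : ∀ u v, Even (φ u v + φ v u + (ψ u v + ψ v u))) (D : J → ℕ) (hodd : ∀ u, Odd (D u))
    (hcop : ∀ u v, u ≠ v → (D u).Coprime (D v)) :
    symb φ D * symb ψ D = reciprocitySign (fun u v => φ u v + ψ u v) (fun u => D u % 4) := by
  set e := Fintype.equivFin J
  set g : J → J → ℝ := fun u v => (jacobiSym (D v) (D u) : ℝ) ^ (φ u v + ψ u v) with hg
  have h1 : symb φ D * symb ψ D = ∏ u, ∏ v, g u v := by
    unfold symb
    rw [← prod_mul_distrib]
    refine prod_congr rfl fun u _ => ?_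
    rw [← prod_mul_distrib]
    refine prod_congr rfl fun v _ => ?_
    simp only [hg, pow_add]
  have h2 : ∀ u v, g u v = (if e u < e v then g u v else 1) * (if e v < e u then g u v else 1) := by
    intro u v
    rcases lt_trichotomy (e u) (e v) with h | h | h
    · simp [h, h.not_gt]
    · have : u = v := e.injective h
      subst this
      simp [hg, hd]
    · simp [h, h.not_gt]
  have h3 : ∏ u, ∏ v, g u v = ∏ u, ∏ v, (if e u < e v then g u v * g v u else 1) := by
    calc ∏ u, ∏ v, g u v = (∏ u, ∏ v, (if e u < e v then g u v else 1)) *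
        ∏ u, ∏ v, (if e v < e u then g u v else 1) := by
          rw [← prod_mul_distrib]
          refine prod_congr rfl fun u _ => ?_
          rw [← prod_mul_distrib]
          exact prod_congr rfl fun v _ => h2 u v
      _ = (∏ u, ∏ v, (if e u < e v then g u v else 1)) *
        ∏ u, ∏ v, (if e u < e v then g v u else 1) := by
          congr 1
          exact Finset.prod_comm
      _ = _ := by
          rw [← prod_mul_distrib]
          refine prod_congr rfl fun u _ => ?_
          rw [← prod_mul_distrib]
          refine prod_congr rfl fun v _ => ?_
          split_ifs <;> simp
  rw [h1, h3]
  unfold reciprocitySign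
  refine prod_congr rfl fun u _ => prod_congr rfl fun v _ => ?_
  show (if e u < e v then g u v * g v u else 1) = if e u < e v then _ else 1
  split_ifs with h hm
  all_goals try rfl
  all_goals
    have huv : u ≠ v := by rintro rfl; exact lt_irrefl _ h
    have hs := jacobiSym_sq_eq_one_real (hcop u v huv)
    have hE : ((jacobiSym (D u) (D v) : ℤ) : ℝ) ^ (φ u v + ψ u v + (φ v u + ψ v u)) = 1 := by
      obtain ⟨r, hr⟩ := hpar u v
      have : φ u v + ψ u v + (φ v u + ψ v u) = 2 * r := by omega
      rw [this, pow_mul, hs, one_pow]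
  · have := jacobiSym.quadratic_reciprocity_three_mod_four hm.2 hm.1
    simp only [hg]
    rw [this]
    push_cast
    rw [neg_pow, mul_assoc, ← pow_add, hE, mul_one]
  · have h4 : D v % 4 = 1 ∨ D u % 4 = 1 := by
      simp only at hm
      have := Nat.odd_iff.1 (hodd u)
      have := Nat.odd_iff.1 (hodd v)
      omega
    have : jacobiSym (D v) (D u) = jacobiSym (D u) (D v) := by
      rcases h4 with h4 | h4
      · exact jacobiSym.quadratic_reciprocity_one_mod_four h4 (hodd u)
      · exact (jacobiSym.quadratic_reciprocity_one_mod_four h4 (hodd v)).symm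
    simp only [hg]
    rw [this, ← pow_add, hE, one_pow]

/-- Changing the orientation of the symbols only costs a sign depending on residues mod four. -/
theorem symb_eq_sign_mul (φ ψ : J → J → ℕ) (hd : ∀ u, φ u u = 0 ∧ ψ u u = 0)
    (hpar : ∀ u v, Even (φ u v + φ v u + (ψ u v + ψ v u))) (D : J → ℕ) (hodd : ∀ u, Odd (D u))
    (hcop : ∀ u v, u ≠ v → (D u).Coprime (D v)) :
    symb φ D = reciprocitySign (fun u v => φ u v + ψ u v) (fun u => D u % 4) * symb ψ D := by
  rw [← symb_mul_symb_eq φ ψ hd hpar D hodd hcop, mul_assoc]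
  have : symb ψ D * symb ψ D = 1 := by
    unfold symb
    rw [← prod_mul_distrib]
    refine prod_eq_one fun u _ => ?_
    rw [← prod_mul_distrib]
    refine prod_eq_one fun v _ => ?_
    by_cases huv : u = v
    · subst huv; simp [hd]
    · rw [← mul_pow, ← sq, jacobiSym_sq_eq_one_real (hcop v u (Ne.symm huv)), one_pow]
  rw [this, mul_one]

end Tuples

section LinkedSums

variable {J : Type*} [Fintype J] [DecidableEq J]

variable (J) in
/-- Factorizations of the admissible integers below `x`. -/
def tupSet (x : ℕ) : Finset (J → ℕ) :=
  (Fintype.piFinset fun _ => range x).filter fun D =>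
    Squarefree (∏ j, D j) ∧ (∏ j, D j) % 4 = 1 ∧ ∏ j, D j < x

theorem mem_tupSet {x : ℕ} {D : J → ℕ} :
    D ∈ tupSet J x ↔ Squarefree (∏ j, D j) ∧ (∏ j, D j) % 4 = 1 ∧ ∏ j, D j < x := by
  simp only [tupSet, mem_filter, Fintype.mem_piFinset, mem_range, and_iff_right_iff_imp]
  rintro ⟨h1, -, h3⟩ j
  exact lt_of_le_of_lt (Nat.le_of_dvd (Nat.pos_of_ne_zero h1.ne_zero)
    (dvd_prod_of_mem D (mem_univ j))) h3

/-- The weight `N ^ (-ω)`. -/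
def wt (N : ℕ) (D : J → ℕ) : ℝ := ∏ u, ∏ _p ∈ (D u).primeFactors, (1 / N : ℝ)

theorem prod_update_two {M : Type*} [CommMonoid M] {u v : J} (huv : u ≠ v) (E : J → ℕ) (a b : ℕ)
    (g : ℕ → M) (h1 : g 1 = 1) :
    ∏ j, g (Function.update (Function.update E u a) v b j) =
      g a * g b * ∏ j, g (Function.update (Function.update E u 1) v 1 j) := by
  have key : ∀ a b : ℕ, ∏ j, g (Function.update (Function.update E u a) v b j) =
      g a * g b * ∏ j ∈ (univ.erase u).erase v, g (E j) := by
    intro a b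
    rw [← mul_prod_erase univ _ (mem_univ u),
      ← mul_prod_erase (univ.erase u) _ (mem_erase.2 ⟨huv.symm, mem_univ v⟩), ← mul_assoc]
    congr 1
    · simp [huv]
    · refine prod_congr rfl fun j hj => ?_
      simp only [mem_erase, mem_univ, and_true] at hj
      simp [hj]
  rw [key, key 1 1, h1, one_mul, one_mul]

theorem symb_update_two (ψ : J → J → ℕ) {u v : J} (huv : u ≠ v) (h1 : ψ u v = 0) (h2 : ψ v u = 1)
    (h3 : ψ u u = 0) (h4 : ψ v v = 0) (E : J → ℕ) :
    ∃ (A B : ℕ → ℝ) (K : ℝ), (∀ n, |A n| ≤ 1) ∧ (∀ n, |B n| ≤ 1) ∧ |K| ≤ 1 ∧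
      ∀ a b : ℕ, symb ψ (Function.update (Function.update E u a) v b) =
        K * A a * B b * jacobiSym a b := by
  set r : (J → ℕ) → J → J → ℝ := fun D s t => (jacobiSym (D t) (D s) : ℝ) ^ ψ s t with hr
  have hr1 : ∀ D s t, |r D s t| ≤ 1 := by
    intro D s t
    rw [hr, abs_pow]
    exact pow_le_one₀ (abs_nonneg _) (by exact_mod_cast abs_jacobiSym_le _ _)
  have habs : ∀ (P : J → J → Prop) [∀ s t, Decidable (P s t)] (D : J → ℕ),
      |∏ s, ∏ t, if P s t then r D s t else 1| ≤ 1 := by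
    intro P _ D
    rw [abs_prod]
    refine prod_le_one (fun _ _ => abs_nonneg _) fun s _ => ?_
    rw [abs_prod]
    refine prod_le_one (fun _ _ => abs_nonneg _) fun t _ => ?_
    split_ifs
    · exact hr1 D s t
    · simp
  refine ⟨fun a => ∏ s, ∏ t, if s = u ∨ t = u then
      r (Function.update (Function.update E u a) v 1) s t else 1,
    fun b => ∏ s, ∏ t, if s = v ∨ t = v then
      r (Function.update (Function.update E u 1) v b) s t else 1,
    ∏ s, ∏ t, if s ≠ u ∧ t ≠ u ∧ s ≠ v ∧ t ≠ v then r E s t else 1,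
    fun a => habs (fun s t => s = u ∨ t = u) _, fun b => habs (fun s t => s = v ∨ t = v) _,
    habs (fun s t => s ≠ u ∧ t ≠ u ∧ s ≠ v ∧ t ≠ v) _, fun a b => ?_⟩
  have h5 : (jacobiSym a b : ℝ) = ∏ s, ∏ t, if s = v ∧ t = u then (jacobiSym a b : ℝ) else 1 := by
    rw [prod_eq_single v, prod_eq_single u]
    · simp
    · intro t _ ht; simp [ht]
    · simp
    · intro s _ hs; simp [hs]
    · simp
  rw [h5]
  unfold symb
  rw [← prod_mul_distrib, ← prod_mul_distrib, ← prod_mul_distrib]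
  refine prod_congr rfl fun s _ => ?_
  rw [← prod_mul_distrib, ← prod_mul_distrib, ← prod_mul_distrib]
  refine prod_congr rfl fun t _ => ?_
  simp only [hr]
  by_cases hsu : s = u
  · subst hsu
    by_cases htu : t = s
    · subst htu; simp [h3, huv]
    · by_cases htv : t = v
      · subst htv; simp [h1, huv]
      · simp [huv, htu, htv]
  · by_cases hsv : s = v
    · subst hsv
      by_cases htu : t = u
      · subst htu; simp [h2, huv, huv.symm, jacobiSym.one_left]
      · by_cases htv : t = s
        · subst htv; simp [h4, huv.symm]
        · simp [hsu, htu, htv]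
    · by_cases htu : t = u
      · subst htu; simp [hsu, hsv, huv]
      · by_cases htv : t = v
        · subst htv; simp [hsu, hsv, huv.symm]
        · simp [hsu, hsv, htu, htv]

theorem wt_update_two (N : ℕ) {u v : J} (huv : u ≠ v) (E : J → ℕ) (hu : E u = 1) (hv : E v = 1)
    (a b : ℕ) : wt N (Function.update (Function.update E u a) v b) =
      (∏ _p ∈ a.primeFactors, (1 / N : ℝ)) * (∏ _p ∈ b.primeFactors, (1 / N : ℝ)) * wt N E := by
  unfold wt
  rw [prod_update_two huv E a b (fun n => ∏ _p ∈ n.primeFactors, (1 / N : ℝ)) (by simp),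
    ← hu, Function.update_eq_self, hu, ← hv, Function.update_eq_self]

theorem abs_wt_factor_le (N n : ℕ) : |∏ _p ∈ n.primeFactors, (1 / N : ℝ)| ≤ 1 := by
  rw [abs_prod]
  refine prod_le_one (fun _ _ => abs_nonneg _) fun _ _ => ?_
  rw [abs_of_nonneg (by positivity)]
  rcases Nat.eq_zero_or_pos N with rfl | h
  · simp
  · rw [div_le_one (by exact_mod_cast h)]
    exact_mod_cast h

theorem abs_wt_le (N : ℕ) (D : J → ℕ) : |wt N D| ≤ 1 := by
  unfold wt
  rw [abs_prod]
  exact prod_le_one (fun _ _ => abs_nonneg _) fun _ _ => abs_wt_factor_le _ _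

theorem wt_nonneg (N : ℕ) (D : J → ℕ) : 0 ≤ wt N D :=
  prod_nonneg fun _ _ => prod_nonneg fun _ _ => by positivity

theorem prod_update_two_self {u v : J} (huv : u ≠ v) (E : J → ℕ) (hu : E u = 1) (hv : E v = 1)
    (a b : ℕ) : ∏ j, Function.update (Function.update E u a) v b j = a * b * ∏ j, E j := by
  have := prod_update_two huv E a b (fun n => n) rfl
  rw [this]
  congr 1
  rw [← hu, Function.update_eq_self, hu, ← hv, Function.update_eq_self]

theorem linked_inner_le (φ : J → J → ℕ) (hφ : ∀ u, φ u u = 0) (N : ℕ) {u v : J} (huv : u ≠ v)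
    (hl : Odd (φ u v + φ v u)) (x w : ℕ) (hw : 1 ≤ w) (E : J → ℕ) (hu : E u = 1) (hv : E v = 1)
    (hE : Squarefree (∏ j, E j)) (Y : ℕ) (hY : Y = (x - 1) / ∏ j, E j) (S : Finset (ℕ × ℕ))
    (hS : S = (Icc 1 Y ×ˢ Icc 1 Y).filter fun p => Squarefree (p.1 * p.2 * ∏ j, E j) ∧
      p.1 * p.2 * (∏ j, E j) % 4 = 1 ∧ p.1 * p.2 * (∏ j, E j) < x ∧ w ^ 16 < p.1 ∧ w ^ 16 < p.2) :
    |∑ p ∈ S, wt N (Function.update (Function.update E u p.1) v p.2) *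
      symb φ (Function.update (Function.update E u p.1) v p.2)| ≤
      24 * Y * (1 + Real.log Y) ^ 5 / w := by
  set m := ∏ j, E j with hm
  have hm0 : 0 < m := Nat.pos_of_ne_zero hE.ne_zero
  set ψ : J → J → ℕ := fun s t => if s = u ∧ t = v then 0 else if s = v ∧ t = u then 1 else φ s t
    with hψ
  have hψd : ∀ s, φ s s = 0 ∧ ψ s s = 0 := by
    intro s
    refine ⟨hφ s, ?_⟩
    simp only [hψ]
    rw [if_neg, if_neg, hφ]
    · rintro ⟨h1, h2⟩; exact huv (h2.symm.trans h1)
    · rintro ⟨h1, h2⟩; exact huv (h1.symm.trans h2)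
  have hψuv : ψ u v = 0 := by simp [hψ]
  have hψvu : ψ v u = 1 := by simp [hψ, huv.symm]
  have hpar : ∀ s t, Even (φ s t + φ t s + (ψ s t + ψ t s)) := by
    intro s t
    by_cases h1 : s = u ∧ t = v
    · obtain ⟨rfl, rfl⟩ := h1
      rw [hψuv, hψvu]
      exact hl.add_one
    · by_cases h2 : s = v ∧ t = u
      · obtain ⟨rfl, rfl⟩ := h2
        rw [hψuv, hψvu, add_comm (φ s t)]
        exact hl.add_one
      · have h3 : ψ s t = φ s t := by simp only [hψ]; rw [if_neg h1, if_neg h2]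
        have h4 : ψ t s = φ t s := by
          simp only [hψ]; rw [if_neg (fun h => h2 h.symm), if_neg (fun h => h1 h.symm)]
        rw [h3, h4]
        exact ⟨_, rfl⟩
  obtain ⟨A, B, K, hA, hB, hK, hAB⟩ := symb_update_two ψ huv hψuv hψvu (hψd u).2 (hψd v).2 E
  set σ : ℕ → ℕ → ℝ := fun i j => reciprocitySign (fun s t => φ s t + ψ s t)
    (fun k => Function.update (Function.update E u i) v j k % 4) with hσ
  have hσmod : ∀ a b : ℕ, σ a b = σ (a % 4) (b % 4) := by
    intro a b
    simp only [hσ]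
    congr 1
    ext k
    by_cases hkv : k = v
    · subst hkv; simp
    · by_cases hku : k = u
      · subst hku; simp [hkv]
      · simp [hku, hkv]
  set τ : ℕ → ℕ → ℝ := fun i j => if i * j * m % 4 = 1 then σ i j * K * wt N E else 0 with hτ
  have hτ1 : ∀ i j, |τ i j| ≤ 1 := by
    intro i j
    simp only [hτ]
    split_ifs
    · rw [abs_mul, abs_mul, hσ, abs_reciprocitySign, one_mul]
      exact mul_le_one₀ hK (abs_nonneg _) (abs_wt_le N E)
    · simp
  set α : ℕ → ℝ := fun a => if Odd a ∧ Squarefree a ∧ w ^ 16 < a ∧ a.Coprime m then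
    A a * ∏ _p ∈ a.primeFactors, (1 / N : ℝ) else 0 with hα
  set β : ℕ → ℝ := fun a => if Odd a ∧ Squarefree a ∧ w ^ 16 < a ∧ a.Coprime m then
    B a * ∏ _p ∈ a.primeFactors, (1 / N : ℝ) else 0 with hβ
  set ind : ℕ → ℕ → ℝ := fun i a => if a % 4 = i then 1 else 0 with hind
  have hα1 : ∀ i n, |α n * ind i n| ≤ 1 := by
    intro i n
    rw [abs_mul]
    refine mul_le_one₀ ?_ (abs_nonneg _) ?_
    · simp only [hα]
      split_ifs
      · rw [abs_mul]; exact mul_le_one₀ (hA n) (abs_nonneg _) (abs_wt_factor_le _ _)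
      · simp
    · simp only [hind]; split_ifs <;> simp
  have hβ1 : ∀ i n, |β n * ind i n| ≤ 1 := by
    intro i n
    rw [abs_mul]
    refine mul_le_one₀ ?_ (abs_nonneg _) ?_
    · simp only [hβ]
      split_ifs
      · rw [abs_mul]; exact mul_le_one₀ (hB n) (abs_nonneg _) (abs_wt_factor_le _ _)
      · simp
    · simp only [hind]; split_ifs <;> simp
  have hαs : ∀ i n, α n * ind i n ≠ 0 → Odd n ∧ Squarefree n ∧ w ^ 16 < n := by
    intro i n h
    by_contra hc
    apply h
    simp only [hα]
    rw [if_neg (fun h' => hc ⟨h'.1, h'.2.1, h'.2.2.1⟩), zero_mul]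
  have hβs : ∀ i n, β n * ind i n ≠ 0 → Odd n ∧ Squarefree n ∧ w ^ 16 < n := by
    intro i n h
    by_contra hc
    apply h
    simp only [hβ]
    rw [if_neg (fun h' => hc ⟨h'.1, h'.2.1, h'.2.2.1⟩), zero_mul]
  -- the terms
  have hterm : ∀ a b : ℕ, a * b ≤ Y →
      (if Squarefree (a * b * m) ∧ a * b * m % 4 = 1 ∧ a * b * m < x ∧ w ^ 16 < a ∧ w ^ 16 < b then
        wt N (Function.update (Function.update E u a) v b) *
          symb φ (Function.update (Function.update E u a) v b) else 0) =
      ∑ i ∈ ({1, 3} : Finset ℕ), ∑ j ∈ ({1, 3} : Finset ℕ),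
        τ i j * ((α a * ind i a) * (β b * ind j b) * jacobiSym a b) := by
    intro a b hab
    have hexp : Odd a → Odd b → ∑ i ∈ ({1, 3} : Finset ℕ), ∑ j ∈ ({1, 3} : Finset ℕ),
        τ i j * ((α a * ind i a) * (β b * ind j b) * jacobiSym a b) =
        τ (a % 4) (b % 4) * (α a * β b * jacobiSym a b) := by
      intro ha hb
      have ha' : a % 4 = 1 ∨ a % 4 = 3 := by have := Nat.odd_iff.1 ha; omega
      have hb' : b % 4 = 1 ∨ b % 4 = 3 := by have := Nat.odd_iff.1 hb; omega
      simp only [hind]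
      rcases ha' with h | h <;> rcases hb' with h' | h' <;> rw [h, h'] <;> simp
    have hzero : ∀ z : ℝ, (∀ i j, (α a * ind i a) * (β b * ind j b) * jacobiSym a b = 0) → z = 0 →
        z = ∑ i ∈ ({1, 3} : Finset ℕ), ∑ j ∈ ({1, 3} : Finset ℕ),
        τ i j * ((α a * ind i a) * (β b * ind j b) * jacobiSym a b) := by
      intro z h hz
      simp only [h, hz, mul_zero, sum_const_zero]
    have hmodeq : (a % 4) * (b % 4) * m % 4 = a * b * m % 4 := by
      rw [Nat.mul_mod, Nat.mul_mod (a * b), ← Nat.mul_mod a b]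
    split_ifs with hc
    · obtain ⟨hsq, hmod, hlt, hza, hzb⟩ := hc
      have hodd : Odd (a * b * m) := by rw [Nat.odd_iff]; omega
      have hoab := Nat.odd_mul.1 hodd
      obtain ⟨ha, hb⟩ := Nat.odd_mul.1 hoab.1
      obtain ⟨hc1, hs1, -⟩ := Nat.squarefree_mul_iff.1 hsq
      obtain ⟨hc2, hs2, hs3⟩ := Nat.squarefree_mul_iff.1 hs1
      rw [hexp ha hb]
      have hprod : ∏ j, Function.update (Function.update E u a) v b j = a * b * m :=
        prod_update_two_self huv E hu hv a b
      have hoddD : ∀ k, Odd (Function.update (Function.update E u a) v b k) := by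
        intro k
        rw [← hprod] at hodd
        exact Odd.of_dvd_nat hodd (dvd_prod_of_mem _ (mem_univ k))
      rw [symb_eq_sign_mul φ ψ hψd hpar _ hoddD
        (fun s t hst => coprime_of_prod_squarefree (hprod.symm ▸ hsq) hst), hAB,
        wt_update_two N huv E hu hv]
      have : reciprocitySign (fun s t => φ s t + ψ s t)
          (fun k => Function.update (Function.update E u a) v b k % 4) = σ (a % 4) (b % 4) := by
        rw [← hσmod]
      rw [this]
      simp only [hτ, hα, hβ]
      rw [if_pos (hmodeq.trans hmod), if_pos ⟨ha, hs2, hza, (Nat.coprime_mul_iff_left.1 hc1).1⟩,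
        if_pos ⟨hb, hs3, hzb, (Nat.coprime_mul_iff_left.1 hc1).2⟩]
      ring
    · by_cases h1 : Odd a ∧ Squarefree a ∧ w ^ 16 < a ∧ a.Coprime m
      · by_cases h2 : Odd b ∧ Squarefree b ∧ w ^ 16 < b ∧ b.Coprime m
        · by_cases h3 : a.Coprime b
          · rw [hexp h1.1 h2.1]
            have : ¬ (a * b * m % 4 = 1) := by
              intro h4
              refine hc ⟨?_, h4, ?_, h1.2.2.1, h2.2.2.1⟩
              · refine Nat.squarefree_mul_iff.2 ⟨Nat.coprime_mul_iff_left.2 ⟨h1.2.2.2, h2.2.2.2⟩,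
                  Nat.squarefree_mul_iff.2 ⟨h3, h1.2.1, h2.2.1⟩, hE⟩
              · have h5 : a * b * m ≤ x - 1 := by
                  rw [hY] at hab
                  exact (Nat.le_div_iff_mul_le hm0).1 hab
                have h6 : 0 < a * b * m := by
                  rcases Nat.eq_zero_or_pos (a * b * m) with h | h
                  · rw [h] at h4; simp at h4
                  · exact h
                omega
            simp only [hτ]
            rw [if_neg (fun h => this (hmodeq.symm.trans h)), zero_mul]
          · refine hzero _ (fun i j => ?_) rfl
            have : jacobiSym a b = 0 := by
              rw [jacobiSym.eq_zero_iff]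
              refine ⟨(Nat.pos_of_ne_zero h2.2.1.ne_zero).ne', ?_⟩
              simpa using h3
            rw [this]; simp
        · refine hzero _ (fun i j => ?_) rfl
          simp only [hβ]
          rw [if_neg h2]; simp
      · refine hzero _ (fun i j => ?_) rfl
        simp only [hα]
        rw [if_neg h1]; simp
  have hsum : ∑ p ∈ S, wt N (Function.update (Function.update E u p.1) v p.2) *
      symb φ (Function.update (Function.update E u p.1) v p.2) =
      ∑ i ∈ ({1, 3} : Finset ℕ), ∑ j ∈ ({1, 3} : Finset ℕ), τ i j *
        ∑ a ∈ Icc 1 Y, ∑ b ∈ (Icc 1 Y).filter (fun b => a * b ≤ Y),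
          (α a * ind i a) * (β b * ind j b) * jacobiSym a b := by
    have hS' : S = ((Icc 1 Y ×ˢ Icc 1 Y).filter fun p => p.1 * p.2 ≤ Y).filter fun p =>
        Squarefree (p.1 * p.2 * m) ∧ p.1 * p.2 * m % 4 = 1 ∧ p.1 * p.2 * m < x ∧
          w ^ 16 < p.1 ∧ w ^ 16 < p.2 := by
      rw [hS]
      ext p
      simp only [mem_filter, and_assoc, and_congr_right_iff]
      intro _
      constructor
      · intro h
        refine ⟨?_, h⟩
        rw [hY, Nat.le_div_iff_mul_le hm0]
        omega
      · exact fun h => h.2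
    rw [hS', sum_filter]
    calc _ = ∑ p ∈ (Icc 1 Y ×ˢ Icc 1 Y).filter fun p => p.1 * p.2 ≤ Y,
          ∑ i ∈ ({1, 3} : Finset ℕ), ∑ j ∈ ({1, 3} : Finset ℕ),
          τ i j * ((α p.1 * ind i p.1) * (β p.2 * ind j p.2) * jacobiSym p.1 p.2) := by
            refine sum_congr rfl fun p hp => ?_
            exact hterm p.1 p.2 (mem_filter.1 hp).2
      _ = _ := by
            rw [sum_comm]
            refine sum_congr rfl fun i _ => ?_
            rw [sum_comm]
            refine sum_congr rfl fun j _ => ?_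
            rw [← mul_sum]
            congr 1
            rw [sum_filter, sum_product]
            simp only [sum_filter]
  rw [hsum]
  have hbd : ∀ i j, |τ i j * ∑ a ∈ Icc 1 Y, ∑ b ∈ (Icc 1 Y).filter (fun b => a * b ≤ Y),
      (α a * ind i a) * (β b * ind j b) * jacobiSym a b| ≤ 6 * Y * (1 + Real.log Y) ^ 5 / w := by
    intro i j
    have h1 := bilinear_hyperbola (fun a => α a * ind i a) (fun b => β b * ind j b) (hα1 i) (hβ1 j)
      w hw (hαs i) (hβs j) Y
    rw [abs_mul]
    calc _ ≤ 1 * |_| := mul_le_mul_of_nonneg_right (hτ1 i j) (abs_nonneg _)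
      _ ≤ _ := by rw [one_mul]; exact h1
  calc _ ≤ ∑ i ∈ ({1, 3} : Finset ℕ), ∑ j ∈ ({1, 3} : Finset ℕ),
        6 * (Y : ℝ) * (1 + Real.log Y) ^ 5 / w := by
        refine (abs_sum_le_sum_abs _ _).trans (sum_le_sum fun i _ => ?_)
        exact (abs_sum_le_sum_abs _ _).trans (sum_le_sum fun j _ => hbd i j)
    _ = _ := by simp; ring

theorem sum_inv_prod_le (x : ℕ) :
    ∑ E ∈ Fintype.piFinset (fun _ : J => Icc 1 x), (1 : ℝ) / ∏ j, (E j : ℝ) ≤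
      (1 + Real.log x) ^ Fintype.card J := by
  have h := Finset.prod_univ_sum (fun _ : J => Icc 1 x) (fun _ a => (1 : ℝ) / (a : ℝ))
  have h2 : ∑ E ∈ Fintype.piFinset (fun _ : J => Icc 1 x), (1 : ℝ) / ∏ j, (E j : ℝ) =
      ∏ _j : J, ∑ a ∈ Icc 1 x, (1 : ℝ) / (a : ℝ) := by
    rw [h]
    refine sum_congr rfl fun E _ => ?_
    rw [prod_div_distrib, prod_const_one]
  rw [h2, prod_const, card_univ]
  exact pow_le_pow_left₀ (sum_nonneg fun _ _ => by positivity) (sum_one_div_le x) _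

/-- Terms in which two linked coordinates are both large cancel. -/
theorem linked_sum_le (φ : J → J → ℕ) (hφ : ∀ u, φ u u = 0) (N : ℕ) {u v : J} (huv : u ≠ v)
    (hl : Odd (φ u v + φ v u)) (x w : ℕ) (hx : 1 ≤ x) (hw : 1 ≤ w) (P : (J → ℕ) → Prop) :
    |∑ D ∈ (tupSet J x).filter (fun D => P (Function.update (Function.update D u 1) v 1) ∧
      w ^ 16 < D u ∧ w ^ 16 < D v), wt N D * symb φ D| ≤
      24 * x * (1 + Real.log x) ^ (Fintype.card J + 5) / w := by
  set T := (tupSet J x).filter (fun D => P (Function.update (Function.update D u 1) v 1) ∧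
      w ^ 16 < D u ∧ w ^ 16 < D v) with hT
  set rest : (J → ℕ) → J → ℕ := fun D => Function.update (Function.update D u 1) v 1 with hrest
  have hlogx : 0 ≤ Real.log x := Real.log_natCast_nonneg x
  have hprodD : ∀ D : J → ℕ, ∏ j, D j = D u * D v * ∏ j, rest D j := by
    intro D
    have := prod_update_two huv D (D u) (D v) (fun n => n) rfl
    rw [← this]
    congr 1; ext j
    by_cases hjv : j = v
    · subst hjv; simp
    · by_cases hju : j = u
      · subst hju; simp [hjv]
      · simp [hjv]
  have hback : ∀ D : J → ℕ, Function.update (Function.update (rest D) u (D u)) v (D v) = D := by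
    intro D
    ext j
    by_cases hjv : j = v
    · subst hjv; simp
    · by_cases hju : j = u
      · subst hju; simp [hjv]
      · simp [hrest, hju, hjv]
  have hu1 : ∀ D, rest D u = 1 := fun D => by simp [hrest, huv]
  have hv1 : ∀ D, rest D v = 1 := fun D => by simp [hrest]
  have hmaps : ∀ D ∈ T, rest D ∈ T.image rest := fun D hD => mem_image_of_mem _ hD
  have hsqE : ∀ D ∈ T, Squarefree (∏ j, rest D j) := by
    intro D hD
    have := (mem_tupSet.1 (mem_filter.1 hD).1).1
    rw [hprodD] at this
    exact this.squarefree_of_dvd (dvd_mul_left _ _)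
  rw [← sum_fiberwise_of_maps_to hmaps]
  have hinner : ∀ E ∈ T.image rest, |∑ D ∈ T with rest D = E, wt N D * symb φ D| ≤
      24 * x * (1 + Real.log x) ^ 5 / w * (1 / ∏ j, (E j : ℝ)) := by
    intro E hE
    obtain ⟨D0, hD0, hD0E⟩ := mem_image.1 hE
    have hEsq : Squarefree (∏ j, E j) := hD0E ▸ hsqE D0 hD0
    have hEu : E u = 1 := hD0E ▸ hu1 D0
    have hEv : E v = 1 := hD0E ▸ hv1 D0
    have hP : P E := by rw [← hD0E]; exact (mem_filter.1 hD0).2.1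
    set Y := (x - 1) / ∏ j, E j with hY
    have hm0 : 0 < ∏ j, E j := Nat.pos_of_ne_zero hEsq.ne_zero
    set S := (Icc 1 Y ×ˢ Icc 1 Y).filter fun p : ℕ × ℕ => Squarefree (p.1 * p.2 * ∏ j, E j) ∧
      p.1 * p.2 * (∏ j, E j) % 4 = 1 ∧ p.1 * p.2 * (∏ j, E j) < x ∧ w ^ 16 < p.1 ∧ w ^ 16 < p.2
      with hS
    have hback' : ∀ D, rest D = E → Function.update (Function.update E u (D u)) v (D v) = D := by
      intro D h; rw [← h]; exact hback D
    have hrest' : ∀ a b : ℕ, rest (Function.update (Function.update E u a) v b) = E := by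
      intro a b
      ext j
      by_cases hjv : j = v
      · subst hjv; simp [hrest, hEv]
      · by_cases hju : j = u
        · subst hju; simp [hrest, hjv, hEu]
        · simp [hrest, hju, hjv]
    have hsum : ∑ D ∈ T with rest D = E, wt N D * symb φ D =
        ∑ p ∈ S, wt N (Function.update (Function.update E u p.1) v p.2) *
          symb φ (Function.update (Function.update E u p.1) v p.2) := by
      refine sum_nbij' (fun D => (D u, D v))
        (fun p => Function.update (Function.update E u p.1) v p.2) ?_ ?_ ?_ ?_ ?_
      · intro D hD
        obtain ⟨hDT, hDE⟩ := mem_filter.1 hD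
        obtain ⟨hDx, -, h1, h2⟩ := mem_filter.1 hDT
        obtain ⟨h3, h4, h5⟩ := mem_tupSet.1 hDx
        rw [hprodD, hDE] at h3 h4 h5
        have h6 : D u * D v ≤ Y := by
          rw [hY, Nat.le_div_iff_mul_le hm0]; omega
        have h7 : 0 < D u := by omega
        have h8 : 0 < D v := by omega
        refine mem_filter.2 ⟨mem_product.2 ⟨mem_Icc.2 ⟨h7, ?_⟩, mem_Icc.2 ⟨h8, ?_⟩⟩,
          h3, h4, h5, h1, h2⟩
        · exact (Nat.le_mul_of_pos_right _ h8).trans h6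
        · exact (Nat.le_mul_of_pos_left _ h7).trans h6
      · rintro ⟨a, b⟩ hp
        obtain ⟨-, h1, h2, h3, h4, h5⟩ := mem_filter.1 hp
        refine mem_filter.2 ⟨mem_filter.2 ⟨mem_tupSet.2 ?_, ?_, ?_, ?_⟩, hrest' a b⟩
        · rw [prod_update_two_self huv E hEu hEv]; exact ⟨h1, h2, h3⟩
        · have := hrest' a b
          simp only [hrest] at this
          rw [this]; exact hP
        · simpa [huv] using h4
        · simpa using h5
      · intro D hD
        exact hback' D (mem_filter.1 hD).2
      · rintro ⟨a, b⟩ _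
        simp [huv]
      · intro D hD
        rw [hback' D (mem_filter.1 hD).2]
    rw [hsum]
    refine (linked_inner_le φ hφ N huv hl x w hw E hEu hEv hEsq Y hY S hS).trans ?_
    have hY1 : (Y : ℝ) ≤ x * (1 / ∏ j, (E j : ℝ)) := by
      rw [mul_one_div, le_div_iff₀ (by exact_mod_cast hm0)]
      have : Y * ∏ j, E j ≤ x := (Nat.div_mul_le_self _ _).trans (Nat.sub_le _ _)
      exact_mod_cast this
    have hY2 : Real.log Y ≤ Real.log x := by
      rcases Nat.eq_zero_or_pos Y with h | h
      · rw [h]; simpa using hlogx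
      · refine Real.log_le_log (by exact_mod_cast h) ?_
        have : Y ≤ x := (Nat.div_le_self _ _).trans (Nat.sub_le _ _)
        exact_mod_cast this
    have hY3 : 0 ≤ Real.log Y := Real.log_natCast_nonneg Y
    calc 24 * (Y : ℝ) * (1 + Real.log Y) ^ 5 / w
        ≤ 24 * (x * (1 / ∏ j, (E j : ℝ))) * (1 + Real.log x) ^ 5 / w := by gcongr
      _ = _ := by ring
  have hsub : T.image rest ⊆ Fintype.piFinset (fun _ : J => Icc 1 x) := by
    intro E hE
    obtain ⟨D, hD, rfl⟩ := mem_image.1 hE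
    have hsq := hsqE D hD
    have h1 := (mem_tupSet.1 (mem_filter.1 hD).1).2.2
    have h0 := (mem_tupSet.1 (mem_filter.1 hD).1).1
    have hdv : ∏ j, rest D j ∣ ∏ j, D j := by rw [hprodD D]; exact dvd_mul_left _ _
    rw [Fintype.mem_piFinset]
    intro j
    have hj := (dvd_prod_of_mem (rest D) (mem_univ j)).trans hdv
    have := Nat.le_of_dvd (Nat.pos_of_ne_zero h0.ne_zero) hj
    exact mem_Icc.2 ⟨Nat.pos_of_dvd_of_pos hj (Nat.pos_of_ne_zero h0.ne_zero), by omega⟩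
  calc _ ≤ ∑ E ∈ T.image rest, 24 * x * (1 + Real.log x) ^ 5 / w * (1 / ∏ j, (E j : ℝ)) :=
        (abs_sum_le_sum_abs _ _).trans (sum_le_sum hinner)
    _ ≤ ∑ E ∈ Fintype.piFinset (fun _ : J => Icc 1 x),
        24 * x * (1 + Real.log x) ^ 5 / w * (1 / ∏ j, (E j : ℝ)) :=
        sum_le_sum_of_subset_of_nonneg hsub fun _ _ _ => by positivity
    _ ≤ 24 * x * (1 + Real.log x) ^ 5 / w * (1 + Real.log x) ^ Fintype.card J := by
        rw [← mul_sum]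
        exact mul_le_mul_of_nonneg_left (sum_inv_prod_le x) (by positivity)
    _ = _ := by rw [pow_add]; ring

end LinkedSums

theorem sum_divisors_char (χ : ℕ →*₀ ℝ) {l : ℕ} (hl : Squarefree l) :
    ∑ a ∈ l.divisors, χ a = ∏ p ∈ l.primeFactors, (1 + χ p) := by
  let f : ArithmeticFunction ℝ := ⟨χ, map_zero χ⟩
  have hf : f.IsMultiplicative := ⟨map_one χ, fun {m n} _ => map_mul χ m n⟩
  exact (hf.prodPrimeFactors_one_add_of_squarefree hl).symm

section SplitSums

variable {J : Type*} [Fintype J] [DecidableEq J]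

/-- The coordinates separating two colours through the linking relation. -/
def sepSet (φ : J → J → ℕ) (u u' : J) : Finset J :=
  univ.filter fun s => Odd (φ u s + φ s u + (φ u' s + φ s u'))

theorem symb_split (ψ : J → J → ℕ) {u u' : J} (huu : u ≠ u') (h1 : ∀ t, ψ u t = 0)
    (h2 : ∀ t, ψ u' t = 0) (G : J → ℕ) (l a : ℕ) (hal : a ∣ l) (hu : G u = 1) (hu' : G u' = 1)
    (hG : ∀ s, G s ≠ 0) (hcop : ∀ s, l.Coprime (G s)) :
    symb ψ (Function.update (Function.update G u a) u' (l / a)) =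
      symb ψ (Function.update (Function.update G u 1) u' l) *
        jacobiSym a (∏ s ∈ univ.filter fun s => Odd (ψ s u + ψ s u'), G s) := by
  have hsq : ∀ s, ((jacobiSym a (G s) : ℤ) : ℝ) ^ 2 = 1 := fun s =>
    jacobiSym_sq_eq_one_real ((hcop s).coprime_dvd_left hal)
  have hmul : ∀ s, ((jacobiSym ((l / a : ℕ) : ℤ) (G s) : ℤ) : ℝ) =
      (jacobiSym l (G s) : ℝ) * jacobiSym a (G s) := by
    intro s
    obtain ⟨b, rfl⟩ := hal
    rcases Nat.eq_zero_or_pos a with rfl | ha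
    · have h5 := hcop s
      simp at h5
      simp [h5]
    rw [Nat.mul_div_cancel_left _ ha, Nat.cast_mul, jacobiSym.mul_left]
    push_cast
    have := hsq s
    calc ((jacobiSym (b : ℤ) (G s) : ℤ) : ℝ) = (jacobiSym (a : ℤ) (G s) : ℝ) ^ 2 * jacobiSym (b : ℤ) (G s) := by
          rw [this, one_mul]
      _ = _ := by ring
  have hfac : ∀ s t, (jacobiSym (Function.update (Function.update G u a) u' (l / a) t)
      (Function.update (Function.update G u a) u' (l / a) s) : ℝ) ^ ψ s t =
      (jacobiSym (Function.update (Function.update G u 1) u' l t)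
        (Function.update (Function.update G u 1) u' l s) : ℝ) ^ ψ s t *
      ((if t = u then (jacobiSym a (G s) : ℝ) ^ ψ s t else 1) *
        (if t = u' then (jacobiSym a (G s) : ℝ) ^ ψ s t else 1)) := by
    intro s t
    by_cases hs : s = u
    · subst hs; simp [h1]
    · by_cases hs' : s = u'
      · subst hs'; simp [h2]
      · by_cases ht : t = u
        · subst ht; simp [hs, hs', huu, jacobiSym.one_left]
        · by_cases ht' : t = u'
          · subst ht'; simp only [Function.update_self, ne_eq, hs', hs, not_false_eq_true,
              Function.update_of_ne, ht, if_false, if_true, one_mul, hmul, mul_pow]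
          · simp [hs, hs', ht, ht']
  unfold symb
  simp only [hfac, prod_mul_distrib, prod_ite_eq', mem_univ, if_true]
  congr 1
  rw [jacobiSym_prod_right _ _ _ (fun s _ => hG s), ← prod_mul_distrib, prod_filter]
  push_cast
  refine prod_congr rfl fun s _ => ?_
  rw [← pow_add]
  split_ifs with ho
  · obtain ⟨r, hr⟩ := ho
    rw [hr, pow_succ, pow_mul, hsq, one_pow, one_mul]
  · obtain ⟨r, hr⟩ := Nat.not_odd_iff_even.1 ho
    rw [hr, ← two_mul, pow_mul, hsq, one_pow]

theorem div_mod_four {l a : ℕ} (hal : a ∣ l) (hl : Odd l) : (l / a) % 4 = (l * (a % 4)) % 4 := by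
  obtain ⟨b, rfl⟩ := hal
  obtain ⟨ha, hb⟩ := Nat.odd_mul.1 hl
  have ha0 : 0 < a := ha.pos
  rw [Nat.mul_div_cancel_left _ ha0]
  have h1 : a * a % 4 = 1 := by
    have := Nat.odd_iff.1 ha
    have : a % 4 = 1 ∨ a % 4 = 3 := by omega
    rcases this with h | h <;> rw [Nat.mul_mod, h]
  have h2 : a * b * (a % 4) % 4 = (a * a % 4) * b % 4 := by
    rw [Nat.mul_mod, Nat.mod_mod, ← Nat.mul_mod, Nat.mod_mul_mod]
    congr 1; ring
  rw [h2, h1, one_mul]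

theorem split_inner_le (φ : J → J → ℕ) (hφ : ∀ u, φ u u = 0) (N : ℕ) {u u' : J} (huu : u ≠ u')
    (hev : Even (φ u u' + φ u' u)) (G : J → ℕ) (l : ℕ) (hu : G u = 1) (hu' : G u' = 1)
    (hsq : Squarefree (l * ∏ j, G j)) (hodd : Odd (l * ∏ j, G j)) :
    |∑ a ∈ l.divisors, wt N (Function.update (Function.update G u a) u' (l / a)) *
        symb φ (Function.update (Function.update G u a) u' (l / a))| ≤
      wt N G * (∏ _p ∈ l.primeFactors, (1 / N : ℝ)) *
        ∑ ε : Bool, ∏ p ∈ l.primeFactors, (1 + qchar ε (∏ s ∈ sepSet φ u u', G s) p) := by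
  set Q := ∏ s ∈ sepSet φ u u', G s with hQ
  set W := wt N G * (∏ _p ∈ l.primeFactors, (1 / N : ℝ)) with hW
  obtain ⟨hcop, hsql, hsqG⟩ := Nat.squarefree_mul_iff.1 hsq
  obtain ⟨hol, hoG⟩ := Nat.odd_mul.1 hodd
  have hW0 : 0 ≤ W := mul_nonneg (wt_nonneg N G) (prod_nonneg fun _ _ => by positivity)
  set ψ : J → J → ℕ := fun s t => if s = u ∨ s = u' then 0 else
    if t = u ∨ t = u' then (φ s t + φ t s) % 2 else φ s t with hψ
  have hψu : ∀ t, ψ u t = 0 := fun t => by simp [hψ]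
  have hψu' : ∀ t, ψ u' t = 0 := fun t => by simp [hψ]
  have hψd : ∀ s, φ s s = 0 ∧ ψ s s = 0 := by
    intro s
    refine ⟨hφ s, ?_⟩
    simp only [hψ, hφ]
    split_ifs <;> rfl
  have hpar : ∀ s t, Even (φ s t + φ t s + (ψ s t + ψ t s)) := by
    intro s t
    simp only [hψ]
    rw [Nat.even_iff] at hev ⊢
    by_cases hs : s = u ∨ s = u'
    · by_cases ht : t = u ∨ t = u'
      · rw [if_pos hs, if_pos ht]
        rcases hs with rfl | rfl <;> rcases ht with rfl | rfl <;> (try simp only [hφ]) <;> omega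
      · rw [if_pos hs, if_neg ht, if_pos hs]; omega
    · by_cases ht : t = u ∨ t = u'
      · rw [if_neg hs, if_pos ht, if_pos ht]; omega
      · rw [if_neg hs, if_neg ht, if_neg ht, if_neg hs]; omega
  have hG0 : ∀ s, G s ≠ 0 := fun s => (squarefree_of_prod_squarefree hsqG s).ne_zero
  have hcopG : ∀ s, l.Coprime (G s) := fun s =>
    hcop.coprime_dvd_right (dvd_prod_of_mem G (mem_univ s))
  have hQ' : ∏ s ∈ univ.filter (fun s => Odd (ψ s u + ψ s u')), G s = Q := by
    rw [hQ]
    unfold sepSet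
    rw [prod_filter, prod_filter]
    refine prod_congr rfl fun s _ => ?_
    by_cases hs : s = u ∨ s = u'
    · have : G s = 1 := by rcases hs with rfl | rfl <;> assumption
      simp [this]
    · congr 1
      simp only [hψ, if_neg hs, true_or, or_true, if_true]
      rw [Nat.odd_iff, Nat.odd_iff]
      apply propext
      omega
  set V := symb ψ (Function.update (Function.update G u 1) u' l) with hV
  set κ : ℕ → ℝ := fun i => reciprocitySign (fun s t => φ s t + ψ s t)
    (fun k => Function.update (Function.update G u i) u' (l * i) k % 4) * V with hκ
  have hκ1 : ∀ i, |κ i| ≤ 1 := by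
    intro i
    simp only [hκ]
    rw [abs_mul, abs_reciprocitySign, one_mul]
    exact abs_symb_le _ _
  have hterm : ∀ a ∈ l.divisors, wt N (Function.update (Function.update G u a) u' (l / a)) *
        symb φ (Function.update (Function.update G u a) u' (l / a)) =
      W * ((κ 1 + κ 3) / 2 * qchar false Q a + (κ 1 - κ 3) / 2 * qchar true Q a) := by
    intro a ha
    have hal := Nat.dvd_of_mem_divisors ha
    have ha0 : a ≠ 0 := ne_zero_of_dvd_ne_zero hsql.ne_zero hal
    have hoa : Odd a := hol.of_dvd_nat hal
    have hprod : ∏ j, Function.update (Function.update G u a) u' (l / a) j = l * ∏ j, G j := by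
      rw [prod_update_two_self huu G hu hu', Nat.mul_div_cancel' hal]
    have hwt : wt N (Function.update (Function.update G u a) u' (l / a)) = W := by
      rw [wt_update_two N huu G hu hu', hW, mul_comm (wt N G)]
      congr 1
      have hc : a.Coprime (l / a) := by
        apply Nat.coprime_of_squarefree_mul
        rwa [Nat.mul_div_cancel' hal]
      rw [← prod_union hc.disjoint_primeFactors, ← hc.primeFactors_mul, Nat.mul_div_cancel' hal]
    have hoddD : ∀ k, Odd (Function.update (Function.update G u a) u' (l / a) k) := by
      intro k
      rw [← hprod] at hodd
      exact Odd.of_dvd_nat hodd (dvd_prod_of_mem _ (mem_univ k))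
    have hsign : reciprocitySign (fun s t => φ s t + ψ s t)
        (fun k => Function.update (Function.update G u a) u' (l / a) k % 4) * V = κ (a % 4) := by
      simp only [hκ]
      congr 2
      ext k
      by_cases hk' : k = u'
      · subst hk'
        simp only [Function.update_self]
        exact div_mod_four hal hol
      · by_cases hk : k = u
        · subst hk; simp [hk']
        · simp [hk, hk']
    rw [hwt, symb_eq_sign_mul φ ψ hψd hpar _ hoddD
        (fun s t hst => coprime_of_prod_squarefree (hprod.symm ▸ hsq) hst),
        symb_split ψ huu hψu hψu' G l a hal hu hu' hG0 hcopG, hQ', ← mul_assoc (reciprocitySign _ _), hsign,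
        qchar_apply ha0, qchar_apply ha0]
    unfold qsym
    congr 1
    have hmod : a % 4 = 1 ∨ a % 4 = 3 := by have := Nat.odd_iff.1 hoa; omega
    rcases hmod with h | h
    · rw [h, ZMod.χ₄_nat_one_mod_four h]; simp; ring
    · rw [h, ZMod.χ₄_nat_three_mod_four h]; simp; ring
  rw [sum_congr rfl hterm, ← mul_sum, sum_add_distrib, ← mul_sum, ← mul_sum, abs_mul,
    abs_of_nonneg hW0]
  refine mul_le_mul_of_nonneg_left ?_ hW0
  rw [sum_divisors_char _ hsql, sum_divisors_char _ hsql]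
  have hnn : ∀ ε : Bool, 0 ≤ ∏ p ∈ l.primeFactors, (1 + qchar ε Q p) := by
    intro ε
    refine prod_nonneg fun p _ => ?_
    have := (abs_le.1 (abs_qchar_le ε Q p)).1
    linarith
  have h1 := hnn false
  have h2 := hnn true
  have hk1 := abs_le.1 (hκ1 1)
  have hk3 := abs_le.1 (hκ1 3)
  rw [Fintype.sum_bool]
  refine (abs_add_le _ _).trans ?_
  rw [abs_mul, abs_mul, abs_of_nonneg h1, abs_of_nonneg h2]
  have e1 : |(κ 1 + κ 3) / 2| ≤ 1 := by rw [abs_le]; constructor <;> linarith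
  have e2 : |(κ 1 - κ 3) / 2| ≤ 1 := by rw [abs_le]; constructor <;> linarith
  have := mul_le_mul_of_nonneg_right e1 h1
  have := mul_le_mul_of_nonneg_right e2 h2
  linarith

end SplitSums

theorem log_div_le {x m : ℕ} (hm : 1 ≤ m) (hmx : m ^ 2 ≤ x) :
    1 ≤ x / m ∧ Real.log x / 2 ≤ 1 + Real.log ((x / m : ℕ) : ℝ) := by
  have h1 : m * m ≤ x := by rw [← sq]; exact hmx
  have hy : 1 ≤ x / m := hm.trans ((Nat.le_div_iff_mul_le hm).2 h1)
  refine ⟨hy, ?_⟩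
  set y := x / m with hydef
  have hlt : x < (y + 1) * m := by
    rw [mul_comm]
    exact Nat.lt_mul_div_succ x hm
  have hm0 : (0 : ℝ) < m := by exact_mod_cast hm
  have hy0 : (1 : ℝ) ≤ y := by exact_mod_cast hy
  have hx0 : (0 : ℝ) < x := by
    have : 0 < x := by nlinarith
    exact_mod_cast this
  have e1 : Real.log x ≤ Real.log ((y + 1) * m) := by
    apply Real.log_le_log hx0
    exact_mod_cast hlt.le
  rw [Real.log_mul (by positivity) hm0.ne'] at e1
  have e2 : Real.log ((m : ℝ) ^ 2) ≤ Real.log x := by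
    apply Real.log_le_log (by positivity)
    exact_mod_cast hmx
  rw [Real.log_pow] at e2
  have e3 : Real.log ((y : ℝ) + 1) ≤ Real.log (2 * y) := by
    apply Real.log_le_log (by positivity)
    linarith
  rw [Real.log_mul (by norm_num) (by positivity)] at e3
  have e4 := Real.log_two_lt_d9
  push_cast at e2
  linarith

section OuterSums

variable {J : Type*} [Fintype J] [DecidableEq J]

/-- The coordinates outside `U`. -/
def offPart (U : Finset J) (D : J → ℕ) (j : J) : ℕ := if j ∈ U then 1 else D j

/-- The coordinates in `U`. -/
def onPart (U : Finset J) (D : J → ℕ) (j : J) : ℕ := if j ∈ U then D j else 1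

theorem prod_on_mul_off (U : Finset J) (D : J → ℕ) :
    (∏ j, onPart U D j) * ∏ j, offPart U D j = ∏ j, D j := by
  rw [← prod_mul_distrib]
  refine prod_congr rfl fun j _ => ?_
  unfold onPart offPart
  split_ifs <;> simp

theorem offPart_facts (U : Finset J) (x z : ℕ) (hz : 1 ≤ z) (hzx : z ^ (2 * Fintype.card J) ≤ x)
    {D : J → ℕ} (hD : D ∈ tupSet J x) (hDz : ∀ j ∉ U, D j ≤ z) :
    Squarefree (∏ j, offPart U D j) ∧ Odd (∏ j, offPart U D j) ∧
      (∀ j, 1 ≤ offPart U D j ∧ offPart U D j ≤ z) ∧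
      ∏ j, offPart U D j ≤ z ^ Fintype.card J ∧ (∏ j, offPart U D j) ^ 2 ≤ x := by
  obtain ⟨h1, h2, h3⟩ := mem_tupSet.1 hD
  have hdvd : ∏ j, offPart U D j ∣ ∏ j, D j := by
    rw [← prod_on_mul_off U D]; exact dvd_mul_left _ _
  have hodd : Odd (∏ j, D j) := by rw [Nat.odd_iff]; omega
  have hsq := h1.squarefree_of_dvd hdvd
  have hle : ∀ j, 1 ≤ offPart U D j ∧ offPart U D j ≤ z := by
    intro j
    refine ⟨Nat.pos_of_ne_zero (squarefree_of_prod_squarefree hsq j).ne_zero, ?_⟩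
    unfold offPart
    split_ifs with h
    · exact hz
    · exact hDz j h
  have hle' : ∏ j, offPart U D j ≤ z ^ Fintype.card J := by
    calc _ ≤ ∏ _j : J, z := prod_le_prod' fun j _ => (hle j).2
      _ = _ := by rw [prod_const, card_univ]
  refine ⟨hsq, hodd.of_dvd_nat hdvd, hle, hle', ?_⟩
  calc _ ≤ (z ^ Fintype.card J) ^ 2 := Nat.pow_le_pow_left hle' 2
    _ = z ^ (2 * Fintype.card J) := by rw [← pow_mul, mul_comm]
    _ ≤ x := hzx

theorem outer_sum_le (U : Finset J) (x z : ℕ) (hz : 1 ≤ z)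
    (hzx : z ^ (2 * Fintype.card J) ≤ x) (T : Finset (J → ℕ))
    (hT : ∀ D ∈ T, D ∈ tupSet J x ∧ ∀ j ∉ U, D j ≤ z) (g : (J → ℕ) → ℝ) (B : ℝ) (hB : 0 ≤ B)
    (h : ∀ E ∈ T.image (offPart U), |∑ D ∈ T with offPart U D = E, g D| ≤
      B * (1 / ∏ j, (E j : ℝ))) :
    |∑ D ∈ T, g D| ≤ B * (1 + Real.log z) ^ Fintype.card J := by
  rw [← sum_fiberwise_of_maps_to (fun D hD => mem_image_of_mem (offPart U) hD)]
  have hsub : T.image (offPart U) ⊆ Fintype.piFinset (fun _ : J => Icc 1 z) := by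
    intro E hE
    obtain ⟨D, hD, rfl⟩ := mem_image.1 hE
    rw [Fintype.mem_piFinset]
    intro j
    exact mem_Icc.2 ((offPart_facts U x z hz hzx (hT D hD).1 (hT D hD).2).2.2.1 j)
  calc _ ≤ ∑ E ∈ T.image (offPart U), B * (1 / ∏ j, (E j : ℝ)) :=
        (abs_sum_le_sum_abs _ _).trans (sum_le_sum h)
    _ ≤ ∑ E ∈ Fintype.piFinset (fun _ : J => Icc 1 z), B * (1 / ∏ j, (E j : ℝ)) :=
        sum_le_sum_of_subset_of_nonneg hsub fun _ _ _ => by positivity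
    _ ≤ _ := by
        rw [← mul_sum]
        exact mul_le_mul_of_nonneg_left (sum_inv_prod_le z) hB

theorem prod_onPart_le {x m : ℕ} (hm : 1 ≤ m) (U : Finset J) {D : J → ℕ} (hD : D ∈ tupSet J x)
    (hE : ∏ j, offPart U D j = m) :
    Squarefree (∏ j, onPart U D j) ∧ ∏ j, onPart U D j ≤ x / m := by
  obtain ⟨h1, h2, h3⟩ := mem_tupSet.1 hD
  rw [← prod_on_mul_off U D] at h1 h3
  refine ⟨h1.squarefree_of_dvd (dvd_mul_right _ _), ?_⟩
  rw [Nat.le_div_iff_mul_le hm, ← hE]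
  exact h3.le

theorem wt_le_onPart (N : ℕ) (U : Finset J) (D : J → ℕ) :
    wt N D ≤ ∏ j, ∏ _p ∈ (onPart U D j).primeFactors, if j ∈ U then (1 / N : ℝ) else 0 := by
  unfold wt
  refine prod_le_prod (fun j _ => prod_nonneg fun _ _ => by positivity) fun j _ => ?_
  unfold onPart
  split_ifs with h
  · exact le_rfl
  · simp only [Nat.primeFactors_one, prod_empty]
    exact (le_abs_self _).trans (abs_wt_factor_le N (D j))

/-- Terms with few large coordinates. -/
theorem few_large_sum_le (N : ℕ) (hN : 2 ≤ N) (U : Finset J) (hU : U.card < N) (x z : ℕ)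
    (hx : 2 ≤ x) (hz : 1 ≤ z) (hzx : z ^ (2 * Fintype.card J) ≤ x) (T : Finset (J → ℕ))
    (hT : ∀ D ∈ T, D ∈ tupSet J x ∧ ∀ j ∉ U, D j ≤ z) (g : (J → ℕ) → ℝ)
    (hg : ∀ D, |g D| ≤ wt N D) :
    |∑ D ∈ T, g D| ≤
      24 * x * (2 / Real.log x) ^ (1 / N : ℝ) * (1 + Real.log z) ^ Fintype.card J := by
  have hlogx : 0 < Real.log x := Real.log_pos (by exact_mod_cast hx)
  refine outer_sum_le U x z hz hzx T hT g _ (by positivity) ?_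
  intro E hE
  obtain ⟨D0, hD0, hD0E⟩ := mem_image.1 hE
  obtain ⟨hsq, hodd, -, hmz, hmx⟩ := offPart_facts U x z hz hzx (hT D0 hD0).1 (hT D0 hD0).2
  rw [hD0E] at hsq hodd hmz hmx
  set m := ∏ j, E j with hm
  have hm1 : 1 ≤ m := hodd.pos
  obtain ⟨hy1, hylog⟩ := log_div_le hm1 hmx
  set F := T.filter fun D => offPart U D = E with hF
  set h : J → ℕ → ℝ := fun j _ => if j ∈ U then (1 / N : ℝ) else 0 with hh
  have hinj : Set.InjOn (onPart U) (F : Set (J → ℕ)) := by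
    intro D hD D' hD' heq
    have e1 := (mem_filter.1 (mem_coe.1 hD)).2
    have e2 := (mem_filter.1 (mem_coe.1 hD')).2
    ext j
    by_cases hj : j ∈ U
    · have := congrFun heq j
      simpa [onPart, hj] using this
    · have := congrFun (e1.trans e2.symm) j
      simpa [offPart, hj] using this
  have hm0 : (0 : ℝ) < m := by exact_mod_cast hm1
  have hylow : (0 : ℝ) < 1 + Real.log ((x / m : ℕ) : ℝ) := by linarith
  calc |∑ D ∈ F, g D| ≤ ∑ D ∈ F, wt N D :=
        (abs_sum_le_sum_abs _ _).trans (sum_le_sum fun D _ => hg D)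
    _ ≤ ∑ D ∈ F, ∏ j, ∏ p ∈ (onPart U D j).primeFactors, h j p :=
        sum_le_sum fun D _ => wt_le_onPart N U D
    _ = ∑ D ∈ F.image (onPart U), ∏ j, ∏ p ∈ (D j).primeFactors, h j p := by
        rw [sum_image hinj]
    _ ≤ ∑ n ∈ (Icc 1 (x / m)).filter Squarefree, ∏ p ∈ n.primeFactors, ∑ j, h j p := by
        refine sum_prod_le_sum_squarefree h ?_ _ _ ?_
        · intro j p; simp only [hh]; split_ifs <;> positivity
        · intro D hD
          obtain ⟨D', hD', rfl⟩ := mem_image.1 hD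
          obtain ⟨h1, h2⟩ := mem_filter.1 hD'
          exact prod_onPart_le hm1 U (hT D' h1).1 (by rw [h2])
    _ ≤ ∑ n ∈ (Icc 1 (x / m)).filter Squarefree, ∏ p ∈ n.primeFactors, (1 - 1 / (N : ℝ)) := by
        have hN0 : (0 : ℝ) < N := by positivity
        refine sum_le_sum fun n _ => prod_le_prod (fun p _ => ?_) fun p _ => ?_
        · exact sum_nonneg fun j _ => by simp only [hh]; split_ifs <;> positivity
        · simp only [hh, sum_ite_mem, univ_inter, sum_const, nsmul_eq_mul]
          rw [mul_one_div, one_sub_div hN0.ne']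
          gcongr
          have : U.card + 1 ≤ N := hU
          have : (U.card : ℝ) + 1 ≤ N := by exact_mod_cast this
          linarith
    _ ≤ 24 * ((x / m : ℕ) : ℝ) * (1 / (1 + Real.log ((x / m : ℕ) : ℝ))) ^ (1 / N : ℝ) :=
        sum_squarefree_const_le N hN _ hy1
    _ ≤ 24 * (x / m) * (2 / Real.log x) ^ (1 / N : ℝ) := by
        gcongr 24 * ?_ * ?_ ^ _
        · exact Nat.cast_div_le
        · rw [div_le_div_iff₀ hylow hlogx]; linarith
    _ = _ := by
        rw [hm, Nat.cast_prod]; ring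

theorem pair_split_sum_le (φ : J → J → ℕ) (hφ : ∀ u, φ u u = 0) (N : ℕ) (hN : 2 ≤ N)
    (U : Finset J) (hU : U.card = N) (hUe : ∀ u ∈ U, ∀ v ∈ U, Even (φ u v + φ v u))
    (x z : ℕ) (hx : 2 ≤ x) (hz : 1 ≤ z) (hzx : z ^ (2 * Fintype.card J) ≤ x)
    (hH : ∀ v ∉ U, ∃ u ∈ U, ∃ u' ∈ U, Odd (φ u v + φ v u) ∧ Even (φ u' v + φ v u')) :
    |∑ D ∈ (tupSet J x).filter (fun D => (∀ j ∉ U, D j ≤ z) ∧ ∃ j ∉ U, D j ≠ 1),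
      wt N D * symb φ D| ≤
      48 * x * ((1 + Real.log (4 * z ^ Fintype.card J)) * 2 / Real.log x) ^ (1 / N : ℝ) *
        (1 + Real.log z) ^ Fintype.card J := by
  have hlogx : 0 < Real.log x := Real.log_pos (by exact_mod_cast hx)
  have hlogz : 0 ≤ 1 + Real.log (4 * (z : ℝ) ^ Fintype.card J) := by
    have h1 : (1 : ℝ) ≤ (z : ℝ) ^ Fintype.card J := one_le_pow₀ (by exact_mod_cast hz)
    have := Real.log_nonneg (show (1 : ℝ) ≤ 4 * (z : ℝ) ^ Fintype.card J by linarith)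
    linarith
  set T := (tupSet J x).filter (fun D => (∀ j ∉ U, D j ≤ z) ∧ ∃ j ∉ U, D j ≠ 1) with hTdef
  have hT : ∀ D ∈ T, D ∈ tupSet J x ∧ ∀ j ∉ U, D j ≤ z := fun D hD =>
    ⟨(mem_filter.1 hD).1, (mem_filter.1 hD).2.1⟩
  refine outer_sum_le U x z hz hzx T hT _ _ (by positivity) ?_
  intro E hE
  obtain ⟨D0, hD0, hD0E⟩ := mem_image.1 hE
  obtain ⟨hsq, hodd, -, hmz, hmx⟩ := offPart_facts U x z hz hzx (hT D0 hD0).1 (hT D0 hD0).2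
  obtain ⟨-, -, v, hvU, hv1⟩ := mem_filter.1 hD0
  have hEv : E v ≠ 1 := by rw [← hD0E]; simpa [offPart, hvU] using hv1
  rw [hD0E] at hsq hodd hmz hmx
  set m := ∏ j, E j with hm
  have hm1 : 1 ≤ m := hodd.pos
  obtain ⟨hy1, hylog⟩ := log_div_le hm1 hmx
  obtain ⟨u, huU, u', hu'U, hodduv, hevuv⟩ := hH v hvU
  have huu : u ≠ u' := by
    rintro rfl
    exact (Nat.not_even_iff_odd.2 hodduv) hevuv
  set F := T.filter fun D => offPart U D = E with hF
  set Q := ∏ s ∈ sepSet φ u u', E s with hQdef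
  have hvL : v ∈ sepSet φ u u' := by
    simp only [sepSet, mem_filter, mem_univ, true_and]
    exact hodduv.add_even hevuv
  have hQm : Q ∣ m := prod_dvd_prod_of_subset _ _ _ (subset_univ _)
  have hQ1 : Q ≠ 1 := by
    intro h
    have : E v ∣ Q := dvd_prod_of_mem E hvL
    rw [h] at this
    exact hEv (Nat.dvd_one.1 this)
  have hQn : ∀ ε, QNontrivial ε Q := fun ε =>
    QNontrivial.of_squarefree (hodd.of_dvd_nat hQm) (hsq.squarefree_of_dvd hQm) hQ1
  set mrg : (J → ℕ) → J → ℕ := fun D =>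
    Function.update (Function.update (onPart U D) u (D u * D u')) u' 1 with hmrg
  have hmrg_u : ∀ D, mrg D u = D u * D u' := fun D => by simp [hmrg, huu]
  have hmrg_u' : ∀ D, mrg D u' = 1 := fun D => by simp [hmrg]
  have hmrg_ne : ∀ D j, j ≠ u → j ≠ u' → mrg D j = onPart U D j := fun D j h1 h2 => by
    simp [hmrg, h1, h2]
  have hprod_mrg : ∀ D, ∏ j, mrg D j = ∏ j, onPart U D j := by
    intro D
    have e1 : onPart U D = Function.update (Function.update (onPart U D) u (D u)) u' (D u') := by
      ext j
      by_cases hj' : j = u'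
      · subst hj'; simp [onPart, hu'U]
      · by_cases hj : j = u
        · subst hj; simp [onPart, huU, hj']
        · simp [hj, hj']
    simp only [hmrg]
    have h1 := prod_update_two huu (onPart U D) (D u * D u') 1 (fun n => n) rfl
    have h2 := prod_update_two huu (onPart U D) (D u) (D u') (fun n => n) rfl
    rw [h1, mul_one, ← h2]
    exact prod_congr rfl fun j _ => (congrFun e1 j).symm
  set h : Bool → J → ℕ → ℝ := fun ε j p => if j = u then (1 + qchar ε Q p) / N else
    if j = u' then 0 else if j ∈ U then (1 / N : ℝ) else 0 with hh
  have hN0 : (0 : ℝ) < N := by positivity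
  have hχ : ∀ ε p, 0 ≤ 1 + qchar ε Q p := fun ε p => by
    have := (abs_le.1 (abs_qchar_le ε Q p)).1
    linarith
  have hh0 : ∀ ε j p, 0 ≤ h ε j p := by
    intro ε j p
    simp only [hh]
    split_ifs
    · exact div_nonneg (hχ ε p) hN0.le
    · exact le_rfl
    · positivity
    · exact le_rfl
  have hhsum : ∀ ε p, ∑ j, h ε j p = 1 - (1 - qchar ε Q p) / N := by
    intro ε p
    have e1 : ∀ j, h ε j p = (if j ∈ U then (1 / N : ℝ) else 0) +
        (if j = u then qchar ε Q p / N else 0) - (if j = u' then (1 / N : ℝ) else 0) := by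
      intro j
      simp only [hh]
      by_cases hj : j = u
      · subst hj; simp [huU, huu]; ring
      · by_cases hj' : j = u'
        · subst hj'; simp [hu'U, hj]
        · simp [hj, hj']
    simp only [e1]
    rw [sum_sub_distrib, sum_add_distrib]
    simp only [sum_ite_mem, univ_inter, sum_const, nsmul_eq_mul, hU, sum_ite_eq', mem_univ, if_true]
    field_simp
    ring
  -- the sum over one fibre of the merging map
  have hfib : ∀ D' ∈ F.image mrg, |∑ D ∈ F with mrg D = D', wt N D * symb φ D| ≤
      ∑ ε : Bool, ∏ j, ∏ p ∈ (D' j).primeFactors, h ε j p := by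
    intro D' hD'
    obtain ⟨D1, hD1, hD1D'⟩ := mem_image.1 hD'
    obtain ⟨hD1T, hD1E⟩ := mem_filter.1 hD1
    obtain ⟨hsq1, hmod1, hlt1⟩ := mem_tupSet.1 (hT D1 hD1T).1
    set G := Function.update (Function.update D1 u 1) u' 1 with hG
    have hGu : G u = 1 := by simp [hG, huu]
    have hGu' : G u' = 1 := by simp [hG]
    set l := D' u with hl
    have hl1 : l = D1 u * D1 u' := by rw [hl, ← hD1D', hmrg_u]
    have hprod1 : ∏ j, D1 j = l * ∏ j, G j := by
      have := prod_update_two huu D1 (D1 u) (D1 u') (fun n => n) rfl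
      rw [hl1, ← this]
      refine prod_congr rfl fun j _ => ?_
      by_cases hj' : j = u'
      · subst hj'; simp
      · by_cases hj : j = u
        · subst hj; simp [hj']
        · simp [hj']
    have hl0 : l ≠ 0 := by
      rintro h0
      rw [hprod1, h0, zero_mul] at hsq1
      exact not_squarefree_zero hsq1
    have hDG : ∀ D ∈ F, mrg D = D' → ∀ j, j ≠ u → j ≠ u' → D j = G j := by
      intro D hD hDD' j h1 h2
      have e0 : G j = D1 j := by simp [hG, h1, h2]
      rw [e0]
      by_cases hj : j ∈ U
      · have := congrFun (hDD'.trans hD1D'.symm) j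
        rw [hmrg_ne D j h1 h2, hmrg_ne D1 j h1 h2] at this
        simpa [onPart, hj] using this
      · have := congrFun ((mem_filter.1 hD).2.trans hD1E.symm) j
        simpa [offPart, hj] using this
    have hGE : ∀ s ∉ U, G s = E s := by
      intro s hs
      have h1 : s ≠ u := by rintro rfl; exact hs huU
      have h2 : s ≠ u' := by rintro rfl; exact hs hu'U
      have := congrFun hD1E s
      rw [← this]
      simp [hG, h1, h2, offPart, hs]
    have hLU : ∀ s ∈ sepSet φ u u', s ∉ U := by
      intro s hs hsU
      have h1 := hUe u huU s hsU
      have h2 := hUe u' hu'U s hsU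
      have := (mem_filter.1 hs).2
      exact (Nat.not_even_iff_odd.2 this) (h1.add h2)
    have hQG : ∏ s ∈ sepSet φ u u', G s = Q :=
      prod_congr rfl fun s hs => hGE s (hLU s hs)
    have hsum : ∑ D ∈ F with mrg D = D', wt N D * symb φ D =
        ∑ a ∈ l.divisors, wt N (Function.update (Function.update G u a) u' (l / a)) *
          symb φ (Function.update (Function.update G u a) u' (l / a)) := by
      have hDrec : ∀ D ∈ F, mrg D = D' →
          Function.update (Function.update G u (D u)) u' (l / D u) = D := by
        intro D hD hDD'
        have e1 : D u * D u' = l := by rw [← hmrg_u, hDD']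
        have e2 : D u ≠ 0 := by rintro h0; rw [h0, zero_mul] at e1; exact hl0 e1.symm
        ext j
        by_cases hj' : j = u'
        · subst hj'
          simp only [Function.update_self]
          rw [← e1, Nat.mul_div_cancel_left _ (Nat.pos_of_ne_zero e2)]
        · by_cases hj : j = u
          · subst hj; simp [hj']
          · simp only [Function.update_of_ne hj', Function.update_of_ne hj]
            exact (hDG D hD hDD' j hj hj').symm
      refine sum_nbij' (fun D => D u)
        (fun a => Function.update (Function.update G u a) u' (l / a)) ?_ ?_ ?_ ?_ ?_
      · intro D hD
        obtain ⟨hDF, hDD'⟩ := mem_filter.1 hD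
        rw [Nat.mem_divisors]
        refine ⟨?_, hl0⟩
        rw [hl, ← hDD', hmrg_u]
        exact dvd_mul_right _ _
      · intro a ha
        have hal := Nat.dvd_of_mem_divisors ha
        set D := Function.update (Function.update G u a) u' (l / a) with hD
        have hDu : D u = a := by simp [hD, huu]
        have hDu' : D u' = l / a := by simp [hD]
        have hDj : ∀ j, j ≠ u → j ≠ u' → D j = D1 j := fun j h1 h2 => by
          simp [hD, hG, h1, h2]
        have hprodD : ∏ j, D j = ∏ j, D1 j := by
          rw [hD, prod_update_two_self huu G hGu hGu', Nat.mul_div_cancel' hal, hprod1]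
        have hoffD : ∀ j ∉ U, D j = D1 j := fun j hj =>
          hDj j (by rintro rfl; exact hj huU) (by rintro rfl; exact hj hu'U)
        have hoff : offPart U D = E := by
          rw [← hD1E]
          ext j
          unfold offPart
          split_ifs with hj
          · rfl
          · exact hoffD j hj
        refine mem_filter.2 ⟨mem_filter.2 ⟨mem_filter.2 ⟨mem_tupSet.2 ?_, ?_, ?_⟩, hoff⟩, ?_⟩
        · rw [hprodD]; exact ⟨hsq1, hmod1, hlt1⟩
        · intro j hj
          rw [hoffD j hj]
          exact (hT D1 hD1T).2 j hj
        · obtain ⟨-, -, j, hj, hj1⟩ := mem_filter.1 hD1T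
          exact ⟨j, hj, by rw [hoffD j hj]; exact hj1⟩
        · rw [← hD1D']
          ext j
          by_cases hj' : j = u'
          · subst hj'; rw [hmrg_u', hmrg_u']
          · by_cases hj : j = u
            · subst hj
              rw [hmrg_u, hmrg_u, hDu, hDu', Nat.mul_div_cancel' hal, hl1]
            · rw [hmrg_ne _ j hj hj', hmrg_ne _ j hj hj']
              unfold onPart
              split_ifs
              · exact hDj j hj hj'
              · rfl
      · intro D hD
        obtain ⟨hDF, hDD'⟩ := mem_filter.1 hD
        exact hDrec D hDF hDD'
      · intro a _
        simp [huu]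
      · intro D hD
        obtain ⟨hDF, hDD'⟩ := mem_filter.1 hD
        rw [hDrec D hDF hDD']
    rw [hsum]
    refine (split_inner_le φ hφ N huu (hUe u huU u' hu'U) G l hGu hGu' (hprod1 ▸ hsq1)
      (by rw [← hprod1, Nat.odd_iff]; omega)).trans ?_
    rw [hQG, mul_sum]
    refine sum_le_sum fun ε _ => ?_
    have hR : ∏ j, ∏ p ∈ (D' j).primeFactors, h ε j p =
        (∏ p ∈ l.primeFactors, (1 + qchar ε Q p) / N) *
          ∏ j ∈ univ.erase u, ∏ p ∈ (D' j).primeFactors, h ε j p := by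
      rw [← mul_prod_erase univ _ (mem_univ u)]
      congr 1
      refine prod_congr rfl fun p _ => ?_
      simp [hh]
    have hW : wt N G = ∏ j ∈ univ.erase u, ∏ _p ∈ (G j).primeFactors, (1 / N : ℝ) := by
      unfold wt
      rw [← mul_prod_erase univ _ (mem_univ u), hGu]
      simp
    have hWle : wt N G ≤ ∏ j ∈ univ.erase u, ∏ p ∈ (D' j).primeFactors, h ε j p := by
      rw [hW]
      refine prod_le_prod (fun j _ => prod_nonneg fun _ _ => by positivity) fun j hj => ?_
      have hju := (mem_erase.1 hj).1
      by_cases hju' : j = u'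
      · subst hju'
        rw [← hD1D', hmrg_u', hGu']
        simp
      · by_cases hjU : j ∈ U
        · have e1 : D' j = G j := by
            rw [← hD1D', hmrg_ne _ j hju hju']
            simp [onPart, hjU, hG, hju, hju']
          rw [e1]
          refine le_of_eq (prod_congr rfl fun p _ => ?_)
          simp [hh, hju, hju', hjU]
        · have e1 : D' j = 1 := by
            rw [← hD1D', hmrg_ne _ j hju hju']
            simp [onPart, hjU]
          rw [e1]
          simp only [Nat.primeFactors_one, prod_empty]
          exact (le_abs_self _).trans (abs_wt_factor_le N (G j))
    rw [hR, mul_assoc, ← prod_mul_distrib, mul_comm]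
    have e2 : ∏ p ∈ l.primeFactors, (1 / N * (1 + qchar ε Q p) : ℝ) =
        ∏ p ∈ l.primeFactors, (1 + qchar ε Q p) / N :=
      prod_congr rfl fun p _ => by ring
    rw [e2]
    exact mul_le_mul_of_nonneg_left hWle (prod_nonneg fun p _ => div_nonneg (hχ ε p) hN0.le)
  have hm0 : (0 : ℝ) < m := by exact_mod_cast hm1
  have hylow : (0 : ℝ) < 1 + Real.log ((x / m : ℕ) : ℝ) := by linarith
  have hQ0 : (0 : ℝ) < Q := by exact_mod_cast Nat.pos_of_dvd_of_pos hQm hm1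
  have hQz : (Q : ℝ) ≤ (z : ℝ) ^ Fintype.card J := by
    exact_mod_cast (Nat.le_of_dvd hm1 hQm).trans hmz
  have hQ1' : (1 : ℝ) ≤ Q := by exact_mod_cast Nat.pos_of_dvd_of_pos hQm hm1
  have hQlog : 0 ≤ Real.log (4 * Q) := Real.log_nonneg (by linarith)
  have hε : ∀ ε : Bool, ∑ D' ∈ F.image mrg, ∏ j, ∏ p ∈ (D' j).primeFactors, h ε j p ≤
      24 * (x / m) *
        ((1 + Real.log (4 * (z : ℝ) ^ Fintype.card J)) * 2 / Real.log x) ^ (1 / N : ℝ) := by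
    intro ε
    calc _ ≤ ∑ n ∈ (Icc 1 (x / m)).filter Squarefree, ∏ p ∈ n.primeFactors, ∑ j, h ε j p := by
          refine sum_prod_le_sum_squarefree (h ε) (hh0 ε) _ _ ?_
          intro D' hD'
          obtain ⟨D, hD, rfl⟩ := mem_image.1 hD'
          obtain ⟨h1, h2⟩ := mem_filter.1 hD
          rw [hprod_mrg]
          exact prod_onPart_le hm1 U (hT D h1).1 (by rw [h2])
      _ = ∑ n ∈ (Icc 1 (x / m)).filter Squarefree,
          ∏ p ∈ n.primeFactors, (1 - (1 - qchar ε Q p) / N) := by simp only [hhsum]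
      _ ≤ 24 * ((x / m : ℕ) : ℝ) * ((1 + Real.log (4 * Q)) /
          (1 + Real.log ((x / m : ℕ) : ℝ))) ^ (1 / N : ℝ) :=
          sum_squarefree_qchar_le (hQn ε) N hN _ hy1
      _ ≤ _ := by
          gcongr 24 * ?_ * ?_ ^ _
          · exact Nat.cast_div_le
          · rw [mul_div_assoc, div_eq_mul_inv]
            gcongr
            rw [inv_le_comm₀ hylow (by positivity), inv_div]
            exact hylog
  calc _ = |∑ D' ∈ F.image mrg, ∑ D ∈ F with mrg D = D', wt N D * symb φ D| := by
        rw [sum_fiberwise_of_maps_to (fun D hD => mem_image_of_mem mrg hD)]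
    _ ≤ ∑ D' ∈ F.image mrg, ∑ ε : Bool, ∏ j, ∏ p ∈ (D' j).primeFactors, h ε j p :=
        (abs_sum_le_sum_abs _ _).trans (sum_le_sum hfib)
    _ = ∑ ε : Bool, ∑ D' ∈ F.image mrg, ∏ j, ∏ p ∈ (D' j).primeFactors, h ε j p :=
        Finset.sum_comm
    _ ≤ ∑ _ε : Bool, 24 * (x / m) *
        ((1 + Real.log (4 * (z : ℝ) ^ Fintype.card J)) * 2 / Real.log x) ^ (1 / N : ℝ) :=
        sum_le_sum fun ε _ => hε ε
    _ = _ := by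
        rw [Fintype.sum_bool, hm, Nat.cast_prod]; ring

end OuterSums

section MainSum

variable {J : Type*} [Fintype J] [DecidableEq J]

/-- The indices at which a tuple exceeds `z`. -/
def bigPart (z : ℕ) (D : J → ℕ) : Finset J := univ.filter fun u => z < D u

theorem mem_bigPart {z : ℕ} {D : J → ℕ} {u : J} : u ∈ bigPart z D ↔ z < D u := by
  simp [bigPart]

/-- The colours `u` and `v` are pairwise unlinked throughout `U`. -/
def Unlinked (φ : J → J → ℕ) (U : Finset J) : Prop := ∀ u ∈ U, ∀ v ∈ U, Even (φ u v + φ v u)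

/-- Bound for the contribution of two large linked coordinates. -/
def linkedErr (J : Type*) [Fintype J] (x w : ℕ) : ℝ :=
  24 * x * (1 + Real.log x) ^ (Fintype.card J + 5) / w

/-- Bound for the contribution of tuples with few large coordinates. -/
def fewErr (J : Type*) [Fintype J] (N x z : ℕ) : ℝ :=
  24 * x * (2 / Real.log x) ^ (1 / N : ℝ) * (1 + Real.log z) ^ Fintype.card J

/-- Bound for the contribution of tuples with a nontrivial small coordinate. -/
def splitErr (J : Type*) [Fintype J] (N x z : ℕ) : ℝ :=
  48 * x * ((1 + Real.log (4 * z ^ Fintype.card J)) * 2 / Real.log x) ^ (1 / N : ℝ) *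
    (1 + Real.log z) ^ Fintype.card J

theorem linkedErr_nonneg (x w : ℕ) : 0 ≤ linkedErr J x w := by
  have := Real.log_natCast_nonneg x
  unfold linkedErr; positivity

theorem fewErr_nonneg (N x z : ℕ) : 0 ≤ fewErr J N x z := by
  have := Real.log_natCast_nonneg x
  have := Real.log_natCast_nonneg z
  unfold fewErr; positivity

theorem splitErr_nonneg (N x : ℕ) {z : ℕ} (hz : 1 ≤ z) : 0 ≤ splitErr J N x z := by
  have := Real.log_natCast_nonneg x
  have := Real.log_natCast_nonneg z
  have h1 : (1 : ℝ) ≤ (z : ℝ) ^ Fintype.card J := one_le_pow₀ (by exact_mod_cast hz)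
  have := Real.log_nonneg (show (1 : ℝ) ≤ 4 * (z : ℝ) ^ Fintype.card J by linarith)
  unfold splitErr; positivity

theorem abs_wt_mul_symb_le (φ : J → J → ℕ) (N : ℕ) (D : J → ℕ) :
    |wt N D * symb φ D| ≤ wt N D := by
  rw [abs_mul, abs_of_nonneg (wt_nonneg N D)]
  exact mul_le_of_le_one_right (wt_nonneg N D) (abs_symb_le φ D)

theorem sum_small_off_eq (F : (J → ℕ) → ℝ) (U : Finset J) (x z : ℕ) :
    ∑ D ∈ (tupSet J x).filter (fun D => ∀ j ∉ U, D j ≤ z), F D =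
      ∑ D ∈ (tupSet J x).filter (fun D => bigPart z D = U), F D +
      ∑ V ∈ U.powerset.filter (fun V => V ≠ U),
        ∑ D ∈ (tupSet J x).filter (fun D => bigPart z D = V), F D := by
  rw [← sum_fiberwise_of_maps_to (g := bigPart z) (t := U.powerset),
    ← sum_filter_add_sum_filter_not U.powerset (fun V => V = U)]
  · have key : ∀ V ⊆ U, ((tupSet J x).filter (fun D => ∀ j ∉ U, D j ≤ z)).filter
        (fun D => bigPart z D = V) = (tupSet J x).filter (fun D => bigPart z D = V) := by
      intro V hV
      rw [filter_filter]
      refine filter_congr fun D _ => ⟨fun h => h.2, fun h => ⟨fun j hj => ?_, h⟩⟩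
      by_contra hc
      exact hj (hV (h ▸ mem_bigPart.2 (not_le.1 hc)))
    congr 1
    · rw [show U.powerset.filter (fun V => V = U) = {U} by
        ext V
        simp only [mem_filter, mem_powerset, mem_singleton, and_iff_right_iff_imp]
        rintro rfl
        exact Subset.rfl, sum_singleton, key U Subset.rfl]
    · refine sum_congr rfl fun V hV => ?_
      rw [key V (mem_powerset.1 (mem_filter.1 hV).1)]
  · intro D hD
    rw [mem_powerset]
    intro j hj
    by_contra hc
    have := (mem_filter.1 hD).2 j hc
    rw [mem_bigPart] at hj
    omega

theorem sum_small_off_eq' (F : (J → ℕ) → ℝ) (U : Finset J) (x : ℕ) {z : ℕ} (hz : 1 ≤ z) :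
    ∑ D ∈ (tupSet J x).filter (fun D => ∀ j ∉ U, D j ≤ z), F D =
      ∑ D ∈ (tupSet J x).filter (fun D => ∀ j ∉ U, D j = 1), F D +
      ∑ D ∈ (tupSet J x).filter (fun D => (∀ j ∉ U, D j ≤ z) ∧ ∃ j ∉ U, D j ≠ 1), F D := by
  rw [← sum_filter_add_sum_filter_not _ (fun D => ∀ j ∉ U, D j = 1), filter_filter,
    filter_filter]
  congr 1
  · refine sum_congr (filter_congr fun D _ => ⟨fun h => h.2, fun h => ⟨fun j hj => ?_, h⟩⟩)
      fun _ _ => rfl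
    rw [h j hj]; exact hz
  · refine sum_congr (filter_congr fun D _ => ?_) fun _ _ => rfl
    push Not
    exact Iff.rfl

theorem bigPart_sum_linked_le (φ : J → J → ℕ) (hφ : ∀ u, φ u u = 0) (N : ℕ)
    (P : Finset J → Prop) (x w : ℕ) (hx : 2 ≤ x) (hw : 1 ≤ w)
    (U : Finset J) (hU : ¬ Unlinked φ U) :
    |∑ D ∈ (tupSet J x).filter
        (fun D => P (univ.filter fun j => D j ≠ 1) ∧ bigPart (w ^ 16) D = U),
          wt N D * symb φ D| ≤ linkedErr J x w := by
  have hz : 1 ≤ w ^ 16 := Nat.one_le_pow _ _ hw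
  unfold Unlinked at hU
  push Not at hU
  obtain ⟨u, hu, v, hv, huv⟩ := hU
  rw [Nat.not_even_iff_odd] at huv
  have hne : u ≠ v := by
    rintro rfl
    rw [hφ] at huv
    exact absurd huv (by decide)
  have hset : (tupSet J x).filter
      (fun D => P (univ.filter fun j => D j ≠ 1) ∧ bigPart (w ^ 16) D = U) =
      (tupSet J x).filter (fun D =>
        (fun E : J → ℕ => P (insert u (insert v (univ.filter fun j => E j ≠ 1))) ∧
          insert u (insert v (bigPart (w ^ 16) E)) = U)
            (Function.update (Function.update D u 1) v 1) ∧ w ^ 16 < D u ∧ w ^ 16 < D v) := by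
    refine filter_congr fun D _ => ?_
    have e1 : w ^ 16 < D u → w ^ 16 < D v →
        insert u (insert v (univ.filter fun j =>
          Function.update (Function.update D u 1) v 1 j ≠ 1)) =
        univ.filter fun j => D j ≠ 1 := by
      intro h h'
      ext j
      simp only [mem_insert, mem_filter, mem_univ, true_and]
      by_cases hju : j = u
      · subst hju; simp; omega
      by_cases hjv : j = v
      · subst hjv; simp; omega
      simp [hju, hjv]
    have e2 : w ^ 16 < D u → w ^ 16 < D v →
        insert u (insert v (bigPart (w ^ 16) (Function.update (Function.update D u 1) v 1))) =
        bigPart (w ^ 16) D := by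
      intro h h'
      ext j
      simp only [mem_insert, mem_bigPart]
      by_cases hju : j = u
      · subst hju; simp [h]
      by_cases hjv : j = v
      · subst hjv; simp [h']
      simp [hju, hjv]
    constructor
    · rintro ⟨h, hb⟩
      have hDu := mem_bigPart.1 (hb ▸ hu)
      have hDv := mem_bigPart.1 (hb ▸ hv)
      refine ⟨⟨?_, ?_⟩, hDu, hDv⟩
      · rw [e1 hDu hDv]; exact h
      · rw [e2 hDu hDv]; exact hb
    · rintro ⟨⟨h, hb⟩, hDu, hDv⟩
      rw [e1 hDu hDv] at h
      rw [e2 hDu hDv] at hb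
      exact ⟨h, hb⟩
  rw [hset]
  have := linked_sum_le φ hφ N hne huv x w (by omega) hw
    (fun E : J → ℕ => P (insert u (insert v (univ.filter fun j => E j ≠ 1))) ∧
          insert u (insert v (bigPart (w ^ 16) E)) = U)
  unfold linkedErr
  convert this

theorem bigPart_sum_few_le (φ : J → J → ℕ) (N : ℕ) (hN : 2 ≤ N) (x z : ℕ)
    (hx : 2 ≤ x) (hz : 1 ≤ z) (hzx : z ^ (2 * Fintype.card J) ≤ x) (U : Finset J)
    (hU : U.card < N) (Q : (J → ℕ) → Prop) :
    |∑ D ∈ (tupSet J x).filter (fun D => Q D ∧ bigPart z D = U), wt N D * symb φ D| ≤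
      fewErr J N x z := by
  refine few_large_sum_le N hN U hU x _ hx hz hzx _ ?_ _ (abs_wt_mul_symb_le φ N)
  intro D hD
  obtain ⟨hD, -, hb⟩ := mem_filter.1 hD
  refine ⟨hD, fun j hj => ?_⟩
  rw [← hb, mem_bigPart] at hj
  omega

theorem bigPart_sum_main_le (φ : J → J → ℕ) (hφ : ∀ u, φ u u = 0) (N : ℕ) (hN : 2 ≤ N)
    (x z : ℕ) (hx : 2 ≤ x) (hz : 1 ≤ z) (hzx : z ^ (2 * Fintype.card J) ≤ x)
    (U : Finset J) (hU : Unlinked φ U) (hc : U.card = N)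
    (h2 : ∀ v ∉ U, ∃ u ∈ U, ∃ u' ∈ U, Odd (φ u v + φ v u) ∧ Even (φ u' v + φ v u')) :
    |∑ D ∈ (tupSet J x).filter (fun D => bigPart z D = U), wt N D * symb φ D -
        ∑ D ∈ (tupSet J x).filter (fun D => ∀ j ∉ U, D j = 1), wt N D * symb φ D| ≤
    2 ^ Fintype.card J * fewErr J N x z + splitErr J N x z := by
  have hf0 := fewErr_nonneg (J := J) N x z
  have hA1 := sum_small_off_eq (fun D => wt N D * symb φ D) U x z
  have hA2 := sum_small_off_eq' (fun D => wt N D * symb φ D) U x hz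
  have hsplit := pair_split_sum_le φ hφ N hN U hc hU x z hx hz hzx h2
  have hrest : |∑ V ∈ U.powerset.filter (fun V => V ≠ U),
      ∑ D ∈ (tupSet J x).filter (fun D => bigPart z D = V), wt N D * symb φ D| ≤
      2 ^ Fintype.card J * fewErr J N x z := by
    refine (abs_sum_le_sum_abs _ _).trans
      ((sum_le_card_nsmul _ _ (fewErr J N x z) ?_).trans ?_)
    · intro V hV
      obtain ⟨hsub, hne⟩ := mem_filter.1 hV
      have := bigPart_sum_few_le φ N hN x z hx hz hzx V
        (hc ▸ card_lt_card (lt_of_le_of_ne (mem_powerset.1 hsub) hne)) (fun _ => True)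
      simpa only [true_and] using this
    · rw [nsmul_eq_mul]
      refine mul_le_mul_of_nonneg_right ?_ hf0
      have : (U.powerset.filter (fun V => V ≠ U)).card ≤ 2 ^ Fintype.card J := by
        refine (card_le_univ _).trans ?_
        rw [Fintype.card_finset]
      exact_mod_cast this
  have e := hA1.symm.trans hA2
  have hsub : ∀ a b c d : ℝ, a + b = c + d → a - c = d - b := by intros; linarith
  rw [hsub _ _ _ _ e]
  refine (abs_sub _ _).trans ?_
  unfold splitErr
  linarith

theorem bigPart_sum_le (φ : J → J → ℕ) (hφ : ∀ u, φ u u = 0) (N : ℕ) (hN : 2 ≤ N)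
    (P : Finset J → Prop)
    (h1 : ∀ U, Unlinked φ U → U.card ≤ N)
    (h2 : ∀ U, Unlinked φ U → U.card = N →
      ∀ v ∉ U, ∃ u ∈ U, ∃ u' ∈ U, Odd (φ u v + φ v u) ∧ Even (φ u' v + φ v u'))
    (h3 : ∀ U, Unlinked φ U → U.card = N → ∀ V, U ⊆ V → P V)
    (x w : ℕ) (hx : 2 ≤ x) (hw : 1 ≤ w) (hwx : (w ^ 16) ^ (2 * Fintype.card J) ≤ x)
    (U : Finset J) :
    |∑ D ∈ (tupSet J x).filter
        (fun D => P (univ.filter fun j => D j ≠ 1) ∧ bigPart (w ^ 16) D = U),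
          wt N D * symb φ D -
      if Unlinked φ U ∧ U.card = N then
        ∑ D ∈ (tupSet J x).filter (fun D => ∀ j ∉ U, D j = 1), wt N D * symb φ D
      else 0| ≤
    linkedErr J x w + 2 ^ Fintype.card J * fewErr J N x (w ^ 16) +
      splitErr J N x (w ^ 16) := by
  have hz : 1 ≤ w ^ 16 := Nat.one_le_pow _ _ hw
  have hl0 := linkedErr_nonneg (J := J) x w
  have hf0 := fewErr_nonneg (J := J) N x (w ^ 16)
  have hs0 := splitErr_nonneg (J := J) N x hz
  have h0 : 0 ≤ (2 : ℝ) ^ Fintype.card J * fewErr J N x (w ^ 16) := by positivity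
  by_cases hU : Unlinked φ U
  · rcases (h1 U hU).lt_or_eq with hlt | heq
    · rw [if_neg (fun h => hlt.ne h.2), sub_zero]
      have hpow : (1 : ℝ) ≤ 2 ^ Fintype.card J := one_le_pow₀ (by norm_num)
      have := bigPart_sum_few_le φ N hN x _ hx hz hwx U hlt
        (fun D => P (univ.filter fun j => D j ≠ 1))
      nlinarith
    · rw [if_pos ⟨hU, heq⟩]
      have hS : (tupSet J x).filter
          (fun D => P (univ.filter fun j => D j ≠ 1) ∧ bigPart (w ^ 16) D = U) =
          (tupSet J x).filter (fun D => bigPart (w ^ 16) D = U) := by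
        refine filter_congr fun D _ => and_iff_right_of_imp fun hb => ?_
        refine h3 U hU heq _ fun u hu => ?_
        rw [← hb, mem_bigPart] at hu
        simp only [mem_filter, mem_univ, true_and]
        omega
      rw [hS]
      have := bigPart_sum_main_le φ hφ N hN x _ hx hz hwx U hU heq (h2 U hU heq)
      linarith
  · rw [if_neg (fun h => hU h.1), sub_zero]
    have := bigPart_sum_linked_le φ hφ N P x w hx hw U hU
    linarith

theorem unlinked_main_sum_le (φ : J → J → ℕ) (hφ : ∀ u, φ u u = 0) (N : ℕ) (hN : 2 ≤ N)
    (P : Finset J → Prop)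
    (h1 : ∀ U, Unlinked φ U → U.card ≤ N)
    (h2 : ∀ U, Unlinked φ U → U.card = N →
      ∀ v ∉ U, ∃ u ∈ U, ∃ u' ∈ U, Odd (φ u v + φ v u) ∧ Even (φ u' v + φ v u'))
    (h3 : ∀ U, Unlinked φ U → U.card = N → ∀ V, U ⊆ V → P V)
    (x w : ℕ) (hx : 2 ≤ x) (hw : 1 ≤ w) (hwx : (w ^ 16) ^ (2 * Fintype.card J) ≤ x) :
    |∑ D ∈ (tupSet J x).filter (fun D => P (univ.filter fun j => D j ≠ 1)),
          wt N D * symb φ D -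
      ∑ U ∈ univ.filter (fun U : Finset J => Unlinked φ U ∧ U.card = N),
        ∑ D ∈ (tupSet J x).filter (fun D => ∀ j ∉ U, D j = 1), wt N D * symb φ D| ≤
    2 ^ Fintype.card J * (linkedErr J x w + 2 ^ Fintype.card J * fewErr J N x (w ^ 16) +
      splitErr J N x (w ^ 16)) := by
  rw [sum_filter (s := (univ : Finset (Finset J))),
    ← sum_fiberwise_of_maps_to (g := bigPart (w ^ 16)) (t := univ) (fun _ _ => mem_univ _),
    ← sum_sub_distrib]
  refine (abs_sum_le_sum_abs _ _).trans ((sum_le_card_nsmul _ _ (linkedErr J x w +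
    2 ^ Fintype.card J * fewErr J N x (w ^ 16) + splitErr J N x (w ^ 16)) fun U _ => ?_).trans ?_)
  · rw [filter_filter]
    exact bigPart_sum_le φ hφ N hN P h1 h2 h3 x w hx hw hwx U
  · rw [nsmul_eq_mul, card_univ, Fintype.card_finset]
    push_cast
    exact le_rfl

end MainSum

section MainSumAsymptotic

variable {J : Type*} [Fintype J] [DecidableEq J]

theorem tendsto_log_natCast : Tendsto (fun x : ℕ => Real.log x) atTop atTop :=
  Real.tendsto_log_atTop.comp tendsto_natCast_atTop_atTop

theorem tendsto_pow_log_one_div (n : ℕ) (K : ℝ) :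
    Tendsto (fun L : ℝ => (K * (1 + Real.log L)) ^ n / L) atTop (nhds 0) := by
  have h := Real.tendsto_pow_log_div_mul_add_atTop (Real.exp (-1)) 0 n (Real.exp_pos _).ne'
  have h2 : Tendsto (fun L : ℝ => Real.exp 1 * L) atTop atTop :=
    tendsto_id.const_mul_atTop (Real.exp_pos 1)
  have h3 := (h.comp h2).const_mul (K ^ n)
  rw [mul_zero] at h3
  refine h3.congr' ?_
  filter_upwards [eventually_gt_atTop 0] with L hL
  simp only [Function.comp]
  rw [Real.log_mul (Real.exp_pos 1).ne' hL.ne', Real.log_exp, add_zero, ← mul_assoc,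
    ← Real.exp_add, mul_pow]
  norm_num
  ring

theorem fewErr_le_splitErr (N x z : ℕ) (hx : 1 ≤ x) (hz : 1 ≤ z) :
    fewErr J N x z ≤ splitErr J N x z := by
  have hlx := Real.log_natCast_nonneg x
  have hlz := Real.log_natCast_nonneg z
  have h1 : (1 : ℝ) ≤ (z : ℝ) ^ Fintype.card J := one_le_pow₀ (by exact_mod_cast hz)
  have hl := Real.log_nonneg (show (1 : ℝ) ≤ 4 * (z : ℝ) ^ Fintype.card J by linarith)
  unfold fewErr splitErr
  gcongr
  · norm_num
  · linarith

theorem error_tendsto_zero (N : ℕ) (hN : 1 ≤ N) :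
    ∃ w : ℕ → ℕ, (∀ᶠ x in atTop, 1 ≤ w x ∧ (w x ^ 16) ^ (2 * Fintype.card J) ≤ x) ∧
      Tendsto (fun x : ℕ => 2 ^ Fintype.card J * (linkedErr J x (w x) +
        2 ^ Fintype.card J * fewErr J N x (w x ^ 16) + splitErr J N x (w x ^ 16)) / (x : ℝ))
        atTop (nhds 0) := by
  set c := Fintype.card J with hc
  set m := c + 6 with hm
  set w : ℕ → ℕ := fun x => ⌈Real.log x ^ m⌉₊ with hw
  have hL1 : ∀ᶠ x : ℕ in atTop, 1 ≤ Real.log x := tendsto_log_natCast.eventually_ge_atTop 1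
  have hlow : ∀ x : ℕ, Real.log x ^ m ≤ w x := fun x => Nat.le_ceil _
  have hup : ∀ x : ℕ, 1 ≤ Real.log x → (w x : ℝ) ≤ 2 * Real.log x ^ m := by
    intro x hx
    have h1 : 1 ≤ Real.log x ^ m := one_le_pow₀ hx
    have := Nat.ceil_lt_add_one (zero_le_one.trans h1)
    simp only [hw]
    linarith
  have hw1 : ∀ x : ℕ, 1 ≤ Real.log x → 1 ≤ w x := by
    intro x hx
    have h1 : 1 ≤ Real.log x ^ m := one_le_pow₀ hx
    exact_mod_cast h1.trans (hlow x)
  refine ⟨w, ?_, ?_⟩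
  · have h := (Real.tendsto_pow_log_div_mul_add_atTop 1 0 (m * (16 * (2 * c))) one_ne_zero).comp
      tendsto_natCast_atTop_atTop
    have h2 := (h.const_mul ((2 : ℝ) ^ (16 * (2 * c))))
    rw [mul_zero] at h2
    filter_upwards [hL1, h2.eventually (gt_mem_nhds one_pos), eventually_ge_atTop 1]
      with x hx hlt hx1
    refine ⟨hw1 x hx, ?_⟩
    have hxp : (0 : ℝ) < x := by exact_mod_cast hx1
    simp only [Function.comp, one_mul, add_zero] at hlt
    rw [← mul_div_assoc, div_lt_one hxp, pow_mul (Real.log x), ← mul_pow] at hlt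
    have : ((w x : ℝ) ^ 16) ^ (2 * c) ≤ x := by
      rw [← pow_mul]
      exact (pow_le_pow_left₀ (Nat.cast_nonneg _) (hup x hx) _).trans hlt.le
    exact_mod_cast this
  · set K : ℝ := 16 * m + 17 with hK
    have hl : Tendsto (fun x : ℕ => 24 * 2 ^ (c + 5) / Real.log x) atTop (nhds 0) :=
      tendsto_const_nhds.div_atTop tendsto_log_natCast
    have hs : Tendsto (fun x : ℕ => 48 * (2 * (c + 3) * ((K * (1 + Real.log (Real.log x))) ^
        (c * N + 1) / Real.log x)) ^ (1 / N : ℝ)) atTop (nhds 0) := by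
      have h1 := ((tendsto_pow_log_one_div (c * N + 1) K).comp tendsto_log_natCast).const_mul
        (2 * ((c : ℝ) + 3))
      rw [mul_zero] at h1
      have hNp : 0 < 1 / (N : ℝ) := by positivity
      have h2 := (h1.rpow_const (p := 1 / (N : ℝ)) (Or.inr hNp.le)).const_mul 48
      rw [Real.zero_rpow hNp.ne', mul_zero] at h2
      exact h2
    have hall := (hl.add (hs.const_mul ((2 : ℝ) ^ c + 1))).const_mul ((2 : ℝ) ^ c)
    simp only [mul_zero, add_zero] at hall
    refine squeeze_zero' ?_ ?_ hall
    · filter_upwards [hL1] with x hx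
      have h1 := linkedErr_nonneg (J := J) x (w x)
      have h2 := fewErr_nonneg (J := J) N x (w x ^ 16)
      have h3 := splitErr_nonneg (J := J) N x (Nat.one_le_pow 16 _ (hw1 x hx))
      positivity
    · filter_upwards [hL1, eventually_ge_atTop 1] with x hx hx1
      have hxp : (0 : ℝ) < x := by exact_mod_cast hx1
      set L := Real.log x with hL
      have hz1 := Nat.one_le_pow 16 _ (hw1 x hx)
      have hwpos : (0 : ℝ) < w x := by exact_mod_cast hw1 x hx
      have hlogL : 0 ≤ Real.log L := Real.log_nonneg hx
      have hlink : linkedErr J x (w x) ≤ x * (24 * 2 ^ (c + 5) / L) := by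
        unfold linkedErr
        rw [← hc, ← hL, mul_div_assoc', div_le_div_iff₀ hwpos (by linarith)]
        have h1 : (1 + L) ^ (c + 5) ≤ (2 * L) ^ (c + 5) :=
          pow_le_pow_left₀ (by linarith) (by linarith) _
        calc 24 * x * (1 + L) ^ (c + 5) * L ≤ 24 * x * (2 * L) ^ (c + 5) * L := by gcongr
          _ = x * (24 * 2 ^ (c + 5)) * L ^ m := by rw [hm, mul_pow]; ring
          _ ≤ x * (24 * 2 ^ (c + 5)) * w x := by gcongr; exact hlow x
      set A := K * (1 + Real.log L) with hA
      have hlw : Real.log (w x) ≤ 1 + m * Real.log L := by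
        refine (Real.log_le_log hwpos (hup x hx)).trans ?_
        rw [Real.log_mul two_ne_zero (by positivity), Real.log_pow]
        have := Real.log_two_lt_d9
        linarith
      have hlz : Real.log ((w x ^ 16 : ℕ) : ℝ) = 16 * Real.log (w x) := by
        push_cast
        rw [Real.log_pow]; norm_num
      have hlz0 : 0 ≤ Real.log ((w x ^ 16 : ℕ) : ℝ) := Real.log_natCast_nonneg _
      have hAz : 1 + Real.log ((w x ^ 16 : ℕ) : ℝ) ≤ A := by
        rw [hlz, hA, hK]
        nlinarith
      have hA1 : 1 ≤ A := by linarith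
      have hAc : 1 + Real.log (4 * ((w x ^ 16 : ℕ) : ℝ) ^ c) ≤ (c + 3) * A := by
        rw [Real.log_mul four_ne_zero (by positivity), Real.log_pow,
          show (4 : ℝ) = 2 ^ 2 by norm_num, Real.log_pow]
        have := Real.log_two_lt_d9
        have h2 : (c : ℝ) * Real.log ((w x ^ 16 : ℕ) : ℝ) ≤ c * A :=
          mul_le_mul_of_nonneg_left (by linarith) (Nat.cast_nonneg c)
        push_cast at *
        linarith
      have hA0 : 0 ≤ 1 + Real.log (4 * ((w x ^ 16 : ℕ) : ℝ) ^ c) := by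
        have h1 : (1 : ℝ) ≤ ((w x ^ 16 : ℕ) : ℝ) ^ c := one_le_pow₀ (by exact_mod_cast hz1)
        have := Real.log_nonneg (show (1 : ℝ) ≤ 4 * ((w x ^ 16 : ℕ) : ℝ) ^ c by linarith)
        linarith
      have hsp : splitErr J N x (w x ^ 16) ≤
          x * (48 * (2 * (c + 3) * (A ^ (c * N + 1) / L)) ^ (1 / N : ℝ)) := by
        have hNp : (0 : ℝ) < 1 / (N : ℝ) := by positivity
        have e : (2 * (c + 3) * (A ^ (c * N + 1) / L)) ^ (1 / N : ℝ) =
            ((c + 3) * A * 2 / L) ^ (1 / N : ℝ) * A ^ c := by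
          have hApos : 0 < A := by linarith
          rw [show 2 * ((c : ℝ) + 3) * (A ^ (c * N + 1) / L) =
            ((c + 3) * A * 2 / L) * (A ^ c) ^ N by ring,
            Real.mul_rpow (by positivity) (by positivity), one_div,
            Real.pow_rpow_inv_natCast (by positivity) (by omega)]
        rw [e]
        unfold splitErr
        rw [← hc, ← hL]
        calc _ ≤ 48 * x * ((c + 3) * A * 2 / L) ^ (1 / N : ℝ) * A ^ c := by
              gcongr
          _ = _ := by ring
      have hfs := fewErr_le_splitErr (J := J) N x (w x ^ 16) hx1 hz1
      rw [div_le_iff₀ hxp]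
      set S := 48 * (2 * (c + 3) * (A ^ (c * N + 1) / L)) ^ (1 / N : ℝ) with hS
      calc _ ≤ 2 ^ c * (x * (24 * 2 ^ (c + 5) / L) + 2 ^ c * (x * S) + x * S) := by
            gcongr
            exact hfs.trans hsp
        _ = _ := by ring

theorem tendsto_unlinked_main_sum (φ : J → J → ℕ) (hφ : ∀ u, φ u u = 0) (N : ℕ) (hN : 2 ≤ N)
    (P : Finset J → Prop)
    (h1 : ∀ U, Unlinked φ U → U.card ≤ N)
    (h2 : ∀ U, Unlinked φ U → U.card = N →
      ∀ v ∉ U, ∃ u ∈ U, ∃ u' ∈ U, Odd (φ u v + φ v u) ∧ Even (φ u' v + φ v u'))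
    (h3 : ∀ U, Unlinked φ U → U.card = N → ∀ V, U ⊆ V → P V) :
    Tendsto (fun x : ℕ =>
      (∑ D ∈ (tupSet J x).filter (fun D => P (univ.filter fun j => D j ≠ 1)),
          wt N D * symb φ D -
        ∑ U ∈ univ.filter (fun U : Finset J => Unlinked φ U ∧ U.card = N),
          ∑ D ∈ (tupSet J x).filter (fun D => ∀ j ∉ U, D j = 1), wt N D * symb φ D) / (x : ℝ))
      atTop (nhds 0) := by
  obtain ⟨w, hw, hlim⟩ := error_tendsto_zero (J := J) N (by omega)
  refine squeeze_zero_norm' ?_ hlim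
  filter_upwards [hw, eventually_ge_atTop 2] with x hwx hx
  rw [Real.norm_eq_abs, abs_div, Nat.abs_cast]
  exact div_le_div_of_nonneg_right
    (unlinked_main_sum_le φ hφ N hN P h1 h2 h3 x (w x) hx hwx.1 hwx.2) (Nat.cast_nonneg x)

end MainSumAsymptotic

theorem sum_curry {P A : Type*} [Fintype P] [DecidableEq P] [Fintype A] (k : ℕ)
    (G : Fin k → (P → A) → ℝ) :
    ∑ f : P → Fin k → A, ∏ j, G j (fun p => f p j) = ∏ j, ∑ g, G j g := by
  rw [Fintype.prod_sum]
  exact Fintype.sum_equiv (Equiv.piComm _) _ _ fun _ => rfl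

theorem wt_tupleOf {J : Type*} [Fintype J] [DecidableEq J] {n : ℕ} (hn : Squarefree n) (N : ℕ)
    (f : n.primeFactors → J) : wt N (tupleOf f) = (1 / N : ℝ) ^ n.primeFactors.card := by
  unfold wt
  rw [prod_primeFactors_tupleOf hn f (fun _ _ => (1 / N : ℝ))]
  simp

theorem tupleOf_ne_one_iff {J : Type*} [Fintype J] [DecidableEq J] {n : ℕ}
    (f : n.primeFactors → J) (j : J) : tupleOf f j ≠ 1 ↔ ∃ p, f p = j := by
  constructor
  · intro h
    by_contra hc
    push Not at hc
    exact h (prod_eq_one fun p _ => if_neg (hc p))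
  · rintro ⟨p, hp⟩ h
    have := (dvd_tupleOf_iff f j p).2 hp
    rw [h, Nat.dvd_one] at this
    exact (Nat.prime_of_mem_primeFactors p.2).one_lt.ne' this

/-- The product of symbols attached to a colouring of the prime factors of `n`. -/
def colorSym {n : ℕ} (g : n.primeFactors → Fin 3 × Bool) : ℝ :=
  ∏ q : n.primeFactors, ∏ p : n.primeFactors, (jacobiSym p q : ℝ) ^ colorExp (g q) (g p)

theorem symb_colorExpPow {n : ℕ} (k : ℕ) (f : n.primeFactors → Fin k → Fin 3 × Bool) :
    symb (colorExpPow k) (tupleOf f) = ∏ j, colorSym (fun p => f p j) := by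
  rw [symb_tupleOf]
  unfold colorSym colorExpPow
  symm
  rw [Finset.prod_comm]
  refine Finset.prod_congr rfl fun q _ => ?_
  rw [Finset.prod_comm]
  refine Finset.prod_congr rfl fun p _ => ?_
  exact Finset.prod_pow_eq_pow_sum _ _ _

/-- The colouring uses all three classes. -/
def UsesAll {n : ℕ} (g : n.primeFactors → Fin 3 × Bool) : Prop := ∀ c, ∃ p, (g p).1 = c

theorem sum_factTuples_filter {n : ℕ} (hn : Squarefree n) (k : ℕ)
    (Q : (Fin k → (n.primeFactors → Fin 3 × Bool) → Prop)) [∀ j, DecidablePred (Q j)]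
    (R : ((Fin k → Fin 3 × Bool) → ℕ) → Prop) [DecidablePred R]
    (hR : ∀ f : n.primeFactors → Fin k → Fin 3 × Bool,
      R (tupleOf f) ↔ ∀ j, Q j (fun p => f p j)) :
    ∑ D ∈ (factTuples (Fin k → Fin 3 × Bool) n).filter R,
      wt (3 ^ k) D * symb (colorExpPow k) D =
    ∏ j, ((1 / 3 ^ n.primeFactors.card) * ∑ g ∈ univ.filter (Q j), colorSym g) := by
  rw [sum_filter, sum_factTuples hn]
  have : ∀ f : n.primeFactors → Fin k → Fin 3 × Bool,
      (if R (tupleOf f) then wt (3 ^ k) (tupleOf f) * symb (colorExpPow k) (tupleOf f) else 0) =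
      (1 / 3 ^ n.primeFactors.card : ℝ) ^ k *
        ∏ j, if Q j (fun p => f p j) then colorSym (fun p => f p j) else 0 := by
    intro f
    rw [Finset.prod_ite_zero, wt_tupleOf hn, symb_colorExpPow]
    by_cases h : R (tupleOf f)
    · rw [if_pos h, if_pos fun j _ => (hR f).1 h j]
      congr 1
      push_cast
      rw [one_div_pow, one_div_pow, ← pow_mul, ← pow_mul, mul_comm]
    · rw [if_neg h, if_neg (fun h' => h ((hR f).2 fun j => h' j (mem_univ j))), mul_zero]
  rw [sum_congr rfl fun f _ => this f, ← mul_sum,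
    sum_curry k (fun j g => if Q j g then colorSym g else 0), prod_mul_distrib]
  simp only [prod_const, card_univ, Fintype.card_fin, sum_filter]

/-- The colours in `V` use all three classes in every component. -/
def CoversClasses {k : ℕ} (V : Finset (Fin k → Fin 3 × Bool)) : Prop :=
  ∀ (j : Fin k) (c : Fin 3), ∃ u ∈ V, (u j).1 = c

theorem sum_factTuples_usesAll {n : ℕ} (hn : Squarefree n) (k : ℕ) :
    ∑ D ∈ (factTuples (Fin k → Fin 3 × Bool) n).filter
      (fun D => CoversClasses (univ.filter fun u => D u ≠ 1)),
      wt (3 ^ k) D * symb (colorExpPow k) D =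
    ((1 / 3 ^ n.primeFactors.card) *
      ∑ g ∈ univ.filter (UsesAll (n := n)), colorSym g) ^ k := by
  rw [sum_factTuples_filter hn k (fun _ g => UsesAll g)]
  · simp
  · intro f
    refine forall_congr' fun j => forall_congr' fun c => ?_
    simp only [mem_filter, mem_univ, true_and, tupleOf_ne_one_iff]
    constructor
    · rintro ⟨u, ⟨p, rfl⟩, h⟩; exact ⟨p, h⟩
    · rintro ⟨p, h⟩; exact ⟨_, ⟨p, rfl⟩, h⟩

/-- Total of the symbols over colourings whose second component is constantly `true`. -/
def trueSum (n : ℕ) : ℝ :=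
  ∑ c : n.primeFactors → Fin 3, symb (fun i j : Fin 3 => if i ≠ j then 1 else 0) (tupleOf c)

theorem sum_colorSym_const (n : ℕ) (b : Bool) :
    ∑ g ∈ univ.filter (fun g : n.primeFactors → Fin 3 × Bool => ∀ p, (g p).2 = b), colorSym g =
      if b then trueSum n else 3 ^ n.primeFactors.card := by
  have h1 : ∑ g ∈ univ.filter (fun g : n.primeFactors → Fin 3 × Bool => ∀ p, (g p).2 = b),
      colorSym g = ∑ c : n.primeFactors → Fin 3, colorSym (fun p => (c p, b)) := by
    symm
    refine sum_bij (fun c _ p => (c p, b)) ?_ ?_ ?_ ?_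
    · intro c _; simp
    · intro c _ c' _ h
      ext p
      have := congrFun h p
      simpa [Prod.ext_iff, Fin.ext_iff] using this
    · intro g hg
      simp only [mem_filter, mem_univ, true_and] at hg
      exact ⟨fun p => (g p).1, mem_univ _, by ext p <;> simp [hg]⟩
    · intro c _; rfl
  rw [h1]
  cases b
  · simp [colorSym, colorExp]
  · simp only [if_true]
    unfold trueSum
    refine sum_congr rfl fun c _ => ?_
    rw [symb_tupleOf]
    simp [colorSym, colorExp]

theorem sum_factTuples_slices {n : ℕ} (hn : Squarefree n) (k : ℕ) :
    ∑ s : Fin k → Bool, ∑ D ∈ (factTuples (Fin k → Fin 3 × Bool) n).filter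
      (fun D => ∀ u ∉ colorSlice k s, D u = 1), wt (3 ^ k) D * symb (colorExpPow k) D =
    (1 + trueSum n / 3 ^ n.primeFactors.card) ^ k := by
  have h : ∀ s : Fin k → Bool, ∑ D ∈ (factTuples (Fin k → Fin 3 × Bool) n).filter
      (fun D => ∀ u ∉ colorSlice k s, D u = 1), wt (3 ^ k) D * symb (colorExpPow k) D =
      ∏ j, if s j then trueSum n / 3 ^ n.primeFactors.card else 1 := by
    intro s
    rw [sum_factTuples_filter hn k (fun j g => ∀ p, (g p).2 = s j)]
    · refine prod_congr rfl fun j _ => ?_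
      rw [sum_colorSym_const]
      cases s j
      · simp
      · simp [div_eq_inv_mul]
    · intro f
      constructor
      · intro h j p
        by_contra hc
        refine (tupleOf_ne_one_iff f (f p)).2 ⟨p, rfl⟩ (h (f p) fun hm => hc ?_)
        exact (mem_filter.1 hm).2 j
      · intro h u hu
        by_contra hc
        obtain ⟨p, rfl⟩ := (tupleOf_ne_one_iff f u).1 hc
        exact hu (mem_filter.2 ⟨mem_univ _, fun j => h j p⟩)
  rw [sum_congr rfl fun s _ => h s, ← Fintype.prod_sum
    (fun (_ : Fin k) (b : Bool) => if b then trueSum n / 3 ^ n.primeFactors.card else 1)]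
  simp [add_comm]

/-- The admissible integers below `x`. -/
def admSet (x : ℕ) : Finset ℕ := (range x).filter fun d => Squarefree d ∧ d % 4 = 1

theorem sum_tupSet_eq {J : Type*} [Fintype J] [DecidableEq J] (x : ℕ) (R : (J → ℕ) → Prop)
    [DecidablePred R] (G : (J → ℕ) → ℝ) :
    ∑ D ∈ (tupSet J x).filter R, G D =
      ∑ d ∈ admSet x, ∑ D ∈ (factTuples J d).filter R, G D := by
  rw [← sum_fiberwise_of_maps_to (g := fun D : J → ℕ => ∏ j, D j) (t := admSet x)]
  · refine sum_congr rfl fun d hd => sum_congr ?_ fun _ _ => rfl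
    simp only [admSet, mem_filter, mem_range] at hd
    ext D
    simp only [mem_filter, mem_tupSet, mem_factTuples hd.2.1.ne_zero]
    constructor
    · rintro ⟨⟨-, h⟩, h'⟩; exact ⟨h', h⟩
    · rintro ⟨rfl, h⟩; exact ⟨⟨⟨hd.2.1, hd.2.2, hd.1⟩, h⟩, rfl⟩
  · intro D hD
    obtain ⟨h1, h2, h3⟩ := mem_tupSet.1 (mem_filter.1 hD).1
    simp only [admSet, mem_filter, mem_range]
    exact ⟨h3, h1, h2⟩

theorem colorExpPow_self (k : ℕ) (u : Fin k → Fin 3 × Bool) : colorExpPow k u u = 0 :=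
  sum_eq_zero fun j _ => if_neg fun h => h.1 rfl

theorem unlinked_colorSlice (k : ℕ) (s : Fin k → Bool) :
    Unlinked (colorExpPow k) (colorSlice k s) := fun u hu v hv =>
  even_link_of_snd_eq k u v fun j => by
    rw [(mem_filter.1 hu).2 j, (mem_filter.1 hv).2 j]

theorem colorSlice_injective (k : ℕ) : Function.Injective (colorSlice k) := by
  intro s t h
  have hm : (fun j => ((0 : Fin 3), s j)) ∈ colorSlice k s := mem_filter.2 ⟨mem_univ _, fun _ => rfl⟩
  rw [h] at hm
  funext j
  exact (mem_filter.1 hm).2 j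

/-- The moments are asymptotically those of `1 + trueSum n / 3 ^ ω(n)`. -/
theorem tendsto_moment_sub (k : ℕ) (hk : 1 ≤ k) :
    Tendsto (fun x : ℕ =>
      (∑ d ∈ admSet x, ((1 / 3 ^ d.primeFactors.card) *
          ∑ g ∈ univ.filter (UsesAll (n := d)), colorSym g) ^ k -
        ∑ d ∈ admSet x, (1 + trueSum d / 3 ^ d.primeFactors.card) ^ k) / (x : ℝ))
      atTop (nhds 0) := by
  have hN : 2 ≤ 3 ^ k := le_trans (by norm_num) (Nat.pow_le_pow_right (by norm_num : 0 < 3) hk)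
  refine (tendsto_unlinked_main_sum (colorExpPow k) (colorExpPow_self k) (3 ^ k) hN
    CoversClasses ?_ ?_ ?_).congr fun x => ?_
  · exact fun U hU => (unlinked_card_le k U hU).1
  · intro U hU hc v hv
    obtain ⟨s, rfl⟩ := (unlinked_card_le k U hU).2 hc
    exact exists_linked_unlinked k s v hv
  · intro U hU hc V hUV j c
    obtain ⟨s, rfl⟩ := (unlinked_card_le k U hU).2 hc
    exact ⟨fun i => (c, s i), hUV (mem_filter.2 ⟨mem_univ _, fun _ => rfl⟩), rfl⟩
  · have hU : univ.filter (fun U => Unlinked (colorExpPow k) U ∧ U.card = 3 ^ k) =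
        univ.map ⟨colorSlice k, colorSlice_injective k⟩ := by
      ext U
      simp only [mem_filter, mem_univ, true_and, Finset.mem_map, Function.Embedding.coeFn_mk]
      constructor
      · rintro ⟨h, hc⟩
        obtain ⟨s, rfl⟩ := (unlinked_card_le k U h).2 hc
        exact ⟨s, rfl⟩
      · rintro ⟨s, rfl⟩
        exact ⟨unlinked_colorSlice k s, card_colorSlice k s⟩
    congr 2
    · rw [sum_tupSet_eq]
      refine sum_congr rfl fun d hd => ?_
      exact sum_factTuples_usesAll (mem_filter.1 hd).2.1 k
    · rw [hU, Finset.sum_map]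
      simp only [Function.Embedding.coeFn_mk]
      rw [sum_congr rfl fun s _ => sum_tupSet_eq x _ _, Finset.sum_comm]
      refine sum_congr rfl fun d hd => ?_
      exact sum_factTuples_slices (mem_filter.1 hd).2.1 k

theorem jacobiSym_mul_swap {a b : ℕ} (ha : Odd a) (hb : Odd b) (hab : a.Coprime b) :
    (jacobiSym a b : ℝ) * jacobiSym b a = if a % 4 = 3 ∧ b % 4 = 3 then -1 else 1 := by
  have hsq := jacobiSym_sq_eq_one_real hab.symm
  rw [sq] at hsq
  rcases Nat.odd_mod_four_iff.1 (Nat.odd_iff.1 ha) with h | h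
  · rw [jacobiSym.quadratic_reciprocity_one_mod_four h hb, if_neg (by omega), hsq]
  · rcases Nat.odd_mod_four_iff.1 (Nat.odd_iff.1 hb) with h' | h'
    · rw [jacobiSym.quadratic_reciprocity_one_mod_four' ha h', if_neg (by omega), hsq]
    · rw [jacobiSym.quadratic_reciprocity_three_mod_four h h', if_pos ⟨h, h'⟩]
      push_cast
      linarith

theorem qchar_true_one {a : ℕ} (ha : Odd a) :
    qchar true 1 a = if a % 4 = 3 then -1 else 1 := by
  rw [qchar_apply ha.pos.ne']
  unfold qsym
  rw [jacobiSym.one_right]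
  rcases Nat.odd_mod_four_iff.1 (Nat.odd_iff.1 ha) with h | h
  · rw [if_neg (show ¬ a % 4 = 3 by omega)]
    simp [ZMod.χ₄_nat_one_mod_four h]
  · rw [if_pos h]
    simp [ZMod.χ₄_nat_three_mod_four h]

theorem symb_three_eq {D : Fin 3 → ℕ} (hsq : Squarefree (∏ i, D i)) (h4 : (∏ i, D i) % 4 = 1) :
    symb (fun i j : Fin 3 => if i ≠ j then 1 else 0) D =
      -1 / 2 + 1 / 2 * ∑ i, qchar true 1 (D i) := by
  have hodd : ∀ i, Odd (D i) := fun i =>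
    Odd.of_dvd_nat (Nat.odd_iff.2 (by omega)) (dvd_prod_of_mem D (mem_univ i))
  have hc : ∀ i j, i ≠ j → (D i).Coprime (D j) := fun i j h => coprime_of_prod_squarefree hsq h
  have e01 := jacobiSym_mul_swap (hodd 0) (hodd 1) (hc 0 1 (by decide))
  have e02 := jacobiSym_mul_swap (hodd 0) (hodd 2) (hc 0 2 (by decide))
  have e12 := jacobiSym_mul_swap (hodd 1) (hodd 2) (hc 1 2 (by decide))
  have e : symb (fun i j : Fin 3 => if i ≠ j then 1 else 0) D =
      ((jacobiSym (D 0) (D 1) : ℝ) * jacobiSym (D 1) (D 0)) *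
      ((jacobiSym (D 0) (D 2) : ℝ) * jacobiSym (D 2) (D 0)) *
      ((jacobiSym (D 1) (D 2) : ℝ) * jacobiSym (D 2) (D 1)) := by
    simp only [symb, Fin.prod_univ_three, Fin.isValue, show (0 : Fin 3) ≠ 1 by decide,
      show (0 : Fin 3) ≠ 2 by decide, show (1 : Fin 3) ≠ 0 by decide,
      show (1 : Fin 3) ≠ 2 by decide, show (2 : Fin 3) ≠ 0 by decide,
      show (2 : Fin 3) ≠ 1 by decide, ne_eq, not_true_eq_false, not_false_eq_true, if_true,
      if_false, pow_one, pow_zero]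
    ring
  rw [e, e01, e02, e12, Fin.sum_univ_three, qchar_true_one (hodd 0), qchar_true_one (hodd 1),
    qchar_true_one (hodd 2)]
  rw [Fin.prod_univ_three, Nat.mul_mod, Nat.mul_mod (D 0)] at h4
  have hm : ∀ i, D i % 4 = 1 ∨ D i % 4 = 3 := fun i =>
    Nat.odd_mod_four_iff.1 (Nat.odd_iff.1 (hodd i))
  rcases hm 0 with h0 | h0 <;> rcases hm 1 with h1 | h1 <;> rcases hm 2 with h2 | h2 <;>
    first
    | (exfalso; simp only [h0, h1, h2] at h4; omega)
    | (rw [h0, h1, h2]; norm_num)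

theorem qchar_eq_prod {n : ℕ} (hn : Squarefree n) (ε : Bool) (Q : ℕ) :
    qchar ε Q n = ∏ p ∈ n.primeFactors, qchar ε Q p := by
  conv_lhs => rw [← Nat.prod_primeFactors_of_squarefree hn, map_prod]

/-- The mean of `(2 + χ₄(p)) / 3`. -/
def chiMean (d : ℕ) : ℝ := ∏ p ∈ d.primeFactors, (1 - (1 - qchar true 1 p) / (3 : ℕ))

theorem trueSum_eq {d : ℕ} (hsq : Squarefree d) (h4 : d % 4 = 1) :
    trueSum d / 3 ^ d.primeFactors.card = -1 / 2 + 3 / 2 * chiMean d := by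
  have h1 : trueSum d = ∑ D ∈ factTuples (Fin 3) d, (-1 / 2 + 1 / 2 * ∑ i, qchar true 1 (D i)) := by
    rw [sum_factTuples hsq]
    refine sum_congr rfl fun c _ => ?_
    have := prod_tupleOf hsq c
    exact symb_three_eq (by rwa [this]) (by rwa [this])
  have h2 : ∀ i : Fin 3, ∑ D ∈ factTuples (Fin 3) d, qchar true 1 (D i) =
      3 ^ d.primeFactors.card * chiMean d := by
    intro i
    have h := sum_factTuples_prod (J := Fin 3) hsq (fun j p => if j = i then qchar true 1 p else 1)
    have e : ∀ D ∈ factTuples (Fin 3) d, ∏ j, ∏ p ∈ (D j).primeFactors,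
        (if j = i then qchar true 1 p else 1) = qchar true 1 (D i) := by
      intro D hD
      rw [prod_eq_single i]
      · simp only [if_true]
        refine (qchar_eq_prod ?_ _ _).symm
        exact squarefree_of_prod_squarefree (by rwa [(mem_factTuples hsq.ne_zero).1 hD]) i
      · intro j _ hj
        simp [hj]
      · simp
    rw [sum_congr rfl e] at h
    rw [h, chiMean, ← prod_const, ← prod_mul_distrib]
    refine prod_congr rfl fun p _ => ?_
    have e' : ∀ j : Fin 3, (if j = i then qchar true 1 p else 1) =
        (if j = i then qchar true 1 p - 1 else 0) + 1 := by
      intro j; split_ifs <;> ring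
    rw [sum_congr rfl fun j _ => e' j, sum_add_distrib, sum_ite_eq' univ i, if_pos (mem_univ i)]
    simp only [sum_const, card_univ, Fintype.card_fin]
    push_cast
    ring
  have h3 : ((factTuples (Fin 3) d).card : ℝ) = 3 ^ d.primeFactors.card := by
    have h := sum_factTuples (J := Fin 3) hsq (fun _ => 1)
    simpa using h
  rw [h1, sum_add_distrib, ← mul_sum, Finset.sum_comm, sum_congr rfl fun i _ => h2 i, sum_const,
    sum_const, nsmul_eq_mul, h3, card_univ, Fintype.card_fin, nsmul_eq_mul]
  field_simp
  push_cast
  ring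

theorem chiMean_factor_mem (p : ℕ) :
    0 ≤ 1 - (1 - qchar true 1 p) / (3 : ℕ) ∧ 1 - (1 - qchar true 1 p) / (3 : ℕ) ≤ 1 := by
  have := abs_le.1 (abs_qchar_le true 1 p)
  push_cast
  constructor <;> linarith

theorem tendsto_chiMean :
    Tendsto (fun x : ℕ => (∑ d ∈ admSet x, chiMean d) / (x : ℝ)) atTop (nhds 0) := by
  have hnt : QNontrivial true 1 := ⟨odd_one, Or.inl ⟨rfl, rfl⟩⟩
  have h1 : Tendsto (fun x : ℕ => (1 + Real.log (4 * (1 : ℕ))) / (1 + Real.log x)) atTop (nhds 0) :=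
    tendsto_const_nhds.div_atTop (tendsto_atTop_add_const_left _ _ tendsto_log_natCast)
  have h2 := (h1.rpow_const (p := 1 / ((3 : ℕ) : ℝ)) (Or.inr (by positivity))).const_mul 24
  rw [Real.zero_rpow (by norm_num), mul_zero] at h2
  refine squeeze_zero' (Eventually.of_forall fun x => ?_) ?_ h2
  · exact div_nonneg (sum_nonneg fun d _ => prod_nonneg fun p _ => (chiMean_factor_mem p).1)
      (Nat.cast_nonneg x)
  · filter_upwards [eventually_ge_atTop 1] with x hx
    rw [div_le_iff₀ (by exact_mod_cast hx)]
    have h := sum_squarefree_qchar_le hnt 3 (by norm_num) x hx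
    have hle : ∑ d ∈ admSet x, chiMean d ≤ ∑ d ∈ (Icc 1 x).filter Squarefree, chiMean d := by
      refine sum_le_sum_of_subset_of_nonneg ?_
        fun d _ _ => prod_nonneg fun p _ => (chiMean_factor_mem p).1
      intro d hd
      simp only [admSet, mem_filter, mem_range] at hd
      exact mem_filter.2 ⟨mem_Icc.2 ⟨Nat.pos_of_ne_zero hd.2.1.ne_zero, hd.1.le⟩, hd.2.1⟩
    refine (hle.trans h).trans (le_of_eq ?_)
    ring

/-- The main term is asymptotically constant. -/
theorem tendsto_main_moment (k : ℕ) :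
    Tendsto (fun x : ℕ => (∑ d ∈ admSet x, (1 + trueSum d / 3 ^ d.primeFactors.card) ^ k -
      (admSet x).card * (1 / 2) ^ k) / (x : ℝ)) atTop (nhds 0) := by
  have h := tendsto_chiMean.const_mul (3 / 2 * k * 2 ^ (k - 1) : ℝ)
  rw [mul_zero] at h
  refine squeeze_zero_norm' (Eventually.of_forall fun x => ?_) h
  rw [Real.norm_eq_abs, abs_div, Nat.abs_cast, ← mul_div_assoc]
  refine div_le_div_of_nonneg_right ?_ (Nat.cast_nonneg x)
  rw [← nsmul_eq_mul, ← sum_const, ← sum_sub_distrib, mul_sum]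
  refine (abs_sum_le_sum_abs _ _).trans (sum_le_sum fun d hd => ?_)
  simp only [admSet, mem_filter, mem_range] at hd
  rw [trueSum_eq hd.2.1 hd.2.2]
  have h0 : 0 ≤ chiMean d := prod_nonneg fun p _ => (chiMean_factor_mem p).1
  have h1 : chiMean d ≤ 1 :=
    prod_le_one (fun p _ => (chiMean_factor_mem p).1) fun p _ => (chiMean_factor_mem p).2
  refine (abs_pow_sub_pow_le _ _ k).trans ?_
  have e1 : |1 + (-1 / 2 + 3 / 2 * chiMean d) - 1 / 2| = 3 / 2 * chiMean d := by
    rw [show 1 + (-1 / 2 + 3 / 2 * chiMean d) - 1 / 2 = 3 / 2 * chiMean d by ring,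
      abs_of_nonneg (by positivity)]
  have e2 : max |1 + (-1 / 2 + 3 / 2 * chiMean d)| |(1 / 2 : ℝ)| ≤ 2 := by
    refine max_le ?_ (by norm_num [abs_of_pos])
    rw [abs_of_nonneg (by linarith)]
    linarith
  rw [e1]
  calc 3 / 2 * chiMean d * k * max |1 + (-1 / 2 + 3 / 2 * chiMean d)| |(1 / 2 : ℝ)| ^ (k - 1)
      ≤ 3 / 2 * chiMean d * k * 2 ^ (k - 1) := by gcongr
    _ = _ := by ring

/-- The discriminant `±n ≡ 1 (mod 4)` attached to an odd `n`. -/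
def oddDisc (n : ℕ) : ℤ := if n % 4 = 1 then n else -n

theorem natAbs_oddDisc (n : ℕ) : (oddDisc n).natAbs = n := by
  unfold oddDisc; split_ifs <;> simp

theorem oddDisc_mod_four {n : ℕ} (hn : Odd n) : oddDisc n % 4 = 1 := by
  have := Nat.odd_iff.1 hn
  unfold oddDisc; split_ifs <;> omega

theorem oddDisc_natAbs {t : ℤ} (ht : t % 4 = 1) : oddDisc t.natAbs = t := by
  unfold oddDisc; split_ifs <;> omega

theorem oddDisc_mul {a b : ℕ} (ha : Odd a) (hb : Odd b) :
    oddDisc (a * b) = oddDisc a * oddDisc b := by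
  have h1 := oddDisc_natAbs (t := oddDisc a * oddDisc b)
    (by rw [Int.mul_emod, oddDisc_mod_four ha, oddDisc_mod_four hb]; rfl)
  rwa [Int.natAbs_mul, natAbs_oddDisc, natAbs_oddDisc] at h1

theorem jacobiSym_oddDisc {a p : ℕ} (ha : Odd a) (hp : Odd p) :
    jacobiSym (oddDisc a) p = jacobiSym p a := by
  unfold oddDisc
  split_ifs with h
  · exact jacobiSym.quadratic_reciprocity_one_mod_four h hp
  · have h3 : a % 4 = 3 := by have := Nat.odd_iff.1 ha; omega
    rw [neg_eq_neg_one_mul, jacobiSym.mul_left, jacobiSym.at_neg_one hp]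
    rcases Nat.odd_mod_four_iff.1 (Nat.odd_iff.1 hp) with h1 | h1
    · rw [ZMod.χ₄_nat_one_mod_four h1, one_mul]
      exact (jacobiSym.quadratic_reciprocity_one_mod_four h1 ha).symm
    · rw [ZMod.χ₄_nat_three_mod_four h1, neg_one_mul,
        jacobiSym.quadratic_reciprocity_three_mod_four h3 h1, neg_neg]

theorem kron_oddDisc_mul {a b p : ℕ} (ha : Odd a) (hb : Odd b) (hp : Odd p) :
    kron (oddDisc a * oddDisc b) p = jacobiSym p a * jacobiSym p b := by
  unfold kron
  rw [if_neg (by rintro rfl; exact absurd hp (by decide)), jacobiSym.mul_left,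
    jacobiSym_oddDisc ha hp, jacobiSym_oddDisc hb hp]

theorem isFundDisc_mod_four {t : ℤ} (ht : IsFundDisc t) (hodd : t % 2 = 1) : t % 4 = 1 := by
  rcases ht with h | ⟨m, rfl, -⟩
  · exact h.1
  · omega

/-- The summand of `ftilde` in terms of a factorization of `|d|`. -/
def factTerm (D : Fin 3 → ℕ) : ℝ :=
  ∏ i, ∏ p ∈ (D i).primeFactors, (1 + ∏ j, if j ≠ i then (jacobiSym p (D j) : ℝ) else 1)

theorem tripleTerm_oddDisc {D : Fin 3 → ℕ} (hodd : ∀ i, Odd (D i)) :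
    (tripleTerm (oddDisc (D 0), oddDisc (D 1), oddDisc (D 2)) : ℝ) = factTerm D := by
  unfold tripleTerm factTerm
  simp only [natAbs_oddDisc]
  have hp : ∀ i, ∀ p ∈ (D i).primeFactors, Odd p := fun i p hp =>
    (hodd i).of_dvd_nat (Nat.dvd_of_mem_primeFactors hp)
  rw [Fin.prod_univ_three]
  push_cast
  rw [mul_comm, ← mul_assoc, mul_right_comm]
  congr 1
  · congr 1
    · refine prod_congr rfl fun p h => ?_
      rw [kron_oddDisc_mul (hodd 1) (hodd 2) (hp 0 p h), Fin.prod_univ_three]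
      simp
    · refine prod_congr rfl fun p h => ?_
      rw [kron_oddDisc_mul (hodd 0) (hodd 2) (hp 1 p h), Fin.prod_univ_three]
      simp
  · refine prod_congr rfl fun p h => ?_
    rw [kron_oddDisc_mul (hodd 0) (hodd 1) (hp 2 p h), Fin.prod_univ_three]
    simp

theorem sum_fdTriples {d : ℕ} (hsq : Squarefree d) (h4 : d % 4 = 1) :
    ∑ t ∈ fdTriples d, (tripleTerm t : ℝ) =
      ∑ D ∈ (factTuples (Fin 3) d).filter (fun D => ∀ i, D i ≠ 1), factTerm D := by
  have hdodd : Odd d := Nat.odd_iff.2 (by omega)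
  symm
  have hfacts : ∀ D ∈ (factTuples (Fin 3) d).filter (fun D => ∀ i, D i ≠ 1),
      (∏ i, D i = d) ∧ (∀ i, D i ≠ 1) ∧ (∀ i, Odd (D i)) ∧ ∀ i, Squarefree (D i) := by
    intro D hD
    obtain ⟨h1, h2⟩ := mem_filter.1 hD
    rw [mem_factTuples hsq.ne_zero] at h1
    refine ⟨h1, h2, fun i => ?_, squarefree_of_prod_squarefree (by rwa [h1])⟩
    exact hdodd.of_dvd_nat (h1 ▸ dvd_prod_of_mem D (mem_univ i))
  refine sum_bij (fun D _ => (oddDisc (D 0), oddDisc (D 1), oddDisc (D 2))) ?_ ?_ ?_ ?_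
  · intro D hD
    obtain ⟨hp, hne, hodd, hsqD⟩ := hfacts D hD
    have hle : ∀ i, D i ≤ d := fun i =>
      Nat.le_of_dvd hdodd.pos (hp ▸ dvd_prod_of_mem D (mem_univ i))
    have hIcc : ∀ i, oddDisc (D i) ∈ Icc (-((d : ℤ).natAbs : ℤ)) ((d : ℤ).natAbs : ℤ) := by
      intro i
      have h1 := hle i
      have h2 := natAbs_oddDisc (D i)
      rw [mem_Icc]; omega
    have hfd : ∀ i, IsFundDisc (oddDisc (D i)) := fun i =>
      Or.inl ⟨oddDisc_mod_four (hodd i),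
        Int.squarefree_natAbs.1 (by rw [natAbs_oddDisc]; exact hsqD i)⟩
    have hne1 : ∀ i, oddDisc (D i) ≠ 1 := by
      intro i h
      apply hne i
      rw [← natAbs_oddDisc (D i), h]; rfl
    have hcop : ∀ i j, i ≠ j → IsCoprime (oddDisc (D i)) (oddDisc (D j)) := by
      intro i j hij
      rw [Int.isCoprime_iff_gcd_eq_one, Int.gcd, natAbs_oddDisc, natAbs_oddDisc]
      exact coprime_of_prod_squarefree (by rwa [hp]) hij
    simp only [fdTriples, mem_filter, mem_product]
    refine ⟨⟨hIcc 0, hIcc 1, hIcc 2⟩, hfd 0, hfd 1, hfd 2, hne1 0, hne1 1, hne1 2,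
      hcop 0 1 (by decide), hcop 0 2 (by decide), hcop 1 2 (by decide), ?_⟩
    rw [← oddDisc_mul (hodd 0) (hodd 1), ← oddDisc_mul ((hodd 0).mul (hodd 1)) (hodd 2),
      ← Fin.prod_univ_three, hp, oddDisc, if_pos h4]
  · intro D _ E _ h
    simp only [Prod.mk.injEq] at h
    obtain ⟨h0, h1, h2⟩ := h
    have key : ∀ {a b : ℕ}, oddDisc a = oddDisc b → a = b := by
      intro a b h
      rw [← natAbs_oddDisc a, h, natAbs_oddDisc]
    funext i
    fin_cases i
    · exact key h0
    · exact key h1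
    · exact key h2
  · rintro ⟨a, b, c⟩ ht
    simp only [fdTriples, mem_filter, mem_product] at ht
    obtain ⟨-, fa, fb, fc, na, nb, nc, -, -, -, habc⟩ := ht
    have hoddd : Odd (a * b * c) := by rw [habc]; exact_mod_cast hdodd
    have ha := isFundDisc_mod_four fa (Int.odd_iff.1 (Int.odd_mul.1 (Int.odd_mul.1 hoddd).1).1)
    have hb := isFundDisc_mod_four fb (Int.odd_iff.1 (Int.odd_mul.1 (Int.odd_mul.1 hoddd).1).2)
    have hc := isFundDisc_mod_four fc (Int.odd_iff.1 (Int.odd_mul.1 hoddd).2)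
    refine ⟨![a.natAbs, b.natAbs, c.natAbs], ?_, ?_⟩
    · rw [mem_filter, mem_factTuples hsq.ne_zero, Fin.prod_univ_three]
      refine ⟨?_, ?_⟩
      · have := congrArg Int.natAbs habc
        rw [Int.natAbs_mul, Int.natAbs_mul] at this
        simpa using this
      · intro i
        fin_cases i
        · change a.natAbs ≠ 1; omega
        · change b.natAbs ≠ 1; omega
        · change c.natAbs ≠ 1; omega
    · simp [oddDisc_natAbs ha, oddDisc_natAbs hb, oddDisc_natAbs hc]
  · intro D hD
    exact (tripleTerm_oddDisc (hfacts D hD).2.2.1).symm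

theorem factTerm_tupleOf {d : ℕ} (hsq : Squarefree d) (c : d.primeFactors → Fin 3) :
    factTerm (tupleOf c) = ∑ b : d.primeFactors → Bool, colorSym (fun p => (c p, b p)) := by
  unfold factTerm
  rw [prod_primeFactors_tupleOf hsq c
    (fun i p => 1 + ∏ j, if j ≠ i then (jacobiSym p (tupleOf c j) : ℝ) else 1)]
  have h1 : ∀ p : d.primeFactors,
      (1 + ∏ j, if j ≠ c p then (jacobiSym p (tupleOf c j) : ℝ) else 1) =
      ∑ b : Bool, ∏ q : d.primeFactors,
        (jacobiSym p q : ℝ) ^ (if c q ≠ c p ∧ b = true then 1 else 0) := by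
    intro p
    rw [Fintype.sum_bool, add_comm]
    congr 1
    · have h2 : ∀ j, (if j ≠ c p then (jacobiSym p (tupleOf c j) : ℝ) else 1) =
          ∏ q with c q = j, (jacobiSym p q : ℝ) ^ (if c q ≠ c p ∧ true = true then 1 else 0) := by
        intro j
        split_ifs with hj
        · rw [tupleOf, ← prod_filter, jacobiSym_prod_right _ _ _ fun q _ =>
            (Nat.prime_of_mem_primeFactors q.2).ne_zero]
          push_cast
          refine prod_congr rfl fun q hq => ?_
          rw [(mem_filter.1 hq).2, if_pos ⟨hj, rfl⟩, pow_one]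
        · refine (prod_eq_one fun q hq => ?_).symm
          rw [(mem_filter.1 hq).2, if_neg (fun h => hj h.1), pow_zero]
      rw [prod_congr rfl fun j _ => h2 j, prod_fiberwise]
    · simp
  rw [prod_congr rfl fun p _ => h1 p, Fintype.prod_sum]
  refine sum_congr rfl fun b _ => ?_
  unfold colorSym colorExp
  rw [Finset.prod_comm]

theorem ftilde_eq {d : ℕ} (hsq : Squarefree d) (h4 : d % 4 = 1) :
    ftilde d = 1 / 96 * ∑ g ∈ univ.filter (UsesAll (n := d)), colorSym g := by
  have ha : alphaFD d = 1 := if_pos (by omega)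
  rw [ftilde, ha, sum_fdTriples hsq h4, sum_filter, sum_factTuples hsq, sum_filter]
  congr 1
  · norm_num
  · rw [← (Equiv.arrowProdEquivProdArrow d.primeFactors (fun _ => Fin 3) (fun _ => Bool)).symm.sum_comp,
      Fintype.sum_prod_type]
    refine sum_congr rfl fun c _ => ?_
    have hiff : ∀ b : d.primeFactors → Bool,
        UsesAll ((Equiv.arrowProdEquivProdArrow d.primeFactors (fun _ => Fin 3)
          (fun _ => Bool)).symm (c, b)) ↔ ∀ i, tupleOf c i ≠ 1 := by
      intro b
      simp only [tupleOf_ne_one_iff]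
      rfl
    simp only [hiff]
    split_ifs with h
    · exact factTerm_tupleOf hsq c
    · simp

theorem sum_inv_sq_le {B : ℕ} (hB : 1 ≤ B) :
    ∑ b ∈ Icc 2 B, 1 / (b : ℝ) ^ 2 ≤ 2 / 3 - 1 / ((B : ℝ) + 1 / 2) := by
  induction B, hB using Nat.le_induction with
  | base => norm_num
  | succ n hn ih =>
    rw [sum_Icc_succ_top (by omega)]
    have h : 1 / ((n + 1 : ℕ) : ℝ) ^ 2 ≤
        1 / ((n : ℝ) + 1 / 2) - 1 / (((n + 1 : ℕ) : ℝ) + 1 / 2) := by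
      rw [div_sub_div _ _ (by positivity) (by positivity),
        div_le_div_iff₀ (by positivity) (by positivity)]
      push_cast
      nlinarith
    linarith

theorem card_filter_sq_dvd_le (x : ℕ) {b : ℕ} (hb : 0 < b) :
    ((range x).filter fun n => n % 4 = 1 ∧ b * b ∣ n).card ≤ x / (b * b) / 4 + 1 := by
  rw [← card_range (x / (b * b) / 4 + 1)]
  have hbb : 0 < b * b := Nat.mul_pos hb hb
  have key : ∀ q, b * b * q % 4 = 1 → q % 4 = 1 := by
    intro q hq
    have h4 : b * b % 4 = 0 ∨ b * b % 4 = 1 := by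
      rw [Nat.mul_mod]
      have : b % 4 < 4 := Nat.mod_lt _ (by norm_num)
      interval_cases b % 4 <;> simp
    rw [Nat.mul_mod] at hq
    rcases h4 with h | h <;> rw [h] at hq <;> omega
  refine card_le_card_of_injOn (fun n => n / (b * b) / 4) ?_ ?_
  · intro n hn
    simp only [coe_filter, mem_range, Set.mem_ofPred_eq] at hn
    simp only [coe_range, Set.mem_Iio]
    have := Nat.div_le_div_right (c := 4) (Nat.div_le_div_right (c := b * b) hn.1.le)
    omega
  · intro n hn m hm h
    simp only [coe_filter, mem_range, Set.mem_ofPred_eq] at hn hm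
    obtain ⟨-, hn4, q, rfl⟩ := hn
    obtain ⟨-, hm4, r, rfl⟩ := hm
    simp only [Nat.mul_div_cancel_left _ hbb] at h
    have := key q hn4
    have := key r hm4
    rw [show q = r by omega]

theorem card_filter_mod_four_le (x : ℕ) :
    (x + 2) / 4 ≤ ((range x).filter fun n => n % 4 = 1).card := by
  rw [← card_range ((x + 2) / 4)]
  refine card_le_card_of_injOn (fun j => 4 * j + 1) ?_ ?_
  · intro j hj
    simp only [coe_range, Set.mem_Iio] at hj
    simp only [coe_filter, mem_range, Set.mem_ofPred_eq]
    omega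
  · intro i _ j _ h
    simp only at h
    omega

theorem le_card_admSet {x : ℕ} (hx : 900 ≤ x) : (x : ℝ) / 24 ≤ (admSet x).card := by
  have hsub : ((range x).filter fun n => n % 4 = 1) ⊆ admSet x ∪
      (Icc 2 x.sqrt).biUnion fun b => (range x).filter fun n => n % 4 = 1 ∧ b * b ∣ n := by
    intro n hn
    obtain ⟨hn, h4⟩ := mem_filter.1 hn
    by_cases hsq : Squarefree n
    · exact mem_union_left _ (mem_filter.2 ⟨hn, hsq, h4⟩)
    · unfold Squarefree at hsq
      push Not at hsq
      obtain ⟨b, hbn, hb⟩ := hsq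
      rw [Nat.isUnit_iff] at hb
      have hb0 : b ≠ 0 := by rintro rfl; rw [zero_mul, zero_dvd_iff] at hbn; omega
      refine mem_union_right _ (mem_biUnion.2 ⟨b, mem_Icc.2 ⟨by omega, ?_⟩,
        mem_filter.2 ⟨hn, h4, hbn⟩⟩)
      exact Nat.le_sqrt.2 ((Nat.le_of_dvd (by omega) hbn).trans (mem_range.1 hn).le)
  have h1 := (card_filter_mod_four_le x).trans ((card_le_card hsub).trans
    ((card_union_le _ _).trans (Nat.add_le_add_left card_biUnion_le _)))
  have h2 : ((∑ b ∈ Icc 2 x.sqrt,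
      ((range x).filter fun n => n % 4 = 1 ∧ b * b ∣ n).card : ℕ) : ℝ) ≤ (x : ℝ) / 6 + (x.sqrt : ℝ) := by
    push_cast
    calc _ ≤ ∑ b ∈ Icc 2 x.sqrt, ((x : ℝ) / 4 * (1 / (b : ℝ) ^ 2) + 1) := by
          refine sum_le_sum fun b hb => ?_
          have hb0 : 0 < b := by have := (mem_Icc.1 hb).1; omega
          refine (Nat.cast_le.2 (card_filter_sq_dvd_le x hb0)).trans ?_
          push_cast
          gcongr
          rw [Nat.div_div_eq_div_mul]
          refine Nat.cast_div_le.trans (le_of_eq ?_)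
          push_cast
          field_simp
      _ ≤ (x : ℝ) / 6 + (x.sqrt : ℝ) := by
          rw [sum_add_distrib, ← mul_sum, sum_const, nsmul_eq_mul, mul_one]
          have hs1 : 1 ≤ x.sqrt := Nat.le_sqrt.2 (by omega)
          have h3 : ∑ b ∈ Icc 2 x.sqrt, 1 / (b : ℝ) ^ 2 ≤ 2 / 3 :=
            (sum_inv_sq_le hs1).trans (sub_le_self _ (by positivity))
          have h4 : ((Icc 2 x.sqrt).card : ℝ) ≤ x.sqrt := by
            rw [Nat.card_Icc]; exact_mod_cast (by omega)
          have h5 := mul_le_mul_of_nonneg_left h3 (show (0 : ℝ) ≤ x / 4 by positivity)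
          linarith
  have h3 : ((x : ℝ) - 1) / 4 ≤ ((x + 2) / 4 : ℕ) := by
    have : x ≤ 4 * ((x + 2) / 4) + 1 := by omega
    have : (x : ℝ) ≤ 4 * ((x + 2) / 4 : ℕ) + 1 := by exact_mod_cast this
    linarith
  have h4 : (((x + 2) / 4 : ℕ) : ℝ) ≤ (admSet x).card + ((∑ b ∈ Icc 2 x.sqrt,
      ((range x).filter fun n => n % 4 = 1 ∧ b * b ∣ n).card : ℕ) : ℝ) := by
    exact_mod_cast h1
  have h5 : (30 : ℝ) ≤ x.sqrt := by exact_mod_cast Nat.le_sqrt.2 (by omega)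
  have h6 : (x.sqrt : ℝ) * x.sqrt ≤ x := by exact_mod_cast Nat.sqrt_le x
  nlinarith

theorem DposOdd_eq (X : ℝ) :
    DposOdd X = ((admSet ⌈X⌉₊).erase 1).map Nat.castEmbedding := by
  ext d
  simp only [DposOdd, admSet, mem_filter, mem_Icc, Finset.mem_map, mem_erase, mem_range,
    Nat.castEmbedding_apply]
  constructor
  · rintro ⟨-, h1, hsq, h4, hX⟩
    lift d to ℕ using by omega
    refine ⟨d, ⟨by omega, Nat.lt_ceil.2 (by exact_mod_cast hX), ?_, by omega⟩, rfl⟩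
    have := Int.squarefree_natAbs.2 hsq
    simpa using this
  · rintro ⟨n, ⟨h1, hX, hsq, h4⟩, rfl⟩
    rw [Nat.lt_ceil] at hX
    have hpos := Nat.pos_of_ne_zero hsq.ne_zero
    refine ⟨⟨by omega, ?_⟩, by omega, ?_, by omega, by exact_mod_cast hX⟩
    · have : ((n : ℤ) : ℝ) ≤ ⌈X⌉ := (by exact_mod_cast hX.le : ((n : ℤ) : ℝ) ≤ X).trans (Int.le_ceil X)
      exact_mod_cast this
    · exact Int.squarefree_natAbs.1 (by simpa using hsq)

theorem sum_usesAll_one : ∑ g ∈ univ.filter (UsesAll (n := 1)), colorSym g = 0 := by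
  refine sum_eq_zero fun g hg => ?_
  obtain ⟨p, -⟩ := (mem_filter.1 hg).2 0
  exact absurd p.2 (by simp)

/-- The normalized `k`-th moment in terms of colorings. -/
theorem sum_DposOdd_eq {k : ℕ} (hk : 1 ≤ k) {X : ℝ} (hX : 2 ≤ ⌈X⌉₊) :
    (∑ d ∈ DposOdd X, (ftilde d / 3 ^ omegaZ d) ^ k) / ((DposOdd X).card : ℝ) =
      (1 / 96) ^ k * ((∑ d ∈ admSet ⌈X⌉₊, ((1 / 3 ^ d.primeFactors.card) *
        ∑ g ∈ univ.filter (UsesAll (n := d)), colorSym g) ^ k) /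
        ((admSet ⌈X⌉₊).card - 1)) := by
  have hmem : 1 ∈ admSet ⌈X⌉₊ := mem_filter.2 ⟨mem_range.2 (by omega), squarefree_one, rfl⟩
  rw [DposOdd_eq, card_map, Finset.sum_map, card_erase_of_mem hmem,
    Nat.cast_pred (card_pos.2 ⟨1, hmem⟩), ← mul_div_assoc, mul_sum, ← add_sum_erase _ _ hmem,
    sum_usesAll_one, mul_zero, zero_pow (by omega), mul_zero, zero_add]
  congr 1
  refine sum_congr rfl fun d hd => ?_
  obtain ⟨-, hsq, h4⟩ := mem_filter.1 (mem_of_mem_erase hd)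
  rw [Nat.castEmbedding_apply, ftilde_eq hsq h4, omegaZ, Int.natAbs_natCast, ← mul_pow]
  congr 1
  ring

theorem moments_point_mass_pos (k : ℕ) (hk : 1 ≤ k) :
    Tendsto
      (fun X : ℝ =>
        (∑ d ∈ DposOdd X, (ftilde d / 3 ^ omegaZ d) ^ k) / ((DposOdd X).card : ℝ))
      atTop (nhds ((1 / 192 : ℝ) ^ k)) := by
  have hinv : Tendsto (fun x : ℕ => (1 / 2 : ℝ) ^ k / (x : ℝ)) atTop (nhds 0) :=
    tendsto_const_nhds.div_atTop tendsto_natCast_atTop_atTop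
  have hnum := (((tendsto_moment_sub k hk).add (tendsto_main_moment k)).add hinv).abs.mul_const 48
  rw [add_zero, add_zero, abs_zero, zero_mul] at hnum
  have hmain : Tendsto (fun x : ℕ => (∑ d ∈ admSet x, ((1 / 3 ^ d.primeFactors.card) *
      ∑ g ∈ univ.filter (UsesAll (n := d)), colorSym g) ^ k) / (((admSet x).card : ℝ) - 1))
      atTop (nhds ((1 / 2) ^ k)) := by
    rw [← tendsto_sub_nhds_zero_iff]
    refine squeeze_zero_norm' ?_ hnum
    filter_upwards [eventually_ge_atTop 900] with x hx
    have hx' : (900 : ℝ) ≤ x := by exact_mod_cast hx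
    have hcard : (x : ℝ) / 48 ≤ (admSet x).card - 1 := by
      have := le_card_admSet hx
      linarith
    have hpos : (0 : ℝ) < (admSet x).card - 1 := by linarith
    generalize (((admSet x).card : ℕ) : ℝ) = A at *
    rw [Real.norm_eq_abs, div_sub' hpos.ne', ← add_div, ← add_div, abs_div, abs_div,
      abs_of_pos hpos, Nat.abs_cast, div_mul_eq_mul_div,
      div_le_div_iff₀ hpos (by linarith)]
    have e : ∀ S T c : ℝ, S - (A - 1) * c = S - T + (T - A * c) + c := by intros; ring
    rw [e _ (∑ d ∈ admSet x, (1 + trueSum d / 3 ^ d.primeFactors.card) ^ k)]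
    rw [mul_assoc]
    exact mul_le_mul_of_nonneg_left (by linarith) (abs_nonneg _)
  have h := ((hmain.comp (tendsto_nat_ceil_atTop (α := ℝ))).const_mul ((1 / 96 : ℝ) ^ k))
  rw [← mul_pow, show (1 / 96 * (1 / 2) : ℝ) = 1 / 192 by norm_num] at h
  refine h.congr' ?_
  filter_upwards [eventually_gt_atTop 1] with X hX
  exact (sum_DposOdd_eq hk (Nat.lt_ceil.2 (by exact_mod_cast hX))).symm
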